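/- Let f be a strictly non-real meromorphic function in the complex plane such that all but finitely many zeros and poles of f and of f'' are real, let g = f̃, and let H be the meromorphic function with finitely many zeros and poles satisfying f''/f = H·(g''/g), with H not identically equal to 1. Suppose that H is a rational function. Then N̄(r, f) + N̄(r, 1/f) = O(r) and T(r, f'/f) = O(r log r) as r → ∞. If, in addition, f has finite lower order and all zeros and poles of f and f'' are real, then f'/f is constant, i.e. f(z) = e^{A₁z + B₁} for some A₁, B₁ ∈ ℂ. -/

import Mathlib

open Complex Filter Topology MeasureTheory
open scoped Classical

noncomputable section

/-- `mtilde f` is the function `z ↦ conj (f (conj z))`, denoted `f̃` in the paper. -/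
def mtilde (f : ℂ → ℂ) : ℂ → ℂ := fun z => (starRingEnd ℂ) (f ((starRingEnd ℂ) z))

/-- Equality of meromorphic functions: near every point of `ℂ`, the two functions agree on a
punctured neighbourhood (so the set where they disagree is closed and discrete). -/
def MeroEq (h₁ h₂ : ℂ → ℂ) : Prop := ∀ z : ℂ, ∀ᶠ w in 𝓝[≠] z, h₁ w = h₂ w

/-- `f` is strictly non-real: `f̃` is not a constant multiple of `f`. -/
def StrictlyNonReal (f : ℂ → ℂ) : Prop := ¬ ∃ c : ℂ, MeroEq (mtilde f) (fun z => c * f z)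

/-- A rational function, as a meromorphic function on `ℂ`. -/
def IsRatFn (h : ℂ → ℂ) : Prop :=
  ∃ p q : Polynomial ℂ, q ≠ 0 ∧ MeroEq h (fun z => p.eval z / q.eval z)

/-- The order of vanishing (negative at a pole) of a function at a point, when the function is
meromorphic there; junk value `0` otherwise. -/
def meroOrder (h : ℂ → ℂ) (z : ℂ) : WithTop ℤ :=
  if hh : MeromorphicAt h z then meromorphicOrderAt h z else 0

/-- The positive part of the logarithm. -/
def logPlus (x : ℝ) : ℝ := max (Real.log x) 0

/-- The Nevanlinna proximity function `m(r, h)`. -/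
def proximity (h : ℂ → ℂ) (r : ℝ) : ℝ :=
  (2 * Real.pi)⁻¹ * ∫ θ in (0:ℝ)..(2 * Real.pi),
    logPlus ‖h ((r : ℂ) * Complex.exp (θ * Complex.I))‖

/-- The multiplicity of a pole of `h` at `z` (0 if not a pole). -/
def poleMult (h : ℂ → ℂ) (z : ℂ) : ℕ := (-((meroOrder h z).untopD 0)).toNat

/-- The number of poles, counted with multiplicity, in the closed disc of radius `t`. -/
def poleCount (h : ℂ → ℂ) (t : ℝ) : ℝ := ∑ᶠ z ∈ Metric.closedBall (0:ℂ) t, (poleMult h z : ℝ)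

/-- The integrated counting function `N(r, h)` of the poles of `h` (with multiplicity). -/
def NCount (h : ℂ → ℂ) (r : ℝ) : ℝ := ∫ t in (1:ℝ)..r, poleCount h t / t

/-- The Nevanlinna characteristic `T(r, h) = m(r, h) + N(r, h)`. -/
def TChar (h : ℂ → ℂ) (r : ℝ) : ℝ := proximity h r + NCount h r

/-- The number of points of `S` in the closed disc of radius `t`. -/
def distinctCount (S : Set ℂ) (t : ℝ) : ℝ := (S ∩ Metric.closedBall (0:ℂ) t).ncard

/-- The integrated counting function `N̄(r, h)` of the distinct poles of `h`. -/
def NbarPoles (h : ℂ → ℂ) (r : ℝ) : ℝ :=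
  ∫ t in (1:ℝ)..r, distinctCount {z | meroOrder h z < 0} t / t

/-- The integrated counting function `N̄(r, 1/h)` of the distinct zeros of `h`. -/
def NbarZeros (h : ℂ → ℂ) (r : ℝ) : ℝ :=
  ∫ t in (1:ℝ)..r, distinctCount {z | 0 < meroOrder h z} t / t

/-- `h` has finite (Nevanlinna) order: `T(r, h) ≤ r ^ C` for all large `r`. -/
def FiniteOrder (h : ℂ → ℂ) : Prop := ∃ C : ℝ, ∀ᶠ r in atTop, TChar h r ≤ r ^ C

/-- `h` has finite lower order: `T(r, h) ≤ r ^ C` for arbitrarily large `r`. -/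
def FiniteLowerOrder (h : ℂ → ℂ) : Prop := ∃ C : ℝ, ∃ᶠ r in atTop, TChar h r ≤ r ^ C

/-- The Setup of Section 3 of the paper: `M ≥ 4` and `f` is a strictly non-real meromorphic
function in the plane such that `f, f', …, f^(M+3)` all have finitely many non-real zeros. -/
def Setup (M : ℕ) (f : ℂ → ℂ) : Prop :=
  4 ≤ M ∧ (∀ z, MeromorphicAt f z) ∧ StrictlyNonReal f ∧
    ∀ m, m ≤ M + 3 → {z : ℂ | 0 < meroOrder (iteratedDeriv m f) z ∧ z.im ≠ 0}.Finite

/-- The function `F_m(z) = z - f^(m)(z) / f^(m+1)(z)`. -/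
def Fm (f : ℂ → ℂ) (m : ℕ) : ℂ → ℂ :=
  fun z => z - iteratedDeriv m f z / iteratedDeriv (m + 1) f z

/-- `Km` is the meromorphic function with finitely many zeros and poles satisfying
`F_m' = K_m G_m'`, where `G_m` is the analogue of `F_m` for `g = f̃`. -/
def IsKm (f : ℂ → ℂ) (m : ℕ) (Km : ℂ → ℂ) : Prop :=
  (∀ z, MeromorphicAt Km z) ∧ {z | 0 < meroOrder Km z}.Finite ∧
    {z | meroOrder Km z < 0}.Finite ∧
    MeroEq (deriv (Fm f m)) (fun z => Km z * deriv (Fm (mtilde f) m) z)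

end



section
set_option linter.all false
open Complex Filter Topology MeasureTheory
open scoped Classical
open Metric

/-- proximity on circles about the origin -/
noncomputable def mm (F : ℂ → ℂ) (ρ : ℝ) : ℝ :=
  Real.circleAverage (fun z => Real.posLog ‖F z‖) 0 ρ

theorem sphere_sub_ball {ρ : ℝ} (h0 : 0 ≤ ρ) (h1 : ρ < 1) :
    sphere (0:ℂ) |ρ| ⊆ ball 0 1 := by
  intro z hz
  rw [mem_sphere, abs_of_nonneg h0] at hz
  rw [mem_ball]; linarith

theorem mm_int {F : ℂ → ℂ} (hF : MeromorphicOn F (ball 0 1)) {ρ : ℝ} (h0 : 0 ≤ ρ) (h1 : ρ < 1) :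
    CircleIntegrable (fun z => Real.posLog ‖F z‖) 0 ρ :=
  MeromorphicOn.circleIntegrable_posLog_norm (fun z hz => hF z (sphere_sub_ball h0 h1 hz))

theorem avg_mono_cod {u v : ℂ → ℝ} {ρ : ℝ} (h0 : 0 < ρ)
    (hu : CircleIntegrable u 0 ρ) (hv : CircleIntegrable v 0 ρ)
    (h : ∀ᶠ z in codiscreteWithin (sphere (0:ℂ) |ρ|), u z ≤ v z) :
    Real.circleAverage u 0 ρ ≤ Real.circleAverage v 0 ρ := by
  have e : v =ᶠ[codiscreteWithin (sphere (0:ℂ) |ρ|)] fun z => max (u z) (v z) := by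
    filter_upwards [h] with z hz
    rw [max_eq_right hz]
  rw [Real.circleAverage_congr_codiscreteWithin e h0.ne']
  exact Real.circleAverage_mono hu (CircleIntegrable.congr_codiscreteWithin e hv)
    (fun x _ => le_max_left _ _)

theorem mm_nonneg (F : ℂ → ℂ) (ρ : ℝ) : 0 ≤ mm F ρ :=
  Real.circleAverage_nonneg_of_nonneg (fun x _ => Real.posLog_nonneg)

/-- codiscrete nonvanishing -/
theorem ana_ne_cod {F : ℂ → ℂ} (hF : AnalyticOnNhd ℂ F (ball 0 1)) (hne : ∃ z ∈ ball (0:ℂ) 1, F z ≠ 0)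
    {ρ : ℝ} (h0 : 0 ≤ ρ) (h1 : ρ < 1) :
    ∀ᶠ z in codiscreteWithin (sphere (0:ℂ) |ρ|), F z ≠ 0 := by
  have h : ∀ z ∈ ball (0:ℂ) 1, ∀ᶠ w in 𝓝[≠] z, F w ≠ 0 := by
    intro z hz
    rcases (hF z hz).eventually_eq_zero_or_eventually_ne_zero with h | h
    · exfalso
      obtain ⟨w, hw, hw'⟩ := hne
      exact hw' (hF.eqOn_zero_of_preconnected_of_eventuallyEq_zero
        (convex_ball 0 1).isPreconnected hz h hw)
    · exact h
  rw [Filter.Eventually, mem_codiscreteWithin]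
  intro x hx
  rw [Filter.disjoint_principal_right]
  have := h x (sphere_sub_ball h0 h1 hx)
  filter_upwards [this] with w hw
  simp [hw]

theorem mm_mul_le {F G : ℂ → ℂ} (hF : MeromorphicOn F (ball 0 1)) (hG : MeromorphicOn G (ball 0 1))
    {ρ : ℝ} (h0 : 0 ≤ ρ) (h1 : ρ < 1) : mm (fun z => F z * G z) ρ ≤ mm F ρ + mm G ρ := by
  unfold mm
  rw [← Real.circleAverage_fun_add (mm_int hF h0 h1) (mm_int hG h0 h1)]
  refine Real.circleAverage_mono (mm_int (fun z hz => (hF z hz).mul (hG z hz)) h0 h1)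
    ((mm_int hF h0 h1).add (mm_int hG h0 h1)) (fun x _ => ?_)
  rw [norm_mul]; exact Real.posLog_mul

theorem mm_add_le {F G : ℂ → ℂ} (hF : MeromorphicOn F (ball 0 1)) (hG : MeromorphicOn G (ball 0 1))
    {ρ : ℝ} (h0 : 0 ≤ ρ) (h1 : ρ < 1) :
    mm (fun z => F z + G z) ρ ≤ mm F ρ + mm G ρ + Real.log 2 := by
  unfold mm
  rw [← Real.circleAverage_fun_add (mm_int hF h0 h1) (mm_int hG h0 h1),
    ← Real.circleAverage_const (Real.log 2) (0:ℂ) ρ,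
    ← Real.circleAverage_fun_add (f₁ := fun z => Real.posLog ‖F z‖ + Real.posLog ‖G z‖) ((mm_int hF h0 h1).add (mm_int hG h0 h1)) (circleIntegrable_const _ _ _)]
  refine Real.circleAverage_mono (mm_int (fun z hz => (hF z hz).add (hG z hz)) h0 h1)
    (((mm_int hF h0 h1).add (mm_int hG h0 h1)).add (circleIntegrable_const _ _ _)) (fun x _ => ?_)
  have := Real.posLog_norm_add_le (F x) (G x)
  simp only [Pi.add_apply] 
  linarith

/-- Jensen lower bound and zero-count bound. -/
theorem jensen_bounds {F : ℂ → ℂ} (hF : AnalyticOnNhd ℂ F (ball 0 1))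
    (hne : ∃ z ∈ ball (0:ℂ) 1, F z ≠ 0) :
    ∃ C : ℝ, 0 ≤ C ∧ (∀ R, 1/2 ≤ R → R < 1 → -C ≤ Real.circleAverage (fun z => Real.log ‖F z‖) 0 R) ∧
      (∀ r R, 1/2 ≤ r → r < R → R < 1 →
        (∑ᶠ u, ((MeromorphicOn.divisor F (closedBall 0 r)) u : ℝ)) * Real.log (R / r)
          ≤ mm F R + C) := by
  have hmer : MeromorphicOn F (ball 0 1) := fun z hz => (hF z hz).meromorphicAt
  set d0 : ℤ := MeromorphicOn.divisor F (ball 0 1) 0 with hd0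
  have hdiv : ∀ r, 0 ≤ r → r < 1 → ∀ u ∈ closedBall (0:ℂ) r,
      MeromorphicOn.divisor F (closedBall 0 r) u = MeromorphicOn.divisor F (ball 0 1) u := by
    intro r h0 h1 u hu
    have hs : closedBall (0:ℂ) r ⊆ ball 0 1 := closedBall_subset_ball h1
    rw [MeromorphicOn.divisor_apply hmer (hs hu),
      MeromorphicOn.divisor_apply (fun z hz => hmer z (hs hz)) hu]
  have hnn : ∀ u, 0 ≤ MeromorphicOn.divisor F (ball 0 1) u :=
    fun u => (MeromorphicOn.AnalyticOnNhd.divisor_nonneg hF) u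
  have hd0' : (0:ℝ) ≤ d0 := by exact_mod_cast hnn 0
  set tc := Real.log ‖meromorphicTrailingCoeffAt F 0‖ with htc
  have hJ : ∀ R, 1/2 ≤ R → R < 1 → Real.circleAverage (fun z => Real.log ‖F z‖) 0 R =
      ∑ᶠ u, ((MeromorphicOn.divisor F (closedBall 0 R)) u : ℝ) * Real.log (R * ‖u‖⁻¹)
        + d0 * Real.log R + tc := by
    intro R h0 h1
    have hR : |R| = R := abs_of_nonneg (by linarith)
    have := MeromorphicOn.circleAverage_log_norm (c := 0) (R := R) (f := F) (by linarith)
      (fun z hz => hmer z (closedBall_subset_ball (by rwa [hR]) hz))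
    rw [this, hR, hdiv R (by linarith) h1 0 (by simp; linarith)]
    simp [hd0, htc]
  have hterm : ∀ R, 1/2 ≤ R → R < 1 → ∀ u, 0 ≤ ((MeromorphicOn.divisor F (closedBall 0 R)) u : ℝ) * Real.log (R * ‖u‖⁻¹) := by
    intro R h0 h1 u
    by_cases hu : u ∈ closedBall (0:ℂ) R
    · rw [hdiv R (by linarith) h1 u hu]
      apply mul_nonneg (by exact_mod_cast hnn u)
      rcases eq_or_ne u 0 with rfl | hu0
      · simp
      · apply Real.log_nonneg
        rw [← div_eq_mul_inv, le_div_iff₀ (norm_pos_iff.2 hu0)]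
        simpa using hu
    · rw [(MeromorphicOn.divisor F (closedBall 0 R)).apply_eq_zero_of_notMem hu]; simp
  have hfin : ∀ R, 1/2 ≤ R → R < 1 → (MeromorphicOn.divisor F (closedBall 0 R)).support.Finite :=
    fun R _ _ => (MeromorphicOn.divisor F (closedBall 0 R)).finiteSupport (isCompact_closedBall 0 R)
  have hlog : ∀ R:ℝ, 1/2 ≤ R → -Real.log 2 ≤ Real.log R := by
    intro R h
    rw [← Real.log_inv]; apply Real.log_le_log (by norm_num); linarith
  have hl2 : 0 ≤ Real.log 2 := Real.log_nonneg (by norm_num)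
  refine ⟨2 * d0 * Real.log 2 + |tc|, by positivity, ?_, ?_⟩
  · intro R h0 h1
    rw [hJ R h0 h1]
    have h1 := finsum_nonneg (hterm R h0 h1)
    have h2 := mul_le_mul_of_nonneg_left (hlog R h0) hd0'
    have h3 := neg_abs_le tc
    nlinarith [mul_nonneg hd0' hl2]
  · intro r R h0 hrR h1
    have hle : Real.circleAverage (fun z => Real.log ‖F z‖) 0 R ≤ mm F R := by
      apply Real.circleAverage_mono (MeromorphicOn.circleIntegrable_log_norm
        (fun z hz => hmer z (sphere_sub_ball (by linarith) h1 hz))) (mm_int hmer (by linarith) h1)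
      intro x _
      exact le_max_right _ _
    rw [hJ R (by linarith) h1] at hle
    have hr0 : (0:ℝ) < r := by linarith
    have key : (∑ᶠ u, ((MeromorphicOn.divisor F (closedBall 0 r)) u : ℝ)) * Real.log (R / r)
        ≤ ∑ᶠ u, ((MeromorphicOn.divisor F (closedBall 0 R)) u : ℝ) * Real.log (R * ‖u‖⁻¹) + d0 * Real.log 2 := by
      have hsub : (Function.support fun u => ((MeromorphicOn.divisor F (closedBall 0 r)) u : ℝ)) ⊆ ((hfin R (by linarith) h1).toFinset : Set ℂ) := by
        intro u hu
        simp only [Function.mem_support, ne_eq, Int.cast_eq_zero] at hu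
        have hur : u ∈ closedBall (0:ℂ) r := by
          by_contra h
          exact hu ((MeromorphicOn.divisor F (closedBall 0 r)).apply_eq_zero_of_notMem h)
        simp only [Set.Finite.coe_toFinset, Function.mem_support]
        rw [hdiv r hr0.le (by linarith) u hur] at hu
        rwa [hdiv R (by linarith) h1 u (closedBall_subset_closedBall hrR.le hur)]
      have hsub2 : (Function.support fun u => ((MeromorphicOn.divisor F (closedBall 0 R)) u : ℝ) * Real.log (R * ‖u‖⁻¹)) ⊆ ((hfin R (by linarith) h1).toFinset : Set ℂ) := by
        intro u hu
        simp only [Set.Finite.coe_toFinset, Function.mem_support]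
        intro h; simp [h] at hu
      rw [finsum_eq_sum_of_support_subset _ hsub, finsum_eq_sum_of_support_subset _ hsub2,
        Finset.sum_mul]
      have hz : d0 * Real.log 2 ≥ ∑ u ∈ (hfin R (by linarith) h1).toFinset, (if u = 0 then (d0:ℝ) * Real.log 2 else 0) := by
        rw [Finset.sum_ite_eq']
        split_ifs
        · exact le_rfl
        · positivity
      refine le_trans ?_ (add_le_add_right hz _)
      rw [← Finset.sum_add_distrib]
      apply Finset.sum_le_sum
      intro u _
      by_cases hu : u ∈ closedBall (0:ℂ) r
      · have huR := closedBall_subset_closedBall hrR.le hu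
        rw [hdiv r hr0.le (by linarith) u hu, hdiv R (by linarith) h1 u huR]
        split_ifs with h
        · subst h
          simp only [norm_zero, inv_zero, mul_zero, Real.log_zero, zero_add]
          apply mul_le_mul_of_nonneg_left _ hd0'
          apply Real.log_le_log (by apply div_pos <;> linarith)
          rw [div_le_iff₀ hr0]; linarith
        · rw [add_zero]
          apply mul_le_mul_of_nonneg_left _ (by exact_mod_cast hnn u)
          apply Real.log_le_log (by apply div_pos <;> linarith)
          rw [← div_eq_mul_inv]
          have : ‖u‖ ≤ r := by simpa using hu
          have hp := norm_pos_iff.2 h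
          gcongr
          linarith
      · rw [(MeromorphicOn.divisor F (closedBall 0 r)).apply_eq_zero_of_notMem hu]
        simp only [Int.cast_zero, zero_mul]
        have := hterm R (by linarith) h1 u
        split_ifs
        · positivity
        · linarith
    have h2 := mul_le_mul_of_nonneg_left (hlog R (by linarith)) hd0'
    have h3 := neg_abs_le tc
    linarith

end


section
set_option linter.all false
open Complex Filter Topology MeasureTheory
open scoped Classical
open Metric

theorem mm_inv_le {F : ℂ → ℂ} (hF : AnalyticOnNhd ℂ F (ball 0 1))
    (hne : ∃ z ∈ ball (0:ℂ) 1, F z ≠ 0) :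
    ∃ C : ℝ, 0 ≤ C ∧ ∀ R, 1/2 ≤ R → R < 1 → mm (fun z => (F z)⁻¹) R ≤ mm F R + C := by
  obtain ⟨C, hC, h1, -⟩ := jensen_bounds hF hne
  have hmer : MeromorphicOn F (ball 0 1) := fun z hz => (hF z hz).meromorphicAt
  refine ⟨C, hC, fun R h0 hR => ?_⟩
  have h2 := h1 R h0 hR
  have e : Real.circleAverage (fun z => Real.log ‖F z‖) 0 R = mm F R - mm (fun z => (F z)⁻¹) R := by
    unfold mm
    rw [← Real.circleAverage_fun_sub (mm_int hmer (by linarith) hR)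
      (mm_int (F := fun z => (F z)⁻¹) (fun z hz => (hmer z hz).inv) (by linarith) hR)]
    congr 1
    ext z
    rw [norm_inv]; exact Real.posLog_sub_posLog_inv.symm
  linarith

/-- factorization -/
theorem ana_factor {F : ℂ → ℂ} (hF : AnalyticOnNhd ℂ F (ball 0 1))
    (hne : ∃ z ∈ ball (0:ℂ) 1, F z ≠ 0) {r : ℝ} (h0 : 0 < r) (h1 : r < 1) :
    ∃ (S : Finset ℂ) (d : ℂ → ℕ) (G : ℂ → ℂ), (∀ u ∈ S, u ∈ closedBall (0:ℂ) r) ∧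
      AnalyticOnNhd ℂ G (closedBall 0 r) ∧ (∀ z ∈ closedBall (0:ℂ) r, G z ≠ 0) ∧
      (∀ z ∈ closedBall (0:ℂ) r, F z = (∏ u ∈ S, (z - u) ^ (d u)) * G z) ∧
      (∑ u ∈ S, (d u : ℝ)) = ∑ᶠ u, ((MeromorphicOn.divisor F (closedBall 0 r)) u : ℝ) := by
  have hs : closedBall (0:ℂ) r ⊆ ball 0 1 := closedBall_subset_ball h1
  have hF' : AnalyticOnNhd ℂ F (closedBall 0 r) := fun z hz => hF z (hs hz)
  have hmer : MeromorphicOn F (closedBall 0 r) := fun z hz => (hF z (hs hz)).meromorphicAt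
  have hfin : (MeromorphicOn.divisor F (closedBall 0 r)).support.Finite :=
    (MeromorphicOn.divisor F (closedBall 0 r)).finiteSupport (isCompact_closedBall 0 r)
  have hev : ∀ z ∈ ball (0:ℂ) 1, ∀ᶠ w in 𝓝[≠] z, F w ≠ 0 := by
    intro z hz
    rcases (hF z hz).eventually_eq_zero_or_eventually_ne_zero with h | h
    · exfalso
      obtain ⟨w, hw, hw'⟩ := hne
      exact hw' (hF.eqOn_zero_of_preconnected_of_eventuallyEq_zero
        (convex_ball 0 1).isPreconnected hz h hw)
    · exact h
  have hord : ∀ u : closedBall (0:ℂ) r, meromorphicOrderAt F u ≠ ⊤ := by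
    intro u
    rw [meromorphicOrderAt_ne_top_iff_eventually_ne_zero (hmer u u.2)]
    exact hev u (hs u.2)
  obtain ⟨G, hG, hG0, hFG⟩ := MeromorphicOn.extract_zeros_poles hmer hord hfin
  have hnn : ∀ u, 0 ≤ MeromorphicOn.divisor F (closedBall 0 r) u :=
    fun u => (MeromorphicOn.AnalyticOnNhd.divisor_nonneg hF') u
  refine ⟨hfin.toFinset, fun u => (MeromorphicOn.divisor F (closedBall 0 r) u).toNat, G, ?_, hG,
    fun z hz => hG0 ⟨z, hz⟩, ?_, ?_⟩
  · intro u hu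
    by_contra h
    simp at hu
    exact hu ((MeromorphicOn.divisor F (closedBall 0 r)).apply_eq_zero_of_notMem h)
  · have hprod : ∀ z, (∏ᶠ (u : ℂ), (fun x => x - u) ^ (MeromorphicOn.divisor F (closedBall 0 r)) u) z
        = ∏ u ∈ hfin.toFinset, (z - u) ^ ((MeromorphicOn.divisor F (closedBall 0 r) u).toNat) := by
      intro z
      rw [Function.FactorizedRational.finprod_eq_fun hfin]
      show (∏ᶠ (u : ℂ), (z - u) ^ (MeromorphicOn.divisor F (closedBall 0 r)) u) = _
      rw [finprod_eq_prod_of_mulSupport_subset (s := hfin.toFinset)]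
      · apply Finset.prod_congr rfl
        intro u _
        rw [← zpow_natCast, Int.toNat_of_nonneg (hnn u)]
      · intro u hu
        simp only [Function.mem_mulSupport] at hu
        simp only [Set.Finite.coe_toFinset, Function.mem_support]
        intro h; apply hu; rw [h]; simp
    intro z hz
    have hcod : ∃ᶠ w in 𝓝[≠] z, F w = (∏ u ∈ hfin.toFinset, (w - u) ^ ((MeromorphicOn.divisor F (closedBall 0 r) u).toNat)) * G w := by
      rw [Filter.EventuallyEq, Filter.Eventually, mem_codiscreteWithin] at hFG
      have h3 := hFG z hz
      rw [Filter.disjoint_principal_right] at h3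
      have h4 : ∃ᶠ w in 𝓝[≠] z, w ∈ ball (0:ℂ) r := by
        have : z ∈ closure (ball (0:ℂ) r) := by rw [closure_ball _ h0.ne']; exact hz
        rw [← mem_closure_ne_iff_frequently_within]
        have h5 := closure_minimal ((dense_compl_singleton z).open_subset_closure_inter
          (isOpen_ball (x := (0:ℂ)) (ε := r))) isClosed_closure this
        exact h5
      refine (h4.and_eventually h3).mono ?_
      rintro w ⟨hw1, hw2⟩
      simp only [Set.mem_compl_iff, Set.mem_diff, Set.mem_setOf_eq, not_and, not_not] at hw2
      have := hw2 (ball_subset_closedBall hw1)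
      rw [this, Pi.smul_apply', hprod, smul_eq_mul]
    have han : AnalyticAt ℂ (fun w => (∏ u ∈ hfin.toFinset, (w - u) ^ ((MeromorphicOn.divisor F (closedBall 0 r) u).toNat)) * G w) z := by
      apply AnalyticAt.mul _ (hG z hz)
      apply Finset.analyticAt_fun_prod
      intro u _
      fun_prop
    exact ((hF' z hz).frequently_eq_iff_eventually_eq han).1 hcod |>.self_of_nhds
  · rw [finsum_eq_sum_of_support_subset (s := hfin.toFinset)]
    · apply Finset.sum_congr rfl
      intro u _
      rw [← Int.cast_natCast, Int.toNat_of_nonneg (hnn u)]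
    · intro u hu
      simpa using hu

end


section
set_option linter.all false
open Complex Filter Topology MeasureTheory
open scoped Classical
open Metric

theorem logderiv_bound {G : ℂ → ℂ} {R ρ : ℝ} (hρ : 0 ≤ ρ) (hR : ρ < R)
    (hG : AnalyticOnNhd ℂ G (closedBall 0 R)) (hG0 : ∀ z ∈ closedBall (0:ℂ) R, G z ≠ 0)
    {z : ℂ} (hz : ‖z‖ ≤ ρ) :
    ‖deriv G z / G z‖ ≤ 2 * R / (R - ρ) ^ 2 *
      Real.circleAverage (fun w => |Real.log ‖G w‖|) 0 R := by
  have hRp : 0 < R := by linarith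
  have hRa : |R| = R := abs_of_pos hRp
  have hcint : CircleIntegrable (fun w => Real.log ‖G w‖) 0 R :=
    MeromorphicOn.circleIntegrable_log_norm
      (fun z hz => (hG z (by rw [hRa] at hz; exact sphere_subset_closedBall hz)).meromorphicAt)
  have hintC : CircleIntegrable (fun w => ((Real.log ‖G w‖ : ℝ) : ℂ)) 0 R := by
    unfold CircleIntegrable at *
    exact ⟨hcint.1.ofReal, hcint.2.ofReal⟩
  set Φ : ℂ → ℂ := fun w => Real.circleAverage
    (fun ζ => herglotzRieszKernel 0 w ζ • ((Real.log ‖G ζ‖ : ℝ) : ℂ)) 0 R with hΦ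
  have hder : ∀ w ∈ ball (0:ℂ) R, HasDerivAt Φ (Real.circleAverage
      (fun ζ => (2 * ζ / (ζ - w) ^ 2) • ((Real.log ‖G ζ‖ : ℝ) : ℂ)) 0 R) w :=
    fun w hw => hasDerivAt_circleAverage_herglotzRieszKernel_smul hintC hw
  have hharm : InnerProductSpace.HarmonicOnNhd (fun w => Real.log ‖G w‖) (closedBall 0 R) :=
    fun w hw => AnalyticAt.harmonicAt_log_norm (hG w hw) (hG0 w hw)
  have hre : ∀ w ∈ ball (0:ℂ) R, (Φ w).re = Real.log ‖G w‖ := by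
    intro w hw
    rw [hΦ]
    rw [← hharm.circleAverage_re_herglotzRieszKernel_smul hw]
    exact re_circleAverage_herglotzRieszKernel_smul hcint hw
  have hbs : ball (0:ℂ) R ⊆ closedBall 0 R := ball_subset_closedBall
  set Q : ℂ → ℂ := fun w => Complex.exp (Φ w) / G w with hQ
  have hQd : DifferentiableOn ℂ Q (ball 0 R) := by
    intro w hw
    exact ((hder w hw).differentiableAt.cexp.div (hG w (hbs hw)).differentiableAt
      (hG0 w (hbs hw))).differentiableWithinAt
  have hQn : ∀ w ∈ ball (0:ℂ) R, ‖Q w‖ = 1 := by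
    intro w hw
    rw [hQ]; simp only [norm_div, Complex.norm_exp]
    rw [hre w hw, Real.exp_log (norm_pos_iff.2 (hG0 w (hbs hw))), div_self]
    exact norm_ne_zero_iff.2 (hG0 w (hbs hw))
  have h0 : (0:ℂ) ∈ ball (0:ℂ) R := by simp [hRp]
  have hc := Complex.eqOn_of_isPreconnected_of_isMaxOn_norm (convex_ball (0:ℂ) R).isPreconnected
    isOpen_ball hQd h0 (fun w hw => by simp [hQn w hw, hQn 0 h0])
  have hzb : z ∈ ball (0:ℂ) R := by simp; linarith
  have hexp : ∀ w ∈ ball (0:ℂ) R, Complex.exp (Φ w) = Q 0 * G w := by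
    intro w hw
    have := hc hw
    simp only [Function.const] at this
    rw [← this, hQ]
    simp only
    rw [div_mul_cancel₀ _ (hG0 w (hbs hw))]
  have hQ0 : Q 0 ≠ 0 := by
    rw [← norm_ne_zero_iff, hQn 0 h0]; norm_num
  have hev : (fun w => Complex.exp (Φ w)) =ᶠ[𝓝 z] fun w => Q 0 * G w := by
    filter_upwards [isOpen_ball.mem_nhds hzb] with w hw using hexp w hw
  have hd1 := ((hder z hzb).cexp).deriv
  rw [hev.deriv_eq, deriv_const_mul _ (hG z (hbs hzb)).differentiableAt, hexp z hzb] at hd1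
  have hD : deriv G z / G z = Real.circleAverage
      (fun ζ => (2 * ζ / (ζ - z) ^ 2) • ((Real.log ‖G ζ‖ : ℝ) : ℂ)) 0 R := by
    rw [div_eq_iff (hG0 z (hbs hzb))]
    apply mul_left_cancel₀ hQ0
    rw [hd1]; ring
  rw [hD]
  have hpos : 0 < R - ρ := by linarith
  calc _ ≤ Real.circleAverage (fun ζ => 2 * R / (R - ρ) ^ 2 * |Real.log ‖G ζ‖|) 0 R := by
        rw [Real.circleAverage_def, Real.circleAverage_def, norm_smul, smul_eq_mul, Real.norm_of_nonneg (by positivity)]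
        apply mul_le_mul_of_nonneg_left _ (by positivity)
        apply intervalIntegral.norm_integral_le_of_norm_le (by positivity)
        · refine ae_of_all _ fun θ _ => ?_
          rw [norm_smul, norm_div, norm_mul, norm_pow, Complex.norm_real, Real.norm_eq_abs]
          have e1 : ‖circleMap 0 R θ‖ = R := by simp [hRa]
          rw [e1]
          apply mul_le_mul_of_nonneg_right _ (abs_nonneg _)
          have e2 : R - ρ ≤ ‖circleMap 0 R θ - z‖ := by
            have := norm_sub_norm_le (circleMap 0 R θ) z
            rw [e1] at this; linarith
          simp only [RCLike.norm_ofNat]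
          gcongr
        · exact (hcint.abs.const_mul _)
    _ = _ := by
        have := Real.circleAverage_fun_smul (a := 2 * R / (R - ρ) ^ 2) (f := fun ζ => |Real.log ‖G ζ‖|) (c := 0) (R := R)
        simpa [smul_eq_mul] using this

theorem sin_kernel : IntervalIntegrable (fun θ : ℝ => |Real.sin θ| ^ (-(1/2) : ℝ)) volume 0 (2 * Real.pi) := by
  have hper : Function.Periodic (fun θ : ℝ => |Real.sin θ| ^ (-(1/2) : ℝ)) Real.pi := by
    intro θ; simp
  have hb : IntervalIntegrable (fun θ : ℝ => |Real.sin θ| ^ (-(1/2) : ℝ)) volume 0 (Real.pi / 2) := by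
    have hmaj : IntervalIntegrable (fun θ : ℝ => (2 / Real.pi) ^ (-(1/2) : ℝ) * θ ^ (-(1/2) : ℝ)) volume 0 (Real.pi / 2) :=
      (intervalIntegral.intervalIntegrable_rpow' (by norm_num)).const_mul _
    refine hmaj.mono_fun ?_ ?_
    · apply Measurable.aestronglyMeasurable
      fun_prop
    · rw [Set.uIoc_of_le (by positivity)]
      filter_upwards [ae_restrict_mem measurableSet_Ioc] with θ hθ
      have h1 := Real.mul_le_sin hθ.1.le hθ.2
      have hp : 0 < 2 / Real.pi * θ := mul_pos (by positivity) hθ.1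
      rw [← Real.mul_rpow (by positivity) hθ.1.le, Real.norm_of_nonneg (by positivity),
        Real.norm_of_nonneg (by positivity), abs_of_nonneg (by linarith)]
      exact Real.rpow_le_rpow_of_nonpos hp h1 (by norm_num)
  have hb2 : IntervalIntegrable (fun θ : ℝ => |Real.sin θ| ^ (-(1/2) : ℝ)) volume (Real.pi / 2) Real.pi := by
    have := hb.comp_sub_left Real.pi
    simp only [sub_zero, Real.sin_pi_sub] at this
    have e : Real.pi - Real.pi / 2 = Real.pi / 2 := by ring
    rw [e] at this
    exact this.symm
  have hb3 := hb.trans hb2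
  exact hper.intervalIntegrable₀ Real.pi_pos.ne' hb3 0 (2 * Real.pi)

theorem sqrt_kernel : ∃ C0 : ℝ, 0 ≤ C0 ∧ ∀ ρ : ℝ, 1/2 ≤ ρ → ∀ u : ℂ,
    CircleIntegrable (fun z => ‖z - u‖ ^ (-(1/2) : ℝ)) 0 ρ ∧
    Real.circleAverage (fun z => ‖z - u‖ ^ (-(1/2) : ℝ)) 0 ρ ≤ C0 := by
  have hper : Function.Periodic (fun θ : ℝ => |Real.sin θ| ^ (-(1/2) : ℝ)) (2 * Real.pi) := by
    intro θ; simp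
  set J := ∫ θ in (0:ℝ)..(2 * Real.pi), |Real.sin θ| ^ (-(1/2) : ℝ) with hJ
  have hJ0 : 0 ≤ J := intervalIntegral.integral_nonneg (by positivity) (fun θ _ => by positivity)
  refine ⟨(2 * Real.pi)⁻¹ * ((1/2 : ℝ) ^ (-(1/2) : ℝ) * J), by positivity, fun ρ hρ u => ?_⟩
  have hρ0 : 0 < ρ := by linarith
  set α := Complex.arg u with hα
  have hlow : ∀ θ : ℝ, 1/2 * |Real.sin (θ - α)| ≤ ‖circleMap 0 ρ θ - u‖ := by
    intro θ
    have h1 : circleMap 0 ρ θ - u =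
        Complex.exp ((α:ℂ) * Complex.I) * (ρ * Complex.exp (((θ - α : ℝ):ℂ) * Complex.I) - (‖u‖:ℂ)) := by
      rw [circleMap_zero]
      conv_lhs => rw [← Complex.norm_mul_exp_arg_mul_I u]
      rw [mul_sub, mul_left_comm, ← Complex.exp_add]
      push_cast
      rw [hα]
      ring_nf
    rw [h1, norm_mul, Complex.norm_exp_ofReal_mul_I, one_mul]
    refine le_trans ?_ (Complex.abs_im_le_norm _)
    have : (ρ * Complex.exp (((θ - α : ℝ):ℂ) * Complex.I) - (‖u‖:ℂ)).im = ρ * Real.sin (θ - α) := by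
      rw [Complex.sub_im, Complex.ofReal_im, Complex.im_ofReal_mul,
        Complex.exp_ofReal_mul_I_im]
      ring
    rw [this, abs_mul, abs_of_pos hρ0]
    gcongr
  have hmajI : IntervalIntegrable (fun θ : ℝ => (1/2 : ℝ) ^ (-(1/2) : ℝ) * |Real.sin (θ - α)| ^ (-(1/2) : ℝ)) volume 0 (2 * Real.pi) := by
    have h1 := hper.intervalIntegrable₀ (by positivity) sin_kernel (0 - α) (2 * Real.pi - α)
    have h2 := h1.comp_sub_right α
    simp only [sub_add_cancel] at h2
    exact h2.const_mul _
  have hae : ∀ᵐ θ : ℝ, Real.sin (θ - α) ≠ 0 := by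
    have hc : (Set.range fun n : ℤ => (n:ℝ) * Real.pi + α).Countable := Set.countable_range _
    filter_upwards [hc.ae_notMem volume] with θ hθ h
    obtain ⟨n, hn⟩ := Real.sin_eq_zero_iff.1 h
    exact hθ ⟨n, by simp only; linarith⟩
  have hle : ∀ᵐ θ : ℝ, ‖circleMap 0 ρ θ - u‖ ^ (-(1/2) : ℝ) ≤ (1/2 : ℝ) ^ (-(1/2) : ℝ) * |Real.sin (θ - α)| ^ (-(1/2) : ℝ) := by
    filter_upwards [hae] with θ hθ
    rw [← Real.mul_rpow (by norm_num) (abs_nonneg _)]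
    have := abs_pos.2 hθ
    exact Real.rpow_le_rpow_of_nonpos (by positivity) (hlow θ) (by norm_num)
  have hcint : CircleIntegrable (fun z => ‖z - u‖ ^ (-(1/2) : ℝ)) 0 ρ := by
    refine hmajI.mono_fun ?_ ?_
    · apply Measurable.aestronglyMeasurable
      have : Measurable (circleMap 0 ρ) := (continuous_circleMap 0 ρ).measurable
      fun_prop
    · filter_upwards [ae_restrict_of_ae hle] with θ hθ
      rw [Real.norm_of_nonneg (by positivity), Real.norm_of_nonneg (by positivity)]
      exact hθ
  refine ⟨hcint, ?_⟩
  rw [Real.circleAverage_def, smul_eq_mul]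
  apply mul_le_mul_of_nonneg_left _ (by positivity)
  calc _ ≤ ∫ θ in (0:ℝ)..(2 * Real.pi), (1/2 : ℝ) ^ (-(1/2) : ℝ) * |Real.sin (θ - α)| ^ (-(1/2) : ℝ) :=
        intervalIntegral.integral_mono_ae (by positivity) hcint hmajI hle
    _ = _ := by
        rw [intervalIntegral.integral_const_mul]
        congr 1
        rw [intervalIntegral.integral_comp_sub_right (fun θ => |Real.sin θ| ^ (-(1/2) : ℝ)) α]
        have := hper.intervalIntegral_add_eq (0 - α) 0
        rw [hJ]
        have e : (0:ℝ) - α + 2 * Real.pi = 2 * Real.pi - α := by ring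
        rw [e, zero_add] at this
        exact this

end


section
set_option linter.all false
open Complex Filter Topology MeasureTheory
open scoped Classical
open Metric

theorem ci_const_mul {f : ℂ → ℝ} {c : ℂ} {R : ℝ} (a : ℝ) (h : CircleIntegrable f c R) :
    CircleIntegrable (fun z => a * f z) c R := IntervalIntegrable.const_mul h a

theorem avg_const_mul (f : ℂ → ℝ) (c : ℂ) (R : ℝ) (a : ℝ) :
    Real.circleAverage (fun z => a * f z) c R = a * Real.circleAverage f c R := by
  have := Real.circleAverage_fun_smul (a := a) (f := f) (c := c) (R := R)
  simpa only [smul_eq_mul] using this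

theorem posLog_le_sqrt {y : ℝ} (hy : 0 ≤ y) : Real.posLog y ≤ 2 * Real.log (1 + y ^ (1/2 : ℝ)) := by
  have h0 : 0 ≤ y ^ (1/2 : ℝ) := by positivity
  rw [Real.posLog]
  apply max_le
  · have : 0 ≤ Real.log (1 + y ^ (1/2 : ℝ)) := Real.log_nonneg (by linarith)
    linarith
  · rcases eq_or_lt_of_le hy with h | h
    · rw [← h]; simp
    · have h1 : Real.log y = 2 * Real.log (y ^ (1/2 : ℝ)) := by rw [Real.log_rpow h]; ring
      rw [h1]
      have : 0 < y ^ (1/2 : ℝ) := by positivity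
      gcongr
      linarith

theorem sqrt_sum_le (S : Finset ℂ) (d : ℂ → ℕ) (z : ℂ) :
    ‖∑ u ∈ S, (d u : ℂ) / (z - u)‖ ^ (1/2 : ℝ) ≤ ∑ u ∈ S, (d u : ℝ) * ‖z - u‖ ^ (-(1/2) : ℝ) := by
  induction S using Finset.induction_on with
  | empty => simp
  | insert a S ha ih =>
    rw [Finset.sum_insert ha, Finset.sum_insert ha]
    have h1 : ‖(d a : ℂ) / (z - a)‖ ^ (1/2 : ℝ) ≤ (d a : ℝ) * ‖z - a‖ ^ (-(1/2) : ℝ) := by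
      rw [norm_div, Real.div_rpow (norm_nonneg _) (norm_nonneg _), Real.rpow_neg (norm_nonneg _),
        div_eq_mul_inv]
      gcongr
      rw [Complex.norm_natCast]
      rcases Nat.eq_zero_or_pos (d a) with h | h
      · simp [h]
      · have : (1:ℝ) ≤ d a := by exact_mod_cast h
        calc (d a : ℝ) ^ (1/2 : ℝ) ≤ (d a : ℝ) ^ (1 : ℝ) := Real.rpow_le_rpow_of_exponent_le this (by norm_num)
          _ = _ := by simp
    calc _ ≤ (‖(d a : ℂ) / (z - a)‖ + ‖∑ u ∈ S, (d u : ℂ) / (z - u)‖) ^ (1/2 : ℝ) := by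
          gcongr; exact norm_add_le _ _
      _ ≤ ‖(d a : ℂ) / (z - a)‖ ^ (1/2 : ℝ) + ‖∑ u ∈ S, (d u : ℂ) / (z - u)‖ ^ (1/2 : ℝ) :=
          Real.rpow_add_le_add_rpow (norm_nonneg _) (norm_nonneg _) (by norm_num) (by norm_num)
      _ ≤ _ := add_le_add h1 ih

theorem mm_sum_le : ∃ C0 : ℝ, 0 ≤ C0 ∧ ∀ (S : Finset ℂ) (d : ℂ → ℕ) (ρ : ℝ), 1/2 ≤ ρ → ρ < 1 →
    mm (fun z => ∑ u ∈ S, (d u : ℂ) / (z - u)) ρ ≤ 2 * Real.log (1 + C0 * ∑ u ∈ S, (d u : ℝ)) := by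
  obtain ⟨C0, hC0, hk⟩ := sqrt_kernel
  refine ⟨C0, hC0, fun S d ρ hρ hρ1 => ?_⟩
  set n : ℝ := ∑ u ∈ S, (d u : ℝ) with hn
  have hn0 : 0 ≤ n := Finset.sum_nonneg (fun u _ => by positivity)
  set A := 1 + C0 * n with hA
  have hA0 : 1 ≤ A := by have := mul_nonneg hC0 hn0; linarith
  have hmer : MeromorphicOn (fun z => ∑ u ∈ S, (d u : ℂ) / (z - u)) (ball 0 1) := by
    intro z _
    apply MeromorphicAt.fun_sum
    intro u
    fun_prop
  have hkI : CircleIntegrable (fun z => ∑ u ∈ S, (d u : ℝ) * ‖z - u‖ ^ (-(1/2) : ℝ)) 0 ρ := by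
    apply CircleIntegrable.fun_sum
    intro u _
    exact ci_const_mul _ (hk ρ hρ u).1
  have hkA : Real.circleAverage (fun z => ∑ u ∈ S, (d u : ℝ) * ‖z - u‖ ^ (-(1/2) : ℝ)) 0 ρ ≤ C0 * n := by
    rw [Real.circleAverage_fun_sum (fun u _ => ci_const_mul _ (hk ρ hρ u).1), hn, Finset.mul_sum]
    apply Finset.sum_le_sum
    intro u _
    have := Real.circleAverage_fun_smul (a := (d u : ℝ)) (f := fun z => ‖z - u‖ ^ (-(1/2) : ℝ)) (c := 0) (R := ρ)
    simp only [smul_eq_mul] at this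
    rw [this, mul_comm]
    exact mul_le_mul_of_nonneg_right (hk ρ hρ u).2 (by positivity)
  have hpt : ∀ z, Real.posLog ‖∑ u ∈ S, (d u : ℂ) / (z - u)‖ ≤
      (2 * Real.log A + 2 / A - 2) + (2 / A) * ∑ u ∈ S, (d u : ℝ) * ‖z - u‖ ^ (-(1/2) : ℝ) := by
    intro z
    refine (posLog_le_sqrt (norm_nonneg _)).trans ?_
    have h1 := sqrt_sum_le S d z
    set X := ‖∑ u ∈ S, (d u : ℂ) / (z - u)‖ ^ (1/2 : ℝ)
    have hX : 0 ≤ X := by positivity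
    set Y := ∑ u ∈ S, (d u : ℝ) * ‖z - u‖ ^ (-(1/2) : ℝ)
    have hY : 0 ≤ Y := le_trans hX h1
    have h2 : Real.log (1 + X) ≤ Real.log (1 + Y) := Real.log_le_log (by linarith) (by linarith)
    have h3 : Real.log (1 + Y) = Real.log A + Real.log ((1 + Y) / A) := by
      rw [Real.log_div (by linarith) (by linarith)]; ring
    have h4 := Real.log_le_sub_one_of_pos (x := (1 + Y) / A) (by apply div_pos <;> linarith)
    have h5 : (1 + Y) / A = 1 / A + Y / A := by ring
    have h6 : 2 / A = 2 * (1 / A) := by ring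
    have h7 : 2 / A * Y = 2 * (Y / A) := by ring
    rw [h6, ← h6, h7, h6]
    linarith
  have hsc : Real.circleAverage (fun z => (2 / A) * ∑ u ∈ S, (d u : ℝ) * ‖z - u‖ ^ (-(1/2) : ℝ)) 0 ρ
      = (2 / A) * Real.circleAverage (fun z => ∑ u ∈ S, (d u : ℝ) * ‖z - u‖ ^ (-(1/2) : ℝ)) 0 ρ := by
    have := Real.circleAverage_fun_smul (a := 2 / A) (f := fun z => ∑ u ∈ S, (d u : ℝ) * ‖z - u‖ ^ (-(1/2) : ℝ)) (c := 0) (R := ρ)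
    simpa only [smul_eq_mul] using this
  calc _ ≤ Real.circleAverage (fun z => (2 * Real.log A + 2 / A - 2) + (2 / A) * ∑ u ∈ S, (d u : ℝ) * ‖z - u‖ ^ (-(1/2) : ℝ)) 0 ρ := by
        apply Real.circleAverage_mono (mm_int hmer (by linarith) hρ1)
        · exact (circleIntegrable_const _ _ _).add (ci_const_mul _ hkI)
        · intro z _; exact hpt z
    _ = (2 * Real.log A + 2 / A - 2) + (2 / A) * Real.circleAverage (fun z => ∑ u ∈ S, (d u : ℝ) * ‖z - u‖ ^ (-(1/2) : ℝ)) 0 ρ := by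
        rw [Real.circleAverage_fun_add (circleIntegrable_const _ _ _) (ci_const_mul _ hkI), hsc,
          Real.circleAverage_const]
    _ ≤ (2 * Real.log A + 2 / A - 2) + (2 / A) * (C0 * n) := by gcongr
    _ = _ := by
        have : C0 * n = A - 1 := by rw [hA]; ring
        rw [this]
        field_simp
        ring

theorem mm_le_of_le {F : ℂ → ℂ} {B : ℝ} (hB : 0 ≤ B) (hF : MeromorphicOn F (ball 0 1)) {ρ : ℝ} (h0 : 0 ≤ ρ) (h1 : ρ < 1)
    (h : ∀ z ∈ sphere (0:ℂ) |ρ|, ‖F z‖ ≤ B) : mm F ρ ≤ Real.posLog B := by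
  rw [← Real.circleAverage_const (Real.posLog B) (0:ℂ) ρ]
  apply Real.circleAverage_mono (mm_int hF h0 h1) (circleIntegrable_const _ _ _)
  intro z hz
  exact Real.posLog_le_posLog (norm_nonneg _) (h z hz)

set_option maxHeartbeats 1000000 in
/-- lemma on the logarithmic derivative -/
theorem LDL {F : ℂ → ℂ} (hF : AnalyticOnNhd ℂ F (ball 0 1))
    (hne : ∃ z ∈ ball (0:ℂ) 1, F z ≠ 0) :
    ∃ C : ℝ, 0 ≤ C ∧ ∀ ρ R M : ℝ, 1/2 ≤ ρ → ρ < R → R < 1 → 0 ≤ M →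
      (∀ t, ρ ≤ t → t ≤ R → mm F t ≤ M) →
      mm (fun z => deriv F z / F z) ρ ≤ C * (1 + Real.log (1 / (R - ρ)) + Real.log (1 + M)) := by
  obtain ⟨C1, hC1, hJ1, hJ2⟩ := jensen_bounds hF hne
  obtain ⟨C0, hC0, hsum⟩ := mm_sum_le
  have hmer : MeromorphicOn F (ball 0 1) := fun z hz => (hF z hz).meromorphicAt
  set k1 := 1 + C0 * (2 * (1 + C1)) with hk1
  set k2 := 8 * (2 + C1 + 3 * Real.log 2 * (2 * (1 + C1))) with hk2
  have hl2 : 0 ≤ Real.log 2 := Real.log_nonneg (by norm_num)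
  have hk1' : 1 ≤ k1 := by rw [hk1]; have : 0 ≤ C0 * (2 * (1 + C1)) := by positivity
                           linarith
  have hk2' : 1 ≤ k2 := by rw [hk2]; have : 0 ≤ 3 * Real.log 2 * (2 * (1 + C1)) := by positivity
                           linarith
  have hlk1 : 0 ≤ Real.log k1 := Real.log_nonneg hk1'
  have hlk2 : 0 ≤ Real.log k2 := Real.log_nonneg hk2'
  refine ⟨2 * Real.log k1 + Real.log k2 + Real.log 2 + 5, by linarith, fun ρ R M hρ hρR hR hM hbd => ?_⟩
  set R1 := (ρ + R) / 2 with hR1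
  set η := R - ρ with hη
  have hη0 : 0 < η := by linarith
  have hη1 : η ≤ 1 := by linarith
  obtain ⟨S, d, G, hS, hG, hG0, hfac, hcount⟩ := ana_factor hF hne (r := R1) (by linarith) (by linarith)
  set n : ℝ := ∑ u ∈ S, (d u : ℝ) with hn
  have hn0 : 0 ≤ n := Finset.sum_nonneg (fun u _ => by positivity)
  have hR1a : |R1| = R1 := abs_of_nonneg (by linarith)
  have hnle : n ≤ 2 * (1 + C1) * ((1 + M) / η) := by
    have h1 := hJ2 R1 R (by linarith) (by linarith) hR
    rw [← hcount] at h1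
    have h2 : η / 2 ≤ Real.log (R / R1) := by
      have h3 := Real.one_sub_inv_le_log_of_pos (x := R / R1) (by apply div_pos <;> linarith)
      refine le_trans ?_ h3
      rw [inv_div, le_sub_comm, div_le_iff₀ (by linarith)]
      nlinarith
    have h4 : n * (η / 2) ≤ M + C1 := by
      have := mul_le_mul_of_nonneg_left h2 hn0
      have := hbd R hρR.le le_rfl
      linarith
    rw [mul_div_assoc', le_div_iff₀ hη0]
    nlinarith
  set T := (1 + M) / η with hT
  have hT1 : 1 ≤ T := by rw [hT, le_div_iff₀ hη0]; linarith
  have hMT : M ≤ T := by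
    rw [hT, le_div_iff₀ hη0]; nlinarith
  -- mean of |log|G||
  have hmean : Real.circleAverage (fun w => |Real.log ‖G w‖|) 0 R1 ≤
      2 * M + C1 + 3 * Real.log 2 * n := by
    have hIF : CircleIntegrable (fun z => Real.log ‖F z‖) 0 R1 :=
      MeromorphicOn.circleIntegrable_log_norm (fun z hz => hmer z (sphere_sub_ball (by linarith) (by linarith) hz))
    have hIu : ∀ u : ℂ, CircleIntegrable (fun z => Real.log ‖z - u‖) 0 R1 := fun u =>
      MeromorphicOn.circleIntegrable_log_norm (f := fun z => z - u) (fun z hz => by fun_prop)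
    have hIG : CircleIntegrable (fun z => Real.log ‖G z‖) 0 R1 :=
      MeromorphicOn.circleIntegrable_log_norm
        (fun z hz => (hG z (by rw [hR1a] at hz; exact sphere_subset_closedBall hz)).meromorphicAt)
    have hIs : CircleIntegrable (fun z => ∑ u ∈ S, (d u : ℝ) * (2 * Real.log 2 - Real.log ‖z - u‖)) 0 R1 := by
      apply CircleIntegrable.fun_sum
      intro u _
      exact ci_const_mul _ ((circleIntegrable_const _ _ _).sub (hIu u))
    have hIm := mm_int hmer (ρ := R1) (by linarith) (by linarith)
    have hI1 : CircleIntegrable (fun z => 2 * Real.posLog ‖F z‖ - Real.log ‖F z‖) 0 R1 :=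
      (ci_const_mul 2 hIm).sub hIF
    have step : Real.circleAverage (fun w => |Real.log ‖G w‖|) 0 R1 ≤
        Real.circleAverage (fun z => (2 * Real.posLog ‖F z‖ - Real.log ‖F z‖) +
          ∑ u ∈ S, (d u : ℝ) * (2 * Real.log 2 - Real.log ‖z - u‖)) 0 R1 := by
      apply avg_mono_cod (by linarith) hIG.abs (hI1.add hIs)
      filter_upwards [ana_ne_cod hF hne (ρ := R1) (by linarith) (by linarith), Filter.self_mem_codiscreteWithin _] with z hz hzs
      rw [hR1a] at hzs
      have hzc := sphere_subset_closedBall hzs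
      have e := hfac z hzc
      have hprod : ∏ u ∈ S, (z - u) ^ (d u) ≠ 0 := by
        intro h; rw [h, zero_mul] at e; exact hz e
      have hne' : ∀ u ∈ S, ‖(z - u) ^ (d u)‖ ≠ 0 := fun u hu =>
        norm_ne_zero_iff.2 (Finset.prod_ne_zero_iff.1 hprod u hu)
      have hlog : Real.log ‖F z‖ = ∑ u ∈ S, (d u : ℝ) * Real.log ‖z - u‖ + Real.log ‖G z‖ := by
        rw [e, norm_mul, Real.log_mul (norm_ne_zero_iff.2 hprod) (norm_ne_zero_iff.2 (hG0 z hzc)),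
          norm_prod, Real.log_prod hne']
        congr 1
        apply Finset.sum_congr rfl
        intro u _
        rw [norm_pow, Real.log_pow]
      have h1 : |Real.log ‖F z‖| = 2 * Real.posLog ‖F z‖ - Real.log ‖F z‖ := by
        have := Real.half_mul_log_add_log_abs (x := ‖F z‖)
        linarith
      have h2 : |∑ u ∈ S, (d u : ℝ) * Real.log ‖z - u‖| ≤ ∑ u ∈ S, (d u : ℝ) * (2 * Real.log 2 - Real.log ‖z - u‖) := by
        refine (Finset.abs_sum_le_sum_abs _ _).trans (Finset.sum_le_sum fun u hu => ?_)
        rw [abs_mul, abs_of_nonneg (by positivity : (0:ℝ) ≤ d u)]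
        apply mul_le_mul_of_nonneg_left _ (by positivity)
        have h3 := Real.half_mul_log_add_log_abs (x := ‖z - u‖)
        have h4 : Real.posLog ‖z - u‖ ≤ Real.log 2 := by
          rw [← Real.posLog_eq_log (x := 2) (by norm_num)]
          apply Real.posLog_le_posLog (norm_nonneg _)
          have h5 := hS u hu
          have h6 := norm_sub_le z u
          simp only [mem_closedBall, dist_zero_right] at h5 hzc
          linarith
        linarith
      have h3 : Real.log ‖G z‖ = Real.log ‖F z‖ - ∑ u ∈ S, (d u : ℝ) * Real.log ‖z - u‖ := by linarith
      show |Real.log ‖G z‖| ≤ (2 * Real.posLog ‖F z‖ - Real.log ‖F z‖) +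
          ∑ u ∈ S, (d u : ℝ) * (2 * Real.log 2 - Real.log ‖z - u‖)
      rw [h3]
      refine (abs_sub _ _).trans ?_
      linarith
    refine step.trans ?_
    rw [Real.circleAverage_fun_add hI1 hIs, Real.circleAverage_fun_sub (ci_const_mul 2 hIm) hIF,
      avg_const_mul, Real.circleAverage_fun_sum (f := fun u z => (d u : ℝ) * (2 * Real.log 2 - Real.log ‖z - u‖)) (fun u _ => ci_const_mul _ ((circleIntegrable_const _ _ _).sub (hIu u)))]
    have h1 := hJ1 R1 (by linarith) (by linarith)
    have h2 : Real.circleAverage (fun z => Real.posLog ‖F z‖) 0 R1 ≤ M := hbd R1 (by linarith) (by linarith)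
    have h3 : ∑ u ∈ S, Real.circleAverage (fun z => (d u : ℝ) * (2 * Real.log 2 - Real.log ‖z - u‖)) 0 R1 ≤ 3 * Real.log 2 * n := by
      rw [hn, Finset.mul_sum]
      apply Finset.sum_le_sum
      intro u hu
      rw [avg_const_mul, mul_comm]
      apply mul_le_mul_of_nonneg_right _ (by positivity)
      rw [Real.circleAverage_fun_sub (circleIntegrable_const _ _ _) (hIu u), Real.circleAverage_const,
        circleAverage_log_norm_sub_const_of_mem_closedBall (by rw [hR1a]; exact hS u hu)]
      have : -Real.log 2 ≤ Real.log R1 := by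
        rw [← Real.log_inv]; apply Real.log_le_log (by norm_num); linarith
      linarith
    linarith
  set B := 2 * R1 / (R1 - ρ) ^ 2 * Real.circleAverage (fun w => |Real.log ‖G w‖|) 0 R1 with hB
  have hav0 : 0 ≤ Real.circleAverage (fun w => |Real.log ‖G w‖|) 0 R1 :=
    Real.circleAverage_nonneg_of_nonneg (fun x _ => abs_nonneg _)
  have hB0 : 0 ≤ B := by
    have : 0 < R1 := by linarith
    positivity
  have hBle : B ≤ k2 * T ^ 3 := by
    have h1 : 2 * R1 / (R1 - ρ) ^ 2 ≤ 8 * T ^ 2 := by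
      have e : R1 - ρ = η / 2 := by rw [hR1, hη]; ring
      rw [e, div_le_iff₀ (by positivity), hT]
      have : 8 * ((1 + M) / η) ^ 2 * (η / 2) ^ 2 = 2 * (1 + M) ^ 2 := by field_simp; ring
      rw [this]; nlinarith
    have h2 : Real.circleAverage (fun w => |Real.log ‖G w‖|) 0 R1 ≤ (2 + C1 + 3 * Real.log 2 * (2 * (1 + C1))) * T := by
      refine hmean.trans ?_
      have := mul_le_mul_of_nonneg_left hnle (by positivity : (0:ℝ) ≤ 3 * Real.log 2)
      nlinarith
    calc B ≤ (8 * T ^ 2) * ((2 + C1 + 3 * Real.log 2 * (2 * (1 + C1))) * T) := by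
          rw [hB]; gcongr
      _ = _ := by rw [hk2]; ring
  -- decomposition
  have hmS : MeromorphicOn (fun z => ∑ u ∈ S, (d u : ℂ) / (z - u)) (ball 0 1) := by
    intro z _
    apply MeromorphicAt.fun_sum
    intro u
    fun_prop
  have hmL : MeromorphicOn (fun z => deriv F z / F z) (ball 0 1) := fun z hz =>
    (hF z hz).deriv.meromorphicAt.div (hF z hz).meromorphicAt
  have hdec : ∀ z ∈ ball (0:ℂ) R1, F z ≠ 0 → deriv F z / F z = (∑ u ∈ S, (d u : ℂ) / (z - u)) + deriv G z / G z := by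
    intro z hz hFz
    have hzc := ball_subset_closedBall hz
    have e := hfac z hzc
    have hprod : ∏ u ∈ S, (z - u) ^ (d u) ≠ 0 := by
      intro h; rw [h, zero_mul] at e; exact hFz e
    have hev : F =ᶠ[𝓝 z] fun z => (∏ u ∈ S, (z - u) ^ (d u)) * G z := by
      filter_upwards [isOpen_ball.mem_nhds hz] with w hw using hfac w (ball_subset_closedBall hw)
    have h1 : logDeriv F z = logDeriv (fun z => (∏ u ∈ S, (z - u) ^ (d u)) * G z) z := by
      simp only [logDeriv_apply]
      rw [hev.deriv_eq, hev.self_of_nhds]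
    rw [← logDeriv_apply, ← logDeriv_apply, h1, logDeriv_mul z hprod (hG0 z hzc) (by fun_prop) (hG z hzc).differentiableAt]
    congr 1
    rw [logDeriv_prod (fun u hu => Finset.prod_ne_zero_iff.1 hprod u hu) (fun u hu => by fun_prop)]
    apply Finset.sum_congr rfl
    intro u _
    rw [logDeriv_fun_pow (by fun_prop), logDeriv_apply]
    simp [deriv_sub_const]
    rw [div_eq_mul_inv]
  have hfin : mm (fun z => deriv F z / F z) ρ ≤ mm (fun z => ∑ u ∈ S, (d u : ℂ) / (z - u)) ρ + (Real.posLog B + Real.log 2) := by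
    unfold mm
    rw [← Real.circleAverage_const (Real.posLog B + Real.log 2) (0:ℂ) ρ,
      ← Real.circleAverage_fun_add (mm_int hmS (by linarith) (by linarith)) (circleIntegrable_const _ _ _)]
    apply avg_mono_cod (by linarith) (mm_int hmL (by linarith) (by linarith))
      ((mm_int hmS (by linarith) (by linarith)).add (circleIntegrable_const _ _ _))
    filter_upwards [ana_ne_cod hF hne (ρ := ρ) (by linarith) (by linarith), Filter.self_mem_codiscreteWithin _] with z hz hzs
    rw [abs_of_nonneg (by linarith), mem_sphere, dist_zero_right] at hzs
    rw [hdec z (by rw [mem_ball, dist_zero_right]; linarith) hz]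
    have h1 := Real.posLog_norm_add_le (∑ u ∈ S, (d u : ℂ) / (z - u)) (deriv G z / G z)
    have h2 : Real.posLog ‖deriv G z / G z‖ ≤ Real.posLog B :=
      Real.posLog_le_posLog (norm_nonneg _) (logderiv_bound (by linarith) (by linarith) hG hG0 hzs.le)
    show _ ≤ Real.posLog ‖∑ u ∈ S, (d u : ℂ) / (z - u)‖ + (Real.posLog B + Real.log 2)
    linarith
  have hs := hsum S d ρ hρ (by linarith)
  have hlT : 0 ≤ Real.log T := Real.log_nonneg hT1
  have h1 : Real.log (1 + C0 * n) ≤ Real.log k1 + Real.log T := by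
    rw [← Real.log_mul (by linarith) (by linarith)]
    apply Real.log_le_log (by positivity)
    have := mul_le_mul_of_nonneg_left hnle hC0
    rw [hk1]; nlinarith
  have h2 : Real.posLog B ≤ Real.log k2 + 3 * Real.log T := by
    calc Real.posLog B ≤ Real.posLog (k2 * T ^ 3) := Real.posLog_le_posLog hB0 hBle
      _ = Real.log (k2 * T ^ 3) := Real.posLog_eq_log (by
          rw [abs_of_nonneg (by positivity)]
          exact one_le_mul_of_one_le_of_one_le hk2' (one_le_pow₀ hT1))
      _ = _ := by
        rw [Real.log_mul (by linarith) (by positivity), Real.log_pow]; norm_num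
  have h3 : Real.log T = Real.log (1 / η) + Real.log (1 + M) := by
    rw [hT, div_eq_mul_one_div, Real.log_mul (by linarith) (by positivity)]; ring
  have h4 : 0 ≤ Real.log (1 / η) := Real.log_nonneg (by rw [le_div_iff₀ hη0]; linarith)
  have h5 : 0 ≤ Real.log (1 + M) := Real.log_nonneg (by linarith)
  have : mm (fun z => deriv F z / F z) ρ ≤ (2 * Real.log k1 + Real.log k2 + Real.log 2) + 5 * Real.log T := by linarith
  refine this.trans ?_
  rw [h3]
  have : 0 ≤ (2 * Real.log k1 + Real.log k2 + Real.log 2) * (Real.log (1 / η) + Real.log (1 + M)) := by positivity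
  nlinarith

end


section
set_option linter.all false
open Complex Filter Topology MeasureTheory
open scoped Classical
open Metric

noncomputable def err (ρ R M : ℝ) : ℝ := 1 + Real.log (1 / (R - ρ)) + Real.log (1 + M)

theorem err_ge {ρ R M : ℝ} (h0 : 1/2 ≤ ρ) (h1 : ρ < R) (h2 : R < 1) (hM : 0 ≤ M) : 1 ≤ err ρ R M := by
  have h4 : 0 ≤ Real.log (1 / (R - ρ)) := Real.log_nonneg (by rw [le_div_iff₀ (by linarith)]; linarith)
  have h5 : 0 ≤ Real.log (1 + M) := Real.log_nonneg (by linarith)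
  unfold err; linarith

def SmallF (L F : ℂ → ℂ) : Prop := ∃ C : ℝ, 0 ≤ C ∧ ∀ ρ R M : ℝ, 1/2 ≤ ρ → ρ < R → R < 1 → 0 ≤ M →
  (∀ t, ρ ≤ t → t ≤ R → mm L t ≤ M) → mm F ρ ≤ C * err ρ R M

def ModF (L F : ℂ → ℂ) : Prop := ∃ C : ℝ, 0 ≤ C ∧ ∀ ρ R M : ℝ, 1/2 ≤ ρ → ρ < R → R < 1 → 0 ≤ M →
  (∀ t, ρ ≤ t → t ≤ R → mm L t ≤ M) → mm F ρ ≤ C * (M + err ρ R M)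

abbrev AnB (F : ℂ → ℂ) : Prop := AnalyticOnNhd ℂ F (ball 0 1)
abbrev MeB (F : ℂ → ℂ) : Prop := MeromorphicOn F (ball 0 1)

theorem AnB.meB {F : ℂ → ℂ} (h : AnB F) : MeB F := fun z hz => (h z hz).meromorphicAt

theorem SmallF.of_le {L F : ℂ → ℂ} {C : ℝ} (h : ∀ ρ, 1/2 ≤ ρ → ρ < 1 → mm F ρ ≤ C) : SmallF L F := by
  refine ⟨|C|, abs_nonneg _, fun ρ R M h0 h1 h2 hM _ => ?_⟩
  have := err_ge h0 h1 h2 hM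
  have h3 := h ρ h0 (by linarith)
  have := le_abs_self C
  nlinarith [abs_nonneg C]

theorem SmallF.mono {L F G : ℂ → ℂ} {k C : ℝ} (hk : 0 ≤ k) (hG : SmallF L G)
    (h : ∀ ρ, 1/2 ≤ ρ → ρ < 1 → mm F ρ ≤ k * mm G ρ + C) : SmallF L F := by
  obtain ⟨c, hc, hG⟩ := hG
  refine ⟨k * c + |C|, by positivity, fun ρ R M h0 h1 h2 hM hb => ?_⟩
  have h3 := err_ge h0 h1 h2 hM
  have h4 := h ρ h0 (by linarith)
  have h5 := mul_le_mul_of_nonneg_left (hG ρ R M h0 h1 h2 hM hb) hk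
  have := le_abs_self C
  nlinarith [abs_nonneg C]

theorem SmallF.add {L F G : ℂ → ℂ} (mF : MeB F) (mG : MeB G) (hF : SmallF L F) (hG : SmallF L G) :
    SmallF L (fun z => F z + G z) := by
  obtain ⟨a, ha, hF⟩ := hF
  obtain ⟨b, hb, hG⟩ := hG
  have hl2 : 0 ≤ Real.log 2 := Real.log_nonneg (by norm_num)
  refine ⟨a + b + Real.log 2, by positivity, fun ρ R M h0 h1 h2 hM hbd => ?_⟩
  have h3 := err_ge h0 h1 h2 hM
  have := mm_add_le mF mG (ρ := ρ) (by linarith) (by linarith)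
  have := hF ρ R M h0 h1 h2 hM hbd
  have := hG ρ R M h0 h1 h2 hM hbd
  nlinarith

theorem SmallF.mul {L F G : ℂ → ℂ} (mF : MeB F) (mG : MeB G) (hF : SmallF L F) (hG : SmallF L G) :
    SmallF L (fun z => F z * G z) := by
  obtain ⟨a, ha, hF⟩ := hF
  obtain ⟨b, hb, hG⟩ := hG
  refine ⟨a + b, by positivity, fun ρ R M h0 h1 h2 hM hbd => ?_⟩
  have := mm_mul_le mF mG (ρ := ρ) (by linarith) (by linarith)
  have := hF ρ R M h0 h1 h2 hM hbd
  have := hG ρ R M h0 h1 h2 hM hbd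
  nlinarith

theorem SmallF.const (L : ℂ → ℂ) (k : ℂ) : SmallF L (fun _ => k) :=
  SmallF.of_le (C := Real.posLog ‖k‖) (fun ρ h0 h1 =>
    mm_le_of_le (norm_nonneg k) (fun z _ => by fun_prop) (by linarith) h1 (fun z _ => le_rfl))

theorem SmallF.bdd {L c : ℂ → ℂ} {B : ℝ} (hc : AnB c) (h : ∀ z ∈ ball (0:ℂ) 1, ‖c z‖ ≤ B) : SmallF L c :=
  SmallF.of_le (C := Real.posLog B) (fun ρ h0 h1 =>
    mm_le_of_le ((norm_nonneg _).trans (h 0 (by simp))) hc.meB (by linarith) h1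
      (fun z hz => h z (sphere_sub_ball (by linarith) h1 hz)))

theorem SmallF.inv {L F : ℂ → ℂ} (aF : AnB F) (hne : ∃ z ∈ ball (0:ℂ) 1, F z ≠ 0) (hF : SmallF L F) :
    SmallF L (fun z => (F z)⁻¹) := by
  obtain ⟨C, hC, h⟩ := mm_inv_le aF hne
  exact SmallF.mono (k := 1) (C := C) zero_le_one hF (fun ρ h0 h1 => by have := h ρ h0 h1; linarith)

theorem SmallF.toMod {L F : ℂ → ℂ} (hF : SmallF L F) : ModF L F := by
  obtain ⟨a, ha, hF⟩ := hF
  refine ⟨a, ha, fun ρ R M h0 h1 h2 hM hbd => ?_⟩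
  have := hF ρ R M h0 h1 h2 hM hbd
  nlinarith

theorem ModF.self (L : ℂ → ℂ) : ModF L L := by
  refine ⟨1, zero_le_one, fun ρ R M h0 h1 h2 hM hbd => ?_⟩
  have := hbd ρ le_rfl h1.le
  have := err_ge h0 h1 h2 hM
  linarith

theorem ModF.add {L F G : ℂ → ℂ} (mF : MeB F) (mG : MeB G) (hF : ModF L F) (hG : ModF L G) :
    ModF L (fun z => F z + G z) := by
  obtain ⟨a, ha, hF⟩ := hF
  obtain ⟨b, hb, hG⟩ := hG
  have hl2 : 0 ≤ Real.log 2 := Real.log_nonneg (by norm_num)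
  refine ⟨a + b + Real.log 2, by positivity, fun ρ R M h0 h1 h2 hM hbd => ?_⟩
  have h3 := err_ge h0 h1 h2 hM
  have := mm_add_le mF mG (ρ := ρ) (by linarith) (by linarith)
  have := hF ρ R M h0 h1 h2 hM hbd
  have := hG ρ R M h0 h1 h2 hM hbd
  nlinarith

theorem ModF.mul {L F G : ℂ → ℂ} (mF : MeB F) (mG : MeB G) (hF : ModF L F) (hG : ModF L G) :
    ModF L (fun z => F z * G z) := by
  obtain ⟨a, ha, hF⟩ := hF
  obtain ⟨b, hb, hG⟩ := hG
  refine ⟨a + b, by positivity, fun ρ R M h0 h1 h2 hM hbd => ?_⟩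
  have := mm_mul_le mF mG (ρ := ρ) (by linarith) (by linarith)
  have := hF ρ R M h0 h1 h2 hM hbd
  have := hG ρ R M h0 h1 h2 hM hbd
  nlinarith

theorem mm_mono_off {F G W : ℂ → ℂ} (mF : MeB F) (mG : MeB G) (aW : AnB W)
    (hne : ∃ z ∈ ball (0:ℂ) 1, W z ≠ 0)
    (h : ∀ z ∈ ball (0:ℂ) 1, W z ≠ 0 → F z = G z) {ρ : ℝ} (h0 : 1/2 ≤ ρ) (h1 : ρ < 1) :
    mm F ρ ≤ mm G ρ := by
  apply avg_mono_cod (by linarith) (mm_int mF (by linarith) h1) (mm_int mG (by linarith) h1)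
  filter_upwards [ana_ne_cod aW hne (ρ := ρ) (by linarith) (by linarith), Filter.self_mem_codiscreteWithin _] with z hz hzs
  rw [h z (sphere_sub_ball (by linarith) h1 hzs) hz]

theorem SmallF.congr_off {L F G W : ℂ → ℂ} (mF : MeB F) (mG : MeB G) (aW : AnB W)
    (hne : ∃ z ∈ ball (0:ℂ) 1, W z ≠ 0)
    (h : ∀ z ∈ ball (0:ℂ) 1, W z ≠ 0 → F z = G z) (hG : SmallF L G) : SmallF L F :=
  SmallF.mono (k := 1) (C := 0) zero_le_one hG
    (fun ρ h0 h1 => by have := mm_mono_off mF mG aW hne h h0 h1; linarith)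

theorem ModF.congr_off {L F G W : ℂ → ℂ} (mF : MeB F) (mG : MeB G) (aW : AnB W)
    (hne : ∃ z ∈ ball (0:ℂ) 1, W z ≠ 0)
    (h : ∀ z ∈ ball (0:ℂ) 1, W z ≠ 0 → F z = G z) (hG : ModF L G) : ModF L F := by
  obtain ⟨a, ha, hG⟩ := hG
  refine ⟨a, ha, fun ρ R M h0 h1 h2 hM hbd => ?_⟩
  exact (mm_mono_off mF mG aW hne h h0 (by linarith)).trans (hG ρ R M h0 h1 h2 hM hbd)

theorem AnB.one_ne : ∃ z ∈ ball (0:ℂ) 1, (fun _ : ℂ => (1:ℂ)) z ≠ 0 := ⟨0, by simp, by simp⟩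

theorem SmallF.congr {L F G : ℂ → ℂ} (mF : MeB F) (mG : MeB G)
    (h : ∀ z ∈ ball (0:ℂ) 1, F z = G z) (hG : SmallF L G) : SmallF L F :=
  SmallF.congr_off mF mG (W := fun _ => 1) (fun z _ => analyticAt_const) AnB.one_ne (fun z hz _ => h z hz) hG

theorem ModF.logDeriv {L F : ℂ → ℂ} (aF : AnB F) (hne : ∃ z ∈ ball (0:ℂ) 1, F z ≠ 0) (hF : ModF L F) :
    SmallF L (fun z => deriv F z / F z) := by
  obtain ⟨C1, hC1, hL⟩ := LDL aF hne
  obtain ⟨C, hC, hF⟩ := hF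
  have hl2 : 0 ≤ Real.log 2 := Real.log_nonneg (by norm_num)
  have hl5 : 0 ≤ Real.log (1 + 5 * C) := Real.log_nonneg (by linarith)
  refine ⟨C1 * (Real.log 2 + Real.log (1 + 5 * C) + 2), by positivity, fun ρ R M h0 h1 h2 hM hbd => ?_⟩
  set η := R - ρ with hη
  have hη0 : 0 < η := by linarith
  have hη1 : η ≤ 1 := by linarith
  have hl1 : 0 ≤ Real.log (1 / η) := Real.log_nonneg (by rw [le_div_iff₀ (by linarith)]; linarith)
  have hlM : 0 ≤ Real.log (1 + M) := Real.log_nonneg (by linarith)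
  have hl12 : Real.log (2 / η) = Real.log 2 + Real.log (1 / η) := by
    rw [← Real.log_mul (by norm_num) (by positivity)]; congr 1; ring
  set M' := C * (M + (1 + Real.log (2 / η) + Real.log (1 + M))) with hM'
  have hM'0 : 0 ≤ M' := by
    rw [hM', hl12]; positivity
  have key := hL ρ ((ρ + R) / 2) M' h0 (by linarith) (by linarith) hM'0 (by
    intro t ht1 ht2
    have h3 := hF t R M (by linarith) (by linarith) h2 hM (fun s hs1 hs2 => hbd s (by linarith) hs2)
    refine h3.trans ?_
    rw [hM']
    unfold err
    have h4 : Real.log (1 / (R - t)) ≤ Real.log (2 / η) := by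
      apply Real.log_le_log (by apply div_pos <;> linarith)
      rw [div_le_div_iff₀ (by linarith) hη0]
      linarith
    gcongr)
  refine key.trans ?_
  have e1 : (ρ + R) / 2 - ρ = η / 2 := by rw [hη]; ring
  have e2 : 1 / (η / 2) = 2 / η := by field_simp
  rw [e1, e2, hl12]
  have h5 : 1 + M' ≤ (1 + 5 * C) * ((1 + M) * (1 / η)) := by
    have a1 : Real.log (1 / η) ≤ 1 / η := (Real.log_le_sub_one_of_pos (by positivity)).trans (by linarith)
    have a2 : Real.log (1 + M) ≤ M := (Real.log_le_sub_one_of_pos (by positivity)).trans (by linarith)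
    have a3 : Real.log 2 ≤ 1 := (Real.log_le_sub_one_of_pos (by positivity)).trans (by norm_num)
    have a4 : 1 ≤ 1 / η := by rw [le_div_iff₀ hη0]; linarith
    set x := 1 / η
    have a5 : 1 + M ≤ (1 + M) * x := by nlinarith
    have a6 : x ≤ (1 + M) * x := by nlinarith
    have : M' ≤ C * (5 * ((1 + M) * x)) := by
      rw [hM', hl12]; gcongr; nlinarith
    nlinarith
  have h6 : Real.log (1 + M') ≤ Real.log (1 + 5 * C) + (Real.log (1 + M) + Real.log (1 / η)) := by
    rw [← Real.log_mul (by positivity) (by positivity), ← Real.log_mul (by positivity) (by positivity)]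
    exact Real.log_le_log (by positivity) h5
  have h7 := err_ge h0 h1 h2 hM
  rw [mul_assoc]
  apply mul_le_mul_of_nonneg_left _ hC1
  unfold err at h7 ⊢
  rw [← hη] at h7 ⊢
  nlinarith [mul_nonneg hl2 hl1, mul_nonneg hl2 hlM, mul_nonneg hl5 hl1, mul_nonneg hl5 hlM]

end


section
set_option linter.all false
open Complex Filter Topology MeasureTheory
open scoped Classical
open Metric

theorem AnalyticOnNhd.meB {F : ℂ → ℂ} (h : AnalyticOnNhd ℂ F (ball 0 1)) : MeB F := fun z hz => (h z hz).meromorphicAt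

theorem AnB.eq_zero_or {F : ℂ → ℂ} (hF : AnB F) : (∀ z ∈ ball (0:ℂ) 1, F z = 0) ∨ ∃ z ∈ ball (0:ℂ) 1, F z ≠ 0 := by
  by_cases h : ∃ z ∈ ball (0:ℂ) 1, F z ≠ 0
  · exact Or.inr h
  · push Not at h; exact Or.inl h

theorem deriv_zero_of_zero {F : ℂ → ℂ} (h : ∀ z ∈ ball (0:ℂ) 1, F z = 0) : ∀ z ∈ ball (0:ℂ) 1, deriv F z = 0 := by
  intro z hz
  have : F =ᶠ[𝓝 z] fun _ => 0 := by
    filter_upwards [isOpen_ball.mem_nhds hz] with w hw using h w hw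
  rw [this.deriv_eq]; simp

theorem SmallF.deriv' {L F c : ℂ → ℂ} (aF : AnB F) (ac : AnB c) (sc : SmallF L c) (hF : SmallF L F) :
    SmallF L (fun z => c z * deriv F z) := by
  have aD : AnB (fun z => c z * deriv F z) := ac.mul aF.deriv
  rcases aF.eq_zero_or with h | h
  · apply SmallF.congr aD.meB (fun z _ => by fun_prop) (G := fun _ => 0) _ (SmallF.const _ _)
    intro z hz
    simp [deriv_zero_of_zero h z hz]
  · have h1 := ModF.logDeriv aF h hF.toMod
    have mq : MeB (fun z => deriv F z / F z) := aF.deriv.meB.div aF.meB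
    have h2 := (hF.mul aF.meB mq h1)
    have h3 := sc.mul ac.meB (aF.meB.mul mq) h2
    apply SmallF.congr_off aD.meB (ac.meB.mul (aF.meB.mul mq)) aF h _ h3
    intro z hz hz0
    simp only [Pi.mul_apply]
    field_simp

theorem ModF.deriv' {L F c : ℂ → ℂ} (aF : AnB F) (ac : AnB c) (sc : SmallF L c) (hF : ModF L F) :
    ModF L (fun z => c z * deriv F z) := by
  have aD : AnB (fun z => c z * deriv F z) := ac.mul aF.deriv
  rcases aF.eq_zero_or with h | h
  · apply SmallF.toMod
    apply SmallF.congr aD.meB (fun z _ => by fun_prop) (G := fun _ => 0) _ (SmallF.const _ _)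
    intro z hz
    simp [deriv_zero_of_zero h z hz]
  · have h1 := (ModF.logDeriv aF h hF).toMod
    have mq : MeB (fun z => deriv F z / F z) := aF.deriv.meB.div aF.meB
    have h2 := (hF.mul aF.meB mq h1)
    have h3 := sc.toMod.mul ac.meB (aF.meB.mul mq) h2
    apply ModF.congr_off aD.meB (ac.meB.mul (aF.meB.mul mq)) aF h _ h3
    intro z hz hz0
    simp only [Pi.mul_apply]
    field_simp

theorem prop_of_logderiv {F K : ℂ → ℂ} (aF : AnB F) (aK : AnB K) (hK : ∀ z ∈ ball (0:ℂ) 1, K z ≠ 0)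
    (h : ∀ z ∈ ball (0:ℂ) 1, deriv F z * K z = F z * deriv K z) : ∃ k : ℂ, ∀ z ∈ ball (0:ℂ) 1, F z = k * K z := by
  have h0 : (0:ℂ) ∈ ball (0:ℂ) 1 := by simp
  refine ⟨F 0 / K 0, fun z hz => ?_⟩
  have hd : DifferentiableOn ℂ (fun z => F z / K z) (ball 0 1) := fun z hz =>
    ((aF z hz).differentiableAt.div (aK z hz).differentiableAt (hK z hz)).differentiableWithinAt
  have := isOpen_ball.is_const_of_deriv_eq_zero (convex_ball (0:ℂ) 1).isPreconnected hd (by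
    intro z hz
    have := ((aF z hz).differentiableAt.hasDerivAt.div (aK z hz).differentiableAt.hasDerivAt (hK z hz)).deriv
    rw [show (fun z => F z / K z) = F / K from rfl, this, h z hz, sub_self, zero_div]; rfl) hz h0
  rw [← this]
  field_simp [hK z hz]

theorem SmallF.of_sq {L N : ℂ → ℂ} (aN : AnB N) (h : SmallF L (fun z => N z ^ 2)) : SmallF L N := by
  apply SmallF.mono (k := 1) (C := 0) zero_le_one h
  intro ρ h0 h1
  rw [one_mul, add_zero]
  apply Real.circleAverage_mono (mm_int aN.meB (by linarith) h1) (mm_int (AnB.meB (F := fun z => N z ^ 2) (aN.pow 2)) (by linarith) h1)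
  intro z _
  simp only [norm_pow]
  by_cases hN : ‖N z‖ ≤ 1
  · rw [Real.posLog_eq_zero_iff _ |>.2 (by rwa [abs_norm])]; exact Real.posLog_nonneg
  · exact Real.posLog_le_posLog (norm_nonneg _) (by nlinarith)

theorem SmallF.of_two {L U A B W : ℂ → ℂ} (mU : MeB U) (mA : MeB A) (mB : MeB B) (aW : AnB W)
    (hne : ∃ z ∈ ball (0:ℂ) 1, W z ≠ 0) (hA : SmallF L A) (hB : SmallF L B)
    (h : ∀ z ∈ ball (0:ℂ) 1, W z ≠ 0 → ‖U z‖ ≤ ‖A z‖ ∨ ‖U z‖ ≤ ‖B z‖) : SmallF L U := by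
  obtain ⟨a, ha, hA⟩ := hA
  obtain ⟨b, hb, hB⟩ := hB
  refine ⟨a + b, by positivity, fun ρ R M h0 h1 h2 hM hbd => ?_⟩
  have i1 := mm_int mA (ρ := ρ) (by linarith) (by linarith)
  have i2 := mm_int mB (ρ := ρ) (by linarith) (by linarith)
  have h3 := hA ρ R M h0 h1 h2 hM hbd
  have h4 := hB ρ R M h0 h1 h2 hM hbd
  have : mm U ρ ≤ mm A ρ + mm B ρ := by
    unfold mm
    rw [← Real.circleAverage_fun_add i1 i2]
    apply avg_mono_cod (by linarith) (mm_int mU (by linarith) (by linarith)) (i1.add i2)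
    filter_upwards [ana_ne_cod aW hne (ρ := ρ) (by linarith) (by linarith), Filter.self_mem_codiscreteWithin _] with z hz hzs
    have p1 : 0 ≤ Real.posLog ‖A z‖ := Real.posLog_nonneg
    have p2 : 0 ≤ Real.posLog ‖B z‖ := Real.posLog_nonneg
    rcases h z (sphere_sub_ball (by linarith) (by linarith) hzs) hz with h | h
    · have := Real.posLog_le_posLog (norm_nonneg _) h; simp only [Pi.add_apply]; linarith
    · have := Real.posLog_le_posLog (norm_nonneg _) h; simp only [Pi.add_apply]; linarith
  nlinarith

theorem clunie_small {L c : ℂ → ℂ} {Bc : ℝ} (aL : AnB L) (ac : AnB c) (hcb : ∀ z ∈ ball (0:ℂ) 1, ‖c z‖ ≤ Bc)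
    (hc0 : ∀ z ∈ ball (0:ℂ) 1, c z ≠ 0) (hK : ∀ z ∈ ball (0:ℂ) 1, c z * deriv L z + L z ^ 2 ≠ 0) :
    SmallF L L := by
  have sc : SmallF L c := SmallF.bdd ac hcb
  rcases aL.eq_zero_or with hL0 | hLne
  · exact SmallF.congr aL.meB (fun z _ => by fun_prop) hL0 (SmallF.const L 0)
  have hd : ∀ {F : ℂ → ℂ}, AnB F → ∀ z ∈ ball (0:ℂ) 1, HasDerivAt F (deriv F z) z :=
    fun aF z hz => (aF z hz).differentiableAt.hasDerivAt
  set dL : ℂ → ℂ := fun z => c z * deriv L z with hdL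
  have adL : AnB dL := ac.mul aL.deriv
  set K : ℂ → ℂ := fun z => dL z + L z ^ 2 with hKdef
  have aK : AnB K := adL.add (aL.pow 2)
  have modK : ModF L K := by
    have h1 : ModF L dL := ModF.deriv' aL ac sc (ModF.self L)
    have h2 := (ModF.self L).mul aL.meB aL.meB (ModF.self L)
    have h3 := h1.add adL.meB (aL.mul aL).meB h2
    refine ModF.congr_off aK.meB (adL.add (aL.mul aL)).meB (W := fun _ => 1) (fun z _ => analyticAt_const) AnB.one_ne ?_ h3
    intro z _ _; simp only [hKdef, Pi.add_apply, Pi.mul_apply]; ring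
  set a : ℂ → ℂ := fun z => c z * (deriv K z / K z) with ha
  have aa : AnB a := fun z hz => (ac z hz).mul ((aK.deriv z hz).div (aK z hz) (hK z hz))
  have sa : SmallF L a := sc.mul ac.meB (aK.deriv.meB.div aK.meB) (ModF.logDeriv aK ⟨0, by simp, hK 0 (by simp)⟩ modK)
  set ddL : ℂ → ℂ := fun z => c z * deriv dL z with hddL
  have addL : AnB ddL := ac.mul adL.deriv
  set P : ℂ → ℂ := fun z => dL z / L z with hP
  have mP : MeB P := adL.meB.div aL.meB
  have sP : SmallF L P := by
    have := sc.mul ac.meB (aL.deriv.meB.div aL.meB) (ModF.logDeriv aL hLne (ModF.self L))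
    refine SmallF.congr mP (ac.meB.mul (aL.deriv.meB.div aL.meB)) ?_ this
    intro z _; simp only [hP, hdL, Pi.mul_apply, Pi.div_apply]; ring
  set Q : ℂ → ℂ := fun z => ddL z / L z with hQ
  have mQ : MeB Q := addL.meB.div aL.meB
  have sQ : SmallF L Q := by
    rcases adL.eq_zero_or with h | h
    · apply SmallF.congr mQ (fun z _ => by fun_prop) (G := fun _ => 0) _ (SmallF.const _ _)
      intro z hz
      simp [hQ, hddL, deriv_zero_of_zero h z hz]
    · have m1 : MeB (fun z => c z * (deriv dL z / dL z)) := ac.meB.mul (adL.deriv.meB.div adL.meB)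
      have h1 := sc.mul ac.meB (adL.deriv.meB.div adL.meB) (ModF.logDeriv adL h (ModF.deriv' aL ac sc (ModF.self L)))
      have h2 := SmallF.mul m1 mP h1 sP
      refine SmallF.congr_off mQ (m1.mul mP) (adL.mul aL) (W := fun z => dL z * L z) ?_ ?_ h2
      · by_contra hcon
        push Not at hcon
        have hp := AnalyticOnNhd.eq_zero_or_eq_zero_of_mul_eq_zero (U := ball (0:ℂ) 1) adL aL
          (by intro z hz; exact hcon z hz) (convex_ball (0:ℂ) 1).isPreconnected
        rcases hp with hp | hp
        · obtain ⟨z, hz, hz'⟩ := h; exact hz' (hp z hz)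
        · obtain ⟨z, hz, hz'⟩ := hLne; exact hz' (hp z hz)
      · intro z hz hz0
        have h3 : dL z ≠ 0 := fun h => hz0 (by simp [h])
        have h4 : L z ≠ 0 := fun h => hz0 (by simp [h])
        simp only [hQ, hP, hddL, Pi.mul_apply]
        field_simp
  set U : ℂ → ℂ := fun z => 2 * dL z - a z * L z with hU
  have aU : AnB U := (analyticOnNhd_const.mul adL).sub (aa.mul aL)
  -- pointwise identities
  have e1 : ∀ z ∈ ball (0:ℂ) 1, a z * K z = ddL z + 2 * L z * dL z := by
    intro z hz
    have h1 : HasDerivAt K (deriv dL z + 2 * L z * deriv L z) z := by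
      have := (hd adL z hz).add ((hd aL z hz).pow 2)
      exact this.congr_deriv (by norm_num)
    have h2 := h1.deriv
    have := hK z hz
    show c z * (deriv K z / K z) * K z = _
    rw [mul_assoc, div_mul_cancel₀ _ (hK z hz), h2, hddL, hdL]; ring
  have e2 : ∀ z ∈ ball (0:ℂ) 1, L z * U z = a z * dL z - ddL z := by
    intro z hz
    have := e1 z hz
    simp only [hU, hKdef] at this ⊢
    linear_combination -this
  have sU : SmallF L U := by
    have m2 : MeB (fun z => (2:ℂ)) := fun z _ => by fun_prop
    have mn : MeB (fun z => (-1:ℂ)) := fun z _ => by fun_prop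
    have sA := ((SmallF.const L 2).mul m2 mP sP).add (m2.mul mP) (mn.mul aa.meB) ((SmallF.const L (-1)).mul mn aa.meB sa)
    have sB := (sa.mul aa.meB mP sP).add (aa.meB.mul mP) (mn.mul mQ) ((SmallF.const L (-1)).mul mn mQ sQ)
    refine SmallF.of_two aU.meB ((m2.mul mP).add (mn.mul aa.meB)) ((aa.meB.mul mP).add (mn.mul mQ)) aL hLne sA sB ?_
    intro z hz hLz
    by_cases hl : ‖L z‖ ≤ 1
    · left
      have : U z = L z * (2 * P z + -1 * a z) := by simp only [hU, hP]; field_simp; ring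
      rw [this, norm_mul]
      simp only [Pi.mul_apply, Pi.add_apply]
      nlinarith [norm_nonneg (2 * P z + -1 * a z)]
    · right
      have : U z = a z * P z + -1 * Q z := by
        have := e2 z hz
        simp only [hP, hQ]
        field_simp
        linear_combination this
      rw [this]
      rfl
  set da : ℂ → ℂ := fun z => c z * deriv a z with hda
  have ada : AnB da := ac.mul aa.deriv
  have sda : SmallF L da := SmallF.deriv' aa ac sc sa
  set dU : ℂ → ℂ := fun z => c z * deriv U z with hdU
  have adU : AnB dU := ac.mul aU.deriv
  have sdU : SmallF L dU := SmallF.deriv' aU ac sc sU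
  have e3 : ∀ z ∈ ball (0:ℂ) 1, dU z = 2 * ddL z - da z * L z - a z * dL z := by
    intro z hz
    have h1 : HasDerivAt U (2 * deriv dL z - (deriv a z * L z + a z * deriv L z)) z :=
      ((hd adL z hz).const_mul 2).sub ((hd aa z hz).mul (hd aL z hz))
    simp only [hdU, hddL, hda]
    rw [h1.deriv, hdL]; ring
  set X : ℂ → ℂ := fun z => U z + ((-1/4) * (a z * a z) + (1/2) * da z) with hX
  set Y : ℂ → ℂ := fun z => (1/4) * (a z * U z) + (-1/2) * dU z with hY
  have ck : ∀ k : ℂ, AnB (fun _ => k) := fun k => analyticOnNhd_const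
  have aX : AnB X := aU.add (((ck _).mul (aa.mul aa)).add ((ck _).mul ada))
  have aY : AnB Y := ((ck _).mul (aa.mul aU)).add ((ck _).mul adU)
  have saa : SmallF L (fun z => a z * a z) := sa.mul aa.meB aa.meB sa
  have maa : MeB (fun z => a z * a z) := (aa.mul aa).meB
  have sX : SmallF L X := by
    apply SmallF.add aU.meB (((ck _).mul (aa.mul aa)).add ((ck _).mul ada)).meB sU
    apply SmallF.add ((ck _).mul (aa.mul aa)).meB ((ck _).mul ada).meB
    · exact SmallF.mul (ck _).meB maa (SmallF.const _ _) saa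
    · exact SmallF.mul (ck _).meB ada.meB (SmallF.const _ _) sda
  have sY : SmallF L Y := by
    apply SmallF.add ((ck _).mul (aa.mul aU)).meB ((ck _).mul adU).meB
    · exact SmallF.mul (ck _).meB (aa.mul aU).meB (SmallF.const _ _) (sa.mul aa.meB aU.meB sU)
    · exact SmallF.mul (ck _).meB adU.meB (SmallF.const _ _) sdU
  have e4 : ∀ z ∈ ball (0:ℂ) 1, L z * X z = Y z := by
    intro z hz
    have h1 := e2 z hz
    have h2 := e3 z hz
    have h3 : U z = 2 * dL z - a z * L z := rfl
    simp only [hX, hY]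
    rw [h2]
    linear_combination h1 + (-1/4) * a z * h3
  rcases aX.eq_zero_or with hX0 | hXne
  swap
  · refine SmallF.congr_off aL.meB (aY.meB.mul (aX.meB.inv)) aX hXne ?_ (sY.mul aY.meB aX.meB.inv (sX.inv aX hXne))
    intro z hz hXz
    have := e4 z hz
    simp only [Pi.mul_apply, Pi.inv_apply]
    rw [← this]; field_simp
  set N : ℂ → ℂ := fun z => L z + (1/4) * a z with hN
  have aN : AnB N := aL.add ((ck _).mul aa)
  have e5 : ∀ z ∈ ball (0:ℂ) 1, c z * deriv N z = a z * N z / 2 := by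
    intro z hz
    have h1 : HasDerivAt N (deriv L z + (1/4) * deriv a z) z := (hd aL z hz).add ((hd aa z hz).const_mul _)
    have h2 := hX0 z hz
    have h3 : dL z = c z * deriv L z := rfl
    have h4 : da z = c z * deriv a z := rfl
    simp only [hX, hU, h3, h4] at h2
    rw [h1.deriv]
    simp only [hN]
    linear_combination (1/2) * h2
  have e6 : ∀ z ∈ ball (0:ℂ) 1, a z * K z = c z * deriv K z := by
    intro z hz; simp only [ha]; rw [mul_assoc, div_mul_cancel₀ _ (hK z hz)]
  obtain ⟨k0, hk0⟩ := prop_of_logderiv (F := fun z => N z ^ 2) (aN.pow 2) aK hK (by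
    intro z hz
    have h1 := ((hd aN z hz).pow 2).deriv
    rw [show (fun z => N z ^ 2) = N ^ 2 from rfl, h1]
    apply mul_left_cancel₀ (hc0 z hz)
    have h5 := e5 z hz
    have h6 := e6 z hz
    norm_num only [Nat.cast_ofNat, Pi.pow_apply, pow_one]
    linear_combination (2 * N z * K z) * h5 + (N z)^2 * h6)
  have e7 : ∀ z ∈ ball (0:ℂ) 1, K z - N z ^ 2 = (1/16) * (a z * a z) - (1/4) * da z := by
    intro z hz
    have h2 := hX0 z hz
    simp only [hX, hU] at h2
    simp only [hKdef, hN]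
    linear_combination (1/2) * h2
  -- it suffices that K is small
  have suff : SmallF L K → SmallF L L := by
    intro sK
    have h1 : SmallF L (fun z => N z ^ 2) :=
      SmallF.congr (F := fun z => N z ^ 2) (aN.pow 2).meB ((ck k0).mul aK).meB hk0 (SmallF.mul (ck k0).meB aK.meB (SmallF.const _ _) sK)
    have h2 := SmallF.of_sq aN h1
    have h3 := h2.add aN.meB ((ck (-1/4)).mul aa).meB (SmallF.mul (ck _).meB aa.meB (SmallF.const _ _) sa)
    refine SmallF.congr aL.meB (aN.add ((ck (-1/4)).mul aa)).meB ?_ h3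
    intro z hz
    simp only [hN, Pi.add_apply, Pi.mul_apply]; ring
  apply suff
  by_cases hk1 : k0 = 1
  · have h8 : ∀ z ∈ ball (0:ℂ) 1, da z = a z * a z / 4 := by
      intro z hz
      have h1 := e7 z hz
      have h2 := hk0 z hz
      rw [h2, hk1] at h1
      linear_combination 4 * h1
    obtain ⟨k1, hk1⟩ := prop_of_logderiv (F := fun z => a z ^ 4) (aa.pow 4) aK hK (by
      intro z hz
      have h1 := ((hd aa z hz).pow 4).deriv
      rw [show (fun z => a z ^ 4) = a ^ 4 from rfl, h1]
      apply mul_left_cancel₀ (hc0 z hz)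
      have h5 := h8 z hz
      simp only [hda] at h5
      have h6 := e6 z hz
      norm_num only [Nat.cast_ofNat, Pi.pow_apply, pow_one]
      linear_combination (4 * a z ^ 3 * K z) * h5 + (a z)^4 * h6)
    by_cases hk10 : k1 = 0
    · have a0 : ∀ z ∈ ball (0:ℂ) 1, a z = 0 := by
        intro z hz
        have := hk1 z hz
        rw [hk10] at this
        simpa using this
      obtain ⟨k2, hk2⟩ := prop_of_logderiv (F := fun z => 1) (ck 1) aK hK (by
        intro z hz
        have := e6 z hz
        rw [a0 z hz, zero_mul] at this
        have := (mul_eq_zero.1 this.symm).resolve_left (hc0 z hz)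
        simp [this])
      refine SmallF.congr aK.meB (ck k2⁻¹).meB ?_ (SmallF.const L k2⁻¹)
      intro z hz
      exact eq_inv_of_mul_eq_one_right (hk2 z hz).symm
    · refine SmallF.congr aK.meB ((ck k1⁻¹).mul ((aa.mul aa).mul (aa.mul aa))).meB ?_
        (SmallF.mul (ck k1⁻¹).meB ((aa.mul aa).mul (aa.mul aa)).meB (SmallF.const _ _) (saa.mul maa maa saa))
      intro z hz
      have := hk1 z hz
      show K z = _ * _
      field_simp
      linear_combination -this
  · have h1k : (1 - k0) ≠ 0 := sub_ne_zero.2 (Ne.symm hk1)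
    have ae : AnB (fun z => (1/16) * (a z * a z) + (-1/4) * da z) := ((ck _).mul (aa.mul aa)).add ((ck _).mul ada)
    have se : SmallF L (fun z => (1/16) * (a z * a z) + (-1/4) * da z) := by
      apply SmallF.add ((ck _).mul (aa.mul aa)).meB ((ck _).mul ada).meB
      · exact SmallF.mul (ck _).meB maa (SmallF.const _ _) saa
      · exact SmallF.mul (ck _).meB ada.meB (SmallF.const _ _) sda
    refine SmallF.congr aK.meB ((ck (1-k0)⁻¹).mul ae).meB ?_
        (SmallF.mul (ck (1-k0)⁻¹).meB ae.meB (SmallF.const _ _) se)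
    intro z hz
    have h2 := hk0 z hz
    have h3 := e7 z hz
    show K z = _ * _
    rw [eq_inv_mul_iff_mul_eq₀ h1k]
    have h2' : N z ^ 2 = k0 * K z := h2
    rw [h2'] at h3
    linear_combination h3

end


section
set_option linter.all false
open Complex Filter Topology MeasureTheory
open scoped Classical
open Metric

theorem borel_growth {φ : ℝ → ℝ} {C : ℝ} (hC : 0 ≤ C)
    (h : ∀ ρ R M : ℝ, 1/2 ≤ ρ → ρ < R → R < 1 → 0 ≤ M → (∀ t, ρ ≤ t → t ≤ R → φ t ≤ M) →
      φ ρ ≤ C * (1 + Real.log (1 / (R - ρ)) + Real.log (1 + M)))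
    (hb : ∀ r, r < 1 → ∃ B, ∀ t, 1/2 ≤ t → t ≤ r → φ t ≤ B) :
    ∃ A : ℝ, 0 ≤ A ∧ ∀ ρ, 1/2 ≤ ρ → ρ < 1 → φ ρ ≤ A * (1 + Real.log (1 / (1 - ρ))) := by
  obtain ⟨x0, hx0⟩ : ∃ x0 : ℝ, ∀ x ≥ x0, C * (3 + 2 * Real.log (1 + 2 * x)) ≤ x / 2 := by
    have h1 : Tendsto (fun x : ℝ => 1 + 2 * x) atTop atTop :=
      tendsto_atTop_add_const_left _ _ (tendsto_id.const_mul_atTop (by norm_num))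
    have h2 : (fun x : ℝ => Real.log (1 + 2 * x)) =o[atTop] (fun x : ℝ => 1 + 2 * x) :=
      Real.isLittleO_log_id_atTop.comp_tendsto h1
    have h3 := h2.def (c := 1 / (16 * (C + 1))) (by positivity)
    obtain ⟨x1, hx1⟩ := (h3.and (eventually_ge_atTop (16 * (C+1)))).exists_forall_of_atTop
    refine ⟨x1, fun x hx => ?_⟩
    obtain ⟨h4, h5⟩ := hx1 x hx
    have h6 : Real.log (1 + 2 * x) ≤ 1 / (16 * (C + 1)) * (1 + 2 * x) := by
      refine (le_abs_self _).trans (h4.trans ?_)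
      rw [Real.norm_of_nonneg (by nlinarith)]
    have h7 : (C + 1) * Real.log (1 + 2 * x) ≤ (1 + 2 * x) / 16 := by
      calc _ ≤ (C + 1) * (1 / (16 * (C + 1)) * (1 + 2 * x)) := by gcongr
        _ = _ := by field_simp
    have h8 : 0 ≤ Real.log (1 + 2 * x) := Real.log_nonneg (by nlinarith)
    nlinarith
  set A := max (max x0 (4 * C)) 1 with hA
  have hA1 : 1 ≤ A := le_max_right _ _
  have hA2 : 4 * C ≤ A := (le_max_right _ _).trans (le_max_left _ _)
  have hA3 : x0 ≤ A := (le_max_left _ _).trans (le_max_left _ _)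
  refine ⟨A, by linarith, ?_⟩
  by_contra hcon
  push Not at hcon
  obtain ⟨ρ0, h0, h1, h2⟩ := hcon
  have step : ∀ ρ, 1/2 ≤ ρ → ρ < 1 → A * (1 + Real.log (1 / (1 - ρ))) < φ ρ →
      ∃ ρ', ρ ≤ ρ' ∧ ρ' ≤ ρ + (1 - ρ) / (4 * φ ρ) ∧ 2 * φ ρ < φ ρ' ∧ 1 ≤ φ ρ ∧
        A * (1 + Real.log (1 / (1 - ρ'))) < φ ρ' := by
    intro ρ a0 a1 a2
    have a3 : 0 ≤ Real.log (1 / (1 - ρ)) := Real.log_nonneg (by rw [le_div_iff₀ (by linarith)]; linarith)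
    set l := Real.log (1 / (1 - ρ)) with hl
    set x := φ ρ with hx
    have hxA : A < x := by nlinarith
    have hx1 : 1 ≤ x := by linarith
    have a4 : (1 - ρ) / (4 * x) ≤ (1 - ρ) / 4 := by
      apply div_le_div_of_nonneg_left <;> linarith
    have a4' : 0 < (1 - ρ) / (4 * x) := by apply div_pos <;> linarith
    have : ∃ t, ρ ≤ t ∧ t ≤ ρ + (1 - ρ) / (4 * x) ∧ 2 * x < φ t := by
      by_contra hn
      push Not at hn
      have a5 := h ρ (ρ + (1 - ρ) / (4 * x)) (2 * x) a0 (by linarith) (by linarith) (by linarith) hn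
      have a6 : Real.log (1 / (ρ + (1 - ρ) / (4 * x) - ρ)) = Real.log 4 + Real.log x + l := by
        rw [hl, ← Real.log_mul (by norm_num) (by linarith), ← Real.log_mul (by nlinarith) (by
          have : 1 - ρ ≠ 0 := by linarith
          positivity)]
        congr 1
        rw [add_sub_cancel_left]; field_simp
      rw [a6] at a5
      have a7 : Real.log x ≤ Real.log (1 + 2 * x) := Real.log_le_log (by linarith) (by linarith)
      have a8 : Real.log 4 ≤ 2 := by
        have : Real.log 4 = 2 * Real.log 2 := by
          rw [show (4:ℝ) = 2 ^ 2 by norm_num, Real.log_pow]; norm_num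
        have := Real.log_le_sub_one_of_pos (x := 2) (by norm_num)
        linarith
      have a9 := hx0 x (by linarith)
      have : x ≤ C * (3 + 2 * Real.log (1 + 2 * x)) + C * l := by
        refine a5.trans ?_
        rw [← mul_add]
        apply mul_le_mul_of_nonneg_left _ hC; linarith
      nlinarith
    obtain ⟨t, t1, t2, t3⟩ := this
    refine ⟨t, t1, t2, t3, hx1, ?_⟩
    have b1 : Real.log (1 / (1 - t)) ≤ l + 1 := by
      have : 1 / (1 - t) ≤ (1 / (1 - ρ)) * 2 := by
        rw [div_mul_eq_mul_div, div_le_div_iff₀ (by linarith) (by linarith)]; linarith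
      calc _ ≤ Real.log ((1 / (1 - ρ)) * 2) := Real.log_le_log (by apply div_pos <;> linarith) this
        _ = l + Real.log 2 := by
          rw [Real.log_mul (by
            have : 1 - ρ ≠ 0 := by linarith
            positivity) (by norm_num)]
        _ ≤ _ := by
          have := Real.log_le_sub_one_of_pos (x := 2) (by norm_num)
          linarith
    nlinarith
  have ind : ∀ k : ℕ, ∃ ρ, ρ0 ≤ ρ ∧ (1 - ρ0) * (1/2 + (1/2)^k / 2) ≤ 1 - ρ ∧ (2:ℝ)^k ≤ φ ρ ∧
      A * (1 + Real.log (1 / (1 - ρ))) < φ ρ := by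
    intro k
    induction k with
    | zero =>
      refine ⟨ρ0, le_rfl, by norm_num, ?_, h2⟩
      obtain ⟨_, _, _, _, h3, _⟩ := step ρ0 h0 h1 h2
      simpa using h3
    | succ k ih =>
      obtain ⟨ρ, c1, c2, c3, c4⟩ := ih
      have hy0 : 0 < (1/2:ℝ)^k := by positivity
      have hy1 : (1/2:ℝ)^k ≤ 1 := pow_le_one₀ (by norm_num) (by norm_num)
      have c5 : ρ < 1 := by nlinarith
      obtain ⟨t, t1, t2, t3, t4, t5⟩ := step ρ (by linarith) c5 c4
      refine ⟨t, by linarith, ?_, by rw [pow_succ]; linarith, t5⟩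
      have c6 : (1 - ρ) / (4 * φ ρ) ≤ (1 - ρ) * ((1/2)^k / 4) := by
        rw [div_eq_mul_inv]
        apply mul_le_mul_of_nonneg_left _ (by linarith)
        rw [inv_le_comm₀ (by linarith) (by positivity)]
        rw [one_div, inv_pow]
        field_simp
        linarith
      rw [pow_succ]
      set y := (1/2:ℝ)^k
      have c7 : (1 - ρ) * (1 - y / 4) ≤ 1 - t := by nlinarith
      have c8 : (1 - ρ0) * (1/2 + y / 2) * (1 - y / 4) ≤ (1 - ρ) * (1 - y / 4) := by
        apply mul_le_mul_of_nonneg_right c2; linarith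
      have c9 : 1/2 + y * (1/2) / 2 ≤ (1/2 + y/2) * (1 - y/4) := by nlinarith
      nlinarith
  obtain ⟨B, hB⟩ := hb (1 - (1 - ρ0) / 2) (by linarith)
  obtain ⟨k, hk⟩ := pow_unbounded_of_one_lt B (by norm_num : (1:ℝ) < 2)
  obtain ⟨ρ, c1, c2, c3, c4⟩ := ind k
  have hy0 : 0 < (1/2:ℝ)^k := by positivity
  have := hB ρ (by linarith) (by nlinarith)
  linarith

theorem clunie_disc {L c : ℂ → ℂ} {Bc : ℝ} (aL : AnB L) (ac : AnB c) (hcb : ∀ z ∈ ball (0:ℂ) 1, ‖c z‖ ≤ Bc)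
    (hc0 : ∀ z ∈ ball (0:ℂ) 1, c z ≠ 0) (hK : ∀ z ∈ ball (0:ℂ) 1, c z * deriv L z + L z ^ 2 ≠ 0) :
    ∃ A : ℝ, 0 ≤ A ∧ ∀ ρ, 1/2 ≤ ρ → ρ < 1 → mm L ρ ≤ A * (1 + Real.log (1 / (1 - ρ))) := by
  obtain ⟨C, hC, h⟩ := clunie_small aL ac hcb hc0 hK
  refine borel_growth hC h ?_
  intro r hr
  have hcomp : IsCompact (closedBall (0:ℂ) r) := isCompact_closedBall _ _
  obtain ⟨B, hB⟩ := hcomp.exists_bound_of_continuousOn (f := L) (fun z hz =>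
    ((aL z (by rw [mem_ball]; rw [mem_closedBall] at hz; linarith)).continuousAt).continuousWithinAt)
  refine ⟨Real.posLog |B|, fun t h1 h2 => ?_⟩
  apply mm_le_of_le (abs_nonneg _) aL.meB (by linarith) (by linarith)
  intro z hz
  refine (hB z ?_).trans (le_abs_self _)
  rw [mem_sphere, abs_of_nonneg (by linarith)] at hz
  rw [mem_closedBall]; linarith

end


section
set_option linter.all false
open Complex Filter Topology MeasureTheory
open scoped Classical
open Metric

theorem polar_lint {G : ℂ → ENNReal} (hG : Measurable G) :
    ∫⁻ z, G z = ∫⁻ r in Set.Ioi (0:ℝ), ENNReal.ofReal r * ∫⁻ θ in Set.Ioo (-Real.pi) Real.pi, G (circleMap 0 r θ) := by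
  rw [← Complex.lintegral_comp_polarCoord_symm]
  have hm : ∀ p : ℝ × ℝ, Complex.polarCoord.symm p = circleMap 0 p.1 p.2 := by
    intro p
    rw [Complex.polarCoord_symm_apply, circleMap, zero_add, Complex.exp_mul_I]
    push_cast; rfl
  simp_rw [hm]
  have hmeas : Measurable (fun p : ℝ × ℝ => circleMap 0 p.1 p.2) := by
    apply Continuous.measurable
    unfold circleMap; fun_prop
  rw [polarCoord_target, Measure.volume_eq_prod, ← Measure.prod_restrict, lintegral_prod]
  · apply lintegral_congr
    intro r
    simp only [smul_eq_mul]
    rw [lintegral_const_mul]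
    exact hG.comp (hmeas.comp (by fun_prop : Measurable (fun y : ℝ => (r, y))))
  · apply Measurable.aemeasurable
    exact (ENNReal.measurable_ofReal.comp measurable_fst).smul (hG.comp hmeas)

theorem circle_lint {u : ℂ → ℝ} {r : ℝ} (hu : ∀ z, 0 ≤ u z) (hi : CircleIntegrable u 0 r) :
    ∫⁻ θ in Set.Ioo (-Real.pi) Real.pi, ENNReal.ofReal (u (circleMap 0 r θ)) =
      ENNReal.ofReal (2 * Real.pi * Real.circleAverage u 0 r) := by
  have hpi := Real.pi_pos
  have hper : Function.Periodic (fun θ => u (circleMap 0 r θ)) (2 * Real.pi) := by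
    intro θ; simp only []; rw [periodic_circleMap 0 r θ]
  have h1 : ∫ θ in (0:ℝ)..2 * Real.pi, u (circleMap 0 r θ) = ∫ θ in (-Real.pi)..Real.pi, u (circleMap 0 r θ) := by
    have := hper.intervalIntegral_add_eq 0 (-Real.pi)
    rw [zero_add] at this
    rw [this]; congr 1; ring
  have hi' : IntervalIntegrable (fun θ => u (circleMap 0 r θ)) volume (-Real.pi) Real.pi := by
    have h2 : IntervalIntegrable (fun θ => u (circleMap 0 r θ)) volume 0 (0 + 2 * Real.pi) := by
      rw [zero_add]; exact hi
    exact hper.intervalIntegrable (by positivity) h2 _ _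
  rw [Real.circleAverage_def, smul_eq_mul, h1, intervalIntegral.integral_of_le (by linarith), integral_Ioc_eq_integral_Ioo]
  rw [← mul_assoc, mul_inv_cancel₀ (by positivity), one_mul]
  rw [ofReal_integral_eq_lintegral_ofReal]
  · exact ((intervalIntegrable_iff_integrableOn_Ioc_of_le (by linarith)).1 hi').mono_set Set.Ioo_subset_Ioc_self
  · exact Eventually.of_forall (fun θ => hu _)

theorem log_one_sub_int {ε : ℝ} (h0 : 0 < ε) :
    IntervalIntegrable (fun r => Real.log (1 - r)) volume (1 - ε) 1 ∧
      ∫ r in (1 - ε)..1, Real.log (1 - r) = ε * Real.log ε - ε := by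
  constructor
  · have := (intervalIntegral.intervalIntegrable_log' (a := ε) (b := 0)).comp_sub_left 1
    simpa using this
  · rw [intervalIntegral.integral_comp_sub_left (fun x => Real.log x) 1]
    simp

theorem meas_ind {F : ℂ → ℂ} {S U : Set ℂ} (hU : IsOpen U) (hS : MeasurableSet S) (hSU : S ⊆ U) (hF : ContinuousOn F U) :
    Measurable (S.indicator (fun z => ENNReal.ofReal (Real.posLog ‖F z‖))) := by
  have hc : ContinuousOn (fun z => Real.posLog ‖F z‖) S :=
    (Real.continuous_posLog.comp continuous_norm).comp_continuousOn (hF.mono hSU)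
  have h2 : ContinuousOn (fun z => ENNReal.ofReal (Real.posLog ‖F z‖)) S := ENNReal.continuous_ofReal.comp_continuousOn hc
  exact h2.measurable_piecewise (continuous_zero.continuousOn) hS

theorem area_disc {F : ℂ → ℂ} (aF : AnB F) {A : ℝ} (hA : 0 ≤ A)
    (h : ∀ ρ, 1/2 ≤ ρ → ρ < 1 → mm F ρ ≤ A * (1 + Real.log (1 / (1 - ρ)))) {ε : ℝ} (h0 : 0 < ε) (h1 : ε ≤ 1/2) :
    ∫⁻ w in {w : ℂ | 1 - ε ≤ ‖w‖ ∧ ‖w‖ < 1}, ENNReal.ofReal (Real.posLog ‖F w‖) ≤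
      ENNReal.ofReal (2 * Real.pi * A * (ε * (2 + Real.log (1 / ε)))) := by
  have hpi := Real.pi_pos
  set S := {w : ℂ | 1 - ε ≤ ‖w‖ ∧ ‖w‖ < 1} with hS
  have mS : MeasurableSet S := (measurableSet_le measurable_const measurable_norm).inter (measurableSet_lt measurable_norm measurable_const)
  have hsub : S ⊆ ball (0:ℂ) 1 := fun w hw => by rw [mem_ball_zero_iff]; exact hw.2
  have mG := meas_ind isOpen_ball mS hsub aF.continuousOn
  rw [← lintegral_indicator mS, polar_lint mG]
  have key : ∀ r ∈ Set.Ioi (0:ℝ), ENNReal.ofReal r * ∫⁻ θ in Set.Ioo (-Real.pi) Real.pi,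
      S.indicator (fun z => ENNReal.ofReal (Real.posLog ‖F z‖)) (circleMap 0 r θ) ≤
      (Set.Ico (1 - ε) 1).indicator (fun r => ENNReal.ofReal (2 * Real.pi * (A * (1 - Real.log (1 - r))))) r := by
    intro r hr
    have hr' : 0 < r := hr
    by_cases hrS : r ∈ Set.Ico (1 - ε) 1
    · rw [Set.indicator_of_mem hrS]
      have e : ∀ θ, S.indicator (fun z => ENNReal.ofReal (Real.posLog ‖F z‖)) (circleMap 0 r θ) =
          ENNReal.ofReal (Real.posLog ‖F (circleMap 0 r θ)‖) := by
        intro θ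
        apply Set.indicator_of_mem
        rw [hS]; simp only [Set.mem_setOf_eq, norm_circleMap_zero, abs_of_pos hr']
        exact hrS
      simp_rw [e]
      rw [circle_lint (u := fun z => Real.posLog ‖F z‖) (fun z => Real.posLog_nonneg) (mm_int aF.meB hr'.le hrS.2),
        ← ENNReal.ofReal_mul hr'.le]
      apply ENNReal.ofReal_le_ofReal
      have := h r (by linarith [hrS.1]) hrS.2
      rw [one_div, Real.log_inv] at this
      have h3 : 0 ≤ mm F r := mm_nonneg F r
      change r * (2 * Real.pi * mm F r) ≤ _
      calc r * (2 * Real.pi * mm F r) ≤ 1 * (2 * Real.pi * mm F r) := by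
            apply mul_le_mul_of_nonneg_right hrS.2.le; positivity
        _ ≤ _ := by rw [one_mul]; apply mul_le_mul_of_nonneg_left _ (by positivity); linarith
    · rw [Set.indicator_of_notMem hrS]
      have e : ∀ θ, S.indicator (fun z => ENNReal.ofReal (Real.posLog ‖F z‖)) (circleMap 0 r θ) = 0 := by
        intro θ
        apply Set.indicator_of_notMem
        rw [hS]; simp only [Set.mem_setOf_eq, norm_circleMap_zero, abs_of_pos hr']
        exact hrS
      simp_rw [e]; simp
  refine (setLIntegral_mono' measurableSet_Ioi key).trans ?_
  refine (setLIntegral_le_lintegral _ _).trans ?_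
  rw [lintegral_indicator measurableSet_Ico]
  obtain ⟨i1, i2⟩ := log_one_sub_int h0
  have i3 : IntervalIntegrable (fun r => 2 * Real.pi * (A * (1 - Real.log (1 - r)))) volume (1 - ε) 1 :=
    ((intervalIntegrable_const.sub i1).const_mul A).const_mul _
  rw [← ofReal_integral_eq_lintegral_ofReal]
  · apply ENNReal.ofReal_le_ofReal
    rw [integral_Ico_eq_integral_Ioo, ← integral_Ioc_eq_integral_Ioo, ← intervalIntegral.integral_of_le (by linarith)]
    rw [intervalIntegral.integral_const_mul, intervalIntegral.integral_const_mul,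
      intervalIntegral.integral_sub intervalIntegrable_const i1, i2]
    apply le_of_eq
    rw [one_div, Real.log_inv]
    simp
    ring
  · have := ((intervalIntegrable_iff_integrableOn_Ioc_of_le (by linarith)).1 i3)
    exact ((integrableOn_Ico_iff_integrableOn_Ioo enorm_ne_top).2 (this.mono_set Set.Ioo_subset_Ioc_self))
  · rw [EventuallyLE, ae_restrict_iff' measurableSet_Ico]
    refine Eventually.of_forall (fun r hr => ?_)
    have : Real.log (1 - r) ≤ 0 := Real.log_nonpos (by linarith [hr.2]) (by linarith [hr.1])
    have : 0 ≤ 1 - Real.log (1 - r) := by linarith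
    simp only [Pi.zero_apply]
    positivity

end


section
set_option linter.all false
open Complex Filter Topology MeasureTheory
open scoped Classical
open Metric

def OmU (r0 : ℝ) : Set ℂ := {z | 0 < z.im ∧ r0 < ‖z‖}

theorem OmU_open (r0 : ℝ) : IsOpen (OmU r0) :=
  (isOpen_lt continuous_const Complex.continuous_im).inter (isOpen_lt continuous_const continuous_norm)

noncomputable def zet (r0 : ℝ) (z : ℂ) : ℂ := z / r0 + r0 / z
noncomputable def TT (r0 : ℝ) (z : ℂ) : ℂ := (zet r0 z - I) / (zet r0 z + I)
noncomputable def jouk (ζ : ℂ) : ℂ := (ζ + Complex.exp ((Complex.log (ζ - 2) + Complex.log (ζ + 2)) / 2)) / 2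
noncomputable def cay (w : ℂ) : ℂ := I * (1 + w) / (1 - w)
noncomputable def Psi (r0 : ℝ) (w : ℂ) : ℂ := r0 * jouk (cay w)

theorem im_zet {r0 : ℝ} (h0 : 0 < r0) {z : ℂ} (hz : z ≠ 0) :
    (zet r0 z).im = z.im / r0 * (1 - r0 ^ 2 / ‖z‖ ^ 2) := by
  unfold zet
  have hn : ‖z‖ ≠ 0 := norm_ne_zero_iff.2 hz
  rw [Complex.add_im, Complex.div_ofReal_im, div_eq_mul_inv (r0:ℂ) z, Complex.im_ofReal_mul, Complex.inv_im,
    ← Complex.sq_norm]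
  field_simp
  ring

theorem cay_im {w : ℂ} (hw : ‖w‖ < 1) : 0 < (cay w).im := by
  have h1 : (1:ℂ) - w ≠ 0 := by
    intro h; rw [sub_eq_zero] at h; rw [← h] at hw; simp at hw
  have h2 : 0 < normSq (1 - w) := normSq_pos.2 h1
  unfold cay
  have h3 : w.re * w.re + w.im * w.im < 1 := by
    have := Complex.sq_norm w
    rw [normSq_apply] at this
    nlinarith [norm_nonneg w]
  rw [Complex.div_im]
  simp only [mul_im, mul_re, I_re, I_im, add_re, add_im, sub_re, sub_im, one_re, one_im]
  rw [← sub_div]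
  apply div_pos _ h2
  nlinarith

theorem jouk_spec {ζ : ℂ} (hζ : 0 < ζ.im) : jouk ζ ^ 2 - ζ * jouk ζ + 1 = 0 ∧ 0 < (jouk ζ).im ∧ AnalyticAt ℂ jouk ζ := by
  set s := Complex.exp ((Complex.log (ζ - 2) + Complex.log (ζ + 2)) / 2) with hs
  have n1 : ζ - 2 ≠ 0 := fun h => by have := congrArg im h; simp at this; linarith
  have n2 : ζ + 2 ≠ 0 := fun h => by have := congrArg im h; simp at this; linarith
  have hs2 : s ^ 2 = ζ ^ 2 - 4 := by
    rw [hs, ← Complex.exp_nat_mul]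
    push_cast
    rw [mul_div_cancel₀ _ (by norm_num : (2:ℂ) ≠ 0), Complex.exp_add, Complex.exp_log n1, Complex.exp_log n2]; ring
  have hj : jouk ζ = (ζ + s) / 2 := rfl
  refine ⟨?_, ?_, ?_⟩
  · rw [hj]; linear_combination (1/4) * hs2
  · have a1 : 0 < (ζ - 2).arg ∧ (ζ - 2).arg < Real.pi := by
      constructor
      · refine lt_of_le_of_ne (Complex.arg_nonneg_iff.2 (by simp; linarith)) ?_
        intro h
        have := (Complex.arg_eq_zero_iff.1 h.symm).2
        simp at this; linarith
      · refine lt_of_le_of_ne (Complex.arg_le_pi _) ?_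
        intro h
        have := (Complex.arg_eq_pi_iff.1 h).2
        simp at this; linarith
    have a2 : 0 < (ζ + 2).arg ∧ (ζ + 2).arg < Real.pi := by
      constructor
      · refine lt_of_le_of_ne (Complex.arg_nonneg_iff.2 (by simp; linarith)) ?_
        intro h
        have := (Complex.arg_eq_zero_iff.1 h.symm).2
        simp at this; linarith
      · refine lt_of_le_of_ne (Complex.arg_le_pi _) ?_
        intro h
        have := (Complex.arg_eq_pi_iff.1 h).2
        simp at this; linarith
    have a3 : 0 < s.im := by
      rw [hs, Complex.exp_im]
      apply mul_pos (Real.exp_pos _)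
      apply Real.sin_pos_of_pos_of_lt_pi
      · simp [Complex.log_im]; linarith
      · simp [Complex.log_im]; linarith
    rw [hj]
    simp
    linarith
  · unfold jouk
    have l1 : AnalyticAt ℂ (fun ζ : ℂ => Complex.log (ζ - 2)) ζ := by
      apply AnalyticAt.clog (by fun_prop)
      right; simp; linarith
    have l2 : AnalyticAt ℂ (fun ζ : ℂ => Complex.log (ζ + 2)) ζ := by
      apply AnalyticAt.clog (by fun_prop)
      right; simp; linarith
    exact (analyticAt_id.add (((l1.add l2).div analyticAt_const (by norm_num)).cexp)).div analyticAt_const (by norm_num)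

end


section
set_option linter.all false
open Complex Filter Topology MeasureTheory
open scoped Classical
open Metric

theorem OmU_ne {r0 : ℝ} {z : ℂ} (hz : z ∈ OmU r0) : z ≠ 0 := by
  rintro rfl; have := hz.1; simp at this

theorem zet_im_pos {r0 : ℝ} (h0 : 0 < r0) {z : ℂ} (hz : z ∈ OmU r0) : 0 < (zet r0 z).im := by
  rw [im_zet h0 (OmU_ne hz)]
  apply mul_pos (div_pos hz.1 h0)
  have : r0 < ‖z‖ := hz.2
  rw [sub_pos, div_lt_one (by nlinarith)]
  nlinarith

theorem add_I_ne {ζ : ℂ} (h : 0 < ζ.im) : ζ + I ≠ 0 ∧ 1 ≤ ‖ζ + I‖ := by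
  have : 1 ≤ ‖ζ + I‖ := by
    refine le_trans ?_ (Complex.abs_im_le_norm _)
    rw [abs_of_pos (by simp; linarith)]; simp; linarith
  exact ⟨fun h => by rw [h] at this; simp at this; linarith, this⟩

theorem Psi_spec {r0 : ℝ} (h0 : 0 < r0) {w : ℂ} (hw : ‖w‖ < 1) :
    Psi r0 w ∈ OmU r0 ∧ TT r0 (Psi r0 w) = w ∧ AnalyticAt ℂ (Psi r0) w := by
  have h1 : (1:ℂ) - w ≠ 0 := by
    intro h; rw [sub_eq_zero] at h; rw [← h] at hw; simp at hw
  have hr : (r0:ℂ) ≠ 0 := by exact_mod_cast h0.ne'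
  obtain ⟨e1, e2, e3⟩ := jouk_spec (cay_im hw)
  set φ := jouk (cay w) with hφ
  have hφ0 : φ ≠ 0 := by rintro h; rw [h] at e2; simp at e2
  have hz : φ + 1 / φ = cay w := by field_simp; linear_combination e1
  have hz1 : zet 1 φ = cay w := by unfold zet; rw [← hz]; simp
  have hn : 1 < ‖φ‖ := by
    have h3 := im_zet one_pos hφ0
    rw [hz1] at h3
    have h4 := cay_im hw
    rw [h3] at h4
    have h5 := (pos_iff_pos_of_mul_pos h4).1 (by simpa using e2)
    by_contra hcon
    push Not at hcon
    have h6 : 0 < ‖φ‖ := norm_pos_iff.2 hφ0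
    have : 1 ≤ 1 ^ 2 / ‖φ‖ ^ 2 := by rw [le_div_iff₀ (by positivity)]; nlinarith
    linarith
  have hP : Psi r0 w = r0 * φ := rfl
  refine ⟨⟨?_, ?_⟩, ?_, ?_⟩
  · rw [hP, Complex.im_ofReal_mul]; positivity
  · rw [hP, norm_mul, Complex.norm_real, Real.norm_of_nonneg h0.le]; nlinarith
  · have : zet r0 (Psi r0 w) = cay w := by
      rw [hP, ← hz]; unfold zet; field_simp
    unfold TT
    rw [this]
    unfold cay
    have h2 : I * (1 + w) / (1 - w) + I = 2 * I / (1 - w) := by field_simp; ring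
    have h3 : I * (1 + w) / (1 - w) - I = 2 * I * w / (1 - w) := by field_simp; ring
    rw [h2, h3]
    have := I_ne_zero
    field_simp
  · unfold Psi
    apply AnalyticAt.mul analyticAt_const
    apply AnalyticAt.comp' e3
    unfold cay
    exact (analyticAt_const.mul (analyticAt_const.add analyticAt_id)).div (analyticAt_const.sub analyticAt_id) h1

noncomputable def TTd (r0 : ℝ) (z : ℂ) : ℂ := 2 * I / (zet r0 z + I) ^ 2 * (1 / r0 - r0 / z ^ 2)

theorem TT_deriv {r0 : ℝ} (h0 : 0 < r0) {z : ℂ} (hz : z ∈ OmU r0) : HasDerivAt (TT r0) (TTd r0 z) z := by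
  have hz0 := OmU_ne hz
  have hr : (r0:ℂ) ≠ 0 := by exact_mod_cast h0.ne'
  have d1 : HasDerivAt (zet r0) (1 / r0 - r0 / z ^ 2) z := by
    have a1 := (hasDerivAt_id z).div_const (r0:ℂ)
    have a2 := (hasDerivAt_inv hz0).const_mul (r0:ℂ)
    have a3 := a1.add a2
    refine HasDerivAt.congr_deriv (f' := 1 / (r0:ℂ) + r0 * (-(z^2)⁻¹)) ?_ (by ring)
    exact a3
  have hne := (add_I_ne (zet_im_pos h0 hz)).1
  have d2 := (d1.sub_const I).div (d1.add_const I) hne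
  refine HasDerivAt.congr_deriv (f' := _) d2 ?_
  unfold TTd
  field_simp
  ring

theorem TT_norm {r0 : ℝ} (h0 : 0 < r0) {z : ℂ} (hz : z ∈ OmU r0) : ‖TT r0 z‖ < 1 := by
  have h1 := zet_im_pos h0 hz
  have h2 := add_I_ne h1
  unfold TT
  set ζ := zet r0 z
  rw [norm_div, div_lt_one (by linarith)]
  apply lt_of_pow_lt_pow_left₀ 2 (norm_nonneg _)
  rw [Complex.sq_norm, Complex.sq_norm, normSq_apply, normSq_apply]
  simp
  nlinarith

theorem TT_inj {r0 : ℝ} (h0 : 0 < r0) : Set.InjOn (TT r0) (OmU r0) := by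
  intro z hz u hu h
  have hz0 := OmU_ne hz
  have hu0 := OmU_ne hu
  have hr : (r0:ℂ) ≠ 0 := by exact_mod_cast h0.ne'
  have h1 := (add_I_ne (zet_im_pos h0 hz)).1
  have h2 := (add_I_ne (zet_im_pos h0 hu)).1
  have h3 : zet r0 z = zet r0 u := by
    unfold TT at h
    rw [div_eq_div_iff h1 h2] at h
    have : (2 * I) * (zet r0 z - zet r0 u) = 0 := by linear_combination h
    have := (mul_eq_zero.1 this).resolve_left (mul_ne_zero two_ne_zero I_ne_zero)
    exact sub_eq_zero.1 this
  unfold zet at h3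
  field_simp at h3
  have h4 : (z - u) * (z * u - r0 ^ 2) = 0 := by linear_combination h3
  rcases mul_eq_zero.1 h4 with h5 | h5
  · exact sub_eq_zero.1 h5
  · exfalso
    have h6 := congrArg norm (sub_eq_zero.1 h5)
    rw [norm_mul, norm_pow, Complex.norm_real, Real.norm_of_nonneg h0.le] at h6
    have a1 : r0 < ‖z‖ := hz.2
    have a2 : r0 < ‖u‖ := hu.2
    nlinarith

theorem Psi_TT {r0 : ℝ} (h0 : 0 < r0) {z : ℂ} (hz : z ∈ OmU r0) : Psi r0 (TT r0 z) = z := by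
  obtain ⟨h1, h2, _⟩ := Psi_spec h0 (TT_norm h0 hz)
  exact TT_inj h0 h1 hz h2

theorem TTd_ne {r0 : ℝ} (h0 : 0 < r0) {w : ℂ} (hw : ‖w‖ < 1) : TTd r0 (Psi r0 w) * deriv (Psi r0) w = 1 := by
  obtain ⟨h1, h2, h3⟩ := Psi_spec h0 hw
  have d1 := (TT_deriv h0 h1).comp w h3.differentiableAt.hasDerivAt
  have : (TT r0 ∘ Psi r0) =ᶠ[𝓝 w] id := by
    have : ball (0:ℂ) 1 ∈ 𝓝 w := isOpen_ball.mem_nhds (by simpa using hw)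
    filter_upwards [this] with v hv
    exact (Psi_spec h0 (by simpa using hv)).2.1
  exact d1.unique ((hasDerivAt_id w).congr_of_eventuallyEq this)

theorem TTd_bdd {r0 : ℝ} (h0 : 0 < r0) {z : ℂ} (hz : z ∈ OmU r0) : ‖TTd r0 z‖ ≤ 4 / r0 := by
  have h1 := (add_I_ne (zet_im_pos h0 hz)).2
  have hz2 : r0 < ‖z‖ := hz.2
  have hzp : 0 < ‖z‖ := h0.trans hz2
  unfold TTd
  rw [norm_mul, norm_div, norm_pow]
  have a1 : ‖2 * I‖ / ‖zet r0 z + I‖ ^ 2 ≤ 2 := by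
    rw [div_le_iff₀ (by positivity)]; simp; nlinarith
  have a2 : ‖1 / (r0:ℂ) - r0 / z ^ 2‖ ≤ 2 / r0 := by
    refine (norm_sub_le _ _).trans ?_
    rw [norm_div, norm_div, norm_pow, Complex.norm_real, Real.norm_of_nonneg h0.le, norm_one]
    have : r0 / ‖z‖ ^ 2 ≤ 1 / r0 := by rw [div_le_div_iff₀ (by positivity) h0]; nlinarith
    calc _ ≤ 1 / r0 + 1 / r0 := by linarith
      _ = _ := by ring
  calc _ ≤ 2 * (2 / r0) := by gcongr
    _ = _ := by ring

theorem TT_bounds {r0 R : ℝ} (h0 : 0 < r0) (hR : 8 * r0 ≤ R) {z : ℂ} (hz : z ∈ OmU r0) (h1 : R < ‖z‖) (h2 : ‖z‖ < 2 * R) :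
    r0 / (16 * R ^ 2) ≤ ‖TTd r0 z‖ ∧ 1 - 4 * r0 / R ≤ ‖TT r0 z‖ := by
  have hz0 := OmU_ne hz
  have hr : (r0:ℂ) ≠ 0 := by exact_mod_cast h0.ne'
  have hRp : 0 < R := by linarith
  have b1 : ‖(r0:ℂ) / z‖ ≤ 1 := by
    rw [norm_div, Complex.norm_real, Real.norm_of_nonneg h0.le, div_le_one (by linarith)]; linarith
  have b2 : ‖z / (r0:ℂ)‖ = ‖z‖ / r0 := by rw [norm_div, Complex.norm_real, Real.norm_of_nonneg h0.le]
  have b0 : 8 ≤ R / r0 := by rw [le_div_iff₀ h0]; linarith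
  have up : ‖zet r0 z + I‖ ≤ 4 * R / r0 := by
    have : ‖zet r0 z + I‖ ≤ ‖z / (r0:ℂ)‖ + ‖(r0:ℂ) / z‖ + ‖I‖ := by
      unfold zet; exact (norm_add_le _ _).trans (by gcongr; exact norm_add_le _ _)
    rw [b2, norm_I] at this
    have h3 : ‖z‖ / r0 ≤ 2 * R / r0 := by gcongr
    have : 2 * R / r0 = 2 * (R / r0) := by ring
    have : 4 * R / r0 = 4 * (R / r0) := by ring
    linarith
  have lo : R / (2 * r0) ≤ ‖zet r0 z + I‖ := by
    have : ‖z / (r0:ℂ)‖ ≤ ‖zet r0 z + I‖ + ‖(r0:ℂ) / z‖ + ‖I‖ := by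
      have e : z / (r0:ℂ) = (zet r0 z + I) - r0 / z - I := by unfold zet; ring
      rw [e]
      exact (norm_sub_le _ _).trans (by gcongr; exact norm_sub_le _ _)
    rw [b2, norm_I] at this
    have h3 : R / r0 ≤ ‖z‖ / r0 := by gcongr
    have : R / (2 * r0) = (R / r0) / 2 := by field_simp
    linarith
  have hne := (add_I_ne (zet_im_pos h0 hz)).1
  have hnp : 0 < ‖zet r0 z + I‖ := norm_pos_iff.2 hne
  constructor
  · unfold TTd
    rw [norm_mul, norm_div, norm_pow]
    have a1 : r0 ^ 2 / (8 * R ^ 2) ≤ ‖2 * I‖ / ‖zet r0 z + I‖ ^ 2 := by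
      rw [div_le_div_iff₀ (by positivity) (by positivity)]
      have : ‖zet r0 z + I‖ ^ 2 ≤ (4 * R / r0) ^ 2 := by gcongr
      have e : r0 ^ 2 * (4 * R / r0) ^ 2 = 16 * R ^ 2 := by field_simp; norm_num
      have : r0 ^ 2 * ‖zet r0 z + I‖ ^ 2 ≤ 16 * R ^ 2 := by rw [← e]; gcongr
      simp; linarith
    have a2 : 1 / (2 * r0) ≤ ‖1 / (r0:ℂ) - r0 / z ^ 2‖ := by
      have := norm_sub_norm_le (1 / (r0:ℂ)) (r0 / z ^ 2)
      rw [norm_div, norm_div, norm_pow, Complex.norm_real, Real.norm_of_nonneg h0.le, norm_one] at this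
      have h3 : r0 / ‖z‖ ^ 2 ≤ 1 / (2 * r0) := by rw [div_le_div_iff₀ (by positivity) (by positivity)]; nlinarith
      have : 1 / r0 = 1 / (2 * r0) + 1 / (2 * r0) := by field_simp; norm_num
      linarith
    calc r0 / (16 * R ^ 2) = r0 ^ 2 / (8 * R ^ 2) * (1 / (2 * r0)) := by field_simp; norm_num
      _ ≤ _ := by gcongr
  · have e : (1:ℂ) - TT r0 z = 2 * I / (zet r0 z + I) := by unfold TT; field_simp; ring
    have h3 := norm_sub_norm_le (1:ℂ) (TT r0 z)
    rw [e, norm_one, norm_div] at h3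
    have : ‖2 * I‖ / ‖zet r0 z + I‖ ≤ 4 * r0 / R := by
      rw [div_le_div_iff₀ hnp hRp]
      have : R ≤ ‖zet r0 z + I‖ * (2 * r0) := by rwa [div_le_iff₀ (by positivity)] at lo
      simp; nlinarith
    linarith

end


section
set_option linter.all false
open Complex Filter Topology MeasureTheory
open scoped Classical
open Metric

theorem det_cmul (a : ℂ) : (((ContinuousLinearMap.toSpanSingleton ℂ a : ℂ →L[ℂ] ℂ).restrictScalars ℝ) : ℂ →L[ℝ] ℂ).det = ‖a‖ ^ 2 := by
  have := Algebra.norm_complex_apply a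
  rw [Complex.sq_norm, ← this, Algebra.norm_apply, ContinuousLinearMap.det]
  congr 1
  ext x <;> simp [mul_comm]

theorem area_half {r0 : ℝ} (h0 : 0 < r0) {lam : ℂ → ℂ} (al : AnalyticOnNhd ℂ lam (OmU r0))
    (hK : ∀ z ∈ OmU r0, deriv lam z + lam z ^ 2 ≠ 0) :
    ∃ C : ℝ, 0 ≤ C ∧ ∀ R, 8 * r0 ≤ R →
      ∫⁻ z in {z : ℂ | z ∈ OmU r0 ∧ R < ‖z‖ ∧ ‖z‖ < 2 * R}, ENNReal.ofReal (Real.posLog ‖lam z‖) ≤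
        ENNReal.ofReal (C * (R ^ 3 * (2 + Real.log (R / (4 * r0))))) := by
  have inb : ∀ {w : ℂ}, w ∈ ball (0:ℂ) 1 → ‖w‖ < 1 := fun hw => by simpa using hw
  set Lam : ℂ → ℂ := fun w => lam (Psi r0 w) with hLam
  have aPsi : AnB (Psi r0) := fun w hw => (Psi_spec h0 (inb hw)).2.2
  have hmem : ∀ w ∈ ball (0:ℂ) 1, Psi r0 w ∈ OmU r0 := fun w hw => (Psi_spec h0 (inb hw)).1
  have aLam : AnB Lam := fun w hw => AnalyticAt.comp' (al _ (hmem w hw)) (aPsi w hw)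
  have aTTd : ∀ z ∈ OmU r0, AnalyticAt ℂ (TTd r0) z := by
    intro z hz
    have hz0 := OmU_ne hz
    have hr : (r0:ℂ) ≠ 0 := by exact_mod_cast h0.ne'
    have hne := (add_I_ne (zet_im_pos h0 hz)).1
    have a1 : AnalyticAt ℂ (zet r0) z := by
      unfold zet
      exact (analyticAt_id.div analyticAt_const hr).add (analyticAt_const.div analyticAt_id hz0)
    unfold TTd
    exact (analyticAt_const.div ((a1.add analyticAt_const).pow 2) (pow_ne_zero _ hne)).mul
      (analyticAt_const.sub (analyticAt_const.div (analyticAt_id.pow 2) (pow_ne_zero _ hz0)))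
  set c : ℂ → ℂ := fun w => TTd r0 (Psi r0 w) with hc
  have ac : AnB c := fun w hw => AnalyticAt.comp' (aTTd _ (hmem w hw)) (aPsi w hw)
  obtain ⟨A, hA, hmm⟩ := clunie_disc (Bc := 4 / r0) aLam ac (fun w hw => TTd_bdd h0 (hmem w hw))
    (fun w hw h => by have := TTd_ne h0 (inb hw); simp only [hc] at h; rw [h] at this; simp at this)
    (by
      intro w hw
      have d1 : HasDerivAt Lam (deriv lam (Psi r0 w) * deriv (Psi r0) w) w :=
        HasDerivAt.comp w (al _ (hmem w hw)).differentiableAt.hasDerivAt (aPsi w hw).differentiableAt.hasDerivAt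
      have e := TTd_ne h0 (inb hw)
      have : c w * deriv Lam w + Lam w ^ 2 = deriv lam (Psi r0 w) + lam (Psi r0 w) ^ 2 := by
        rw [d1.deriv]; simp only [hc, hLam]; linear_combination deriv lam (Psi r0 w) * e
      rw [this]
      exact hK _ (hmem w hw))
  have hpi := Real.pi_pos
  refine ⟨256 / r0 ^ 2 * (2 * Real.pi * A * (4 * r0)), by positivity, fun R hR => ?_⟩
  have hRp : 0 < R := by linarith
  set S := {z : ℂ | z ∈ OmU r0 ∧ R < ‖z‖ ∧ ‖z‖ < 2 * R} with hS
  have mS : MeasurableSet S := by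
    apply IsOpen.measurableSet
    exact (OmU_open r0).inter ((isOpen_lt continuous_const continuous_norm).inter (isOpen_lt continuous_norm continuous_const))
  have a1 := area_disc aLam hA hmm (ε := 4 * r0 / R) (by positivity) (by rw [div_le_iff₀ hRp]; linarith)
  set W := {w : ℂ | 1 - 4 * r0 / R ≤ ‖w‖ ∧ ‖w‖ < 1} with hW
  have sub : TT r0 '' S ⊆ W := by
    rintro _ ⟨z, hz, rfl⟩
    exact ⟨(TT_bounds h0 hR hz.1 hz.2.1 hz.2.2).2, TT_norm h0 hz.1⟩
  have cov := lintegral_image_eq_lintegral_abs_det_fderiv_mul volume mS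
    (f := TT r0) (f' := fun z => (ContinuousLinearMap.toSpanSingleton ℂ (TTd r0 z)).restrictScalars ℝ)
    (fun z hz => ((TT_deriv h0 hz.1).hasFDerivAt.restrictScalars ℝ).hasFDerivWithinAt)
    ((TT_inj h0).mono (fun z hz => hz.1)) (fun w => ENNReal.ofReal (Real.posLog ‖Lam w‖))
  have a2 : ∫⁻ z in S, ENNReal.ofReal (r0 ^ 2 / (256 * R ^ 4)) * ENNReal.ofReal (Real.posLog ‖lam z‖) ≤
      ENNReal.ofReal (2 * Real.pi * A * (4 * r0 / R * (2 + Real.log (1 / (4 * r0 / R))))) := by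
    refine le_trans ?_ ((lintegral_mono_set sub).trans a1)
    rw [cov]
    apply setLIntegral_mono' mS
    intro z hz
    rw [det_cmul]
    simp only [hLam]
    rw [Psi_TT h0 hz.1]
    gcongr
    have b := (TT_bounds h0 hR hz.1 hz.2.1 hz.2.2).1
    rw [abs_of_nonneg (by positivity)]
    calc r0 ^ 2 / (256 * R ^ 4) = (r0 / (16 * R ^ 2)) ^ 2 := by field_simp; norm_num
      _ ≤ _ := by gcongr
  rw [lintegral_const_mul' _ _ ENNReal.ofReal_ne_top] at a2
  set Iv := ∫⁻ z in S, ENNReal.ofReal (Real.posLog ‖lam z‖)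
  have hk : ENNReal.ofReal (256 * R ^ 4 / r0 ^ 2) * ENNReal.ofReal (r0 ^ 2 / (256 * R ^ 4)) = 1 := by
    rw [← ENNReal.ofReal_mul (by positivity)]
    rw [show 256 * R ^ 4 / r0 ^ 2 * (r0 ^ 2 / (256 * R ^ 4)) = 1 by field_simp]
    simp
  calc Iv = ENNReal.ofReal (256 * R ^ 4 / r0 ^ 2) * (ENNReal.ofReal (r0 ^ 2 / (256 * R ^ 4)) * Iv) := by
        rw [← mul_assoc, hk, one_mul]
    _ ≤ ENNReal.ofReal (256 * R ^ 4 / r0 ^ 2) * ENNReal.ofReal (2 * Real.pi * A * (4 * r0 / R * (2 + Real.log (1 / (4 * r0 / R))))) := by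
        gcongr
    _ = _ := by
        rw [← ENNReal.ofReal_mul (by positivity)]
        congr 1
        rw [show 1 / (4 * r0 / R) = R / (4 * r0) by field_simp]
        field_simp

end


section
set_option linter.all false
open Complex Filter Topology MeasureTheory
open scoped Classical
open Metric


theorem mtilde_deriv (L : ℂ → ℂ) (z : ℂ) : deriv (mtilde L) z = (starRingEnd ℂ) (deriv L ((starRingEnd ℂ) z)) := by
  exact congrFun (deriv_conj_conj (𝕜 := ℂ) (f := L)) z

theorem mtilde_analyticAt {L : ℂ → ℂ} {z : ℂ} (h : AnalyticAt ℂ L ((starRingEnd ℂ) z)) : AnalyticAt ℂ (mtilde L) z := by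
  rw [Complex.analyticAt_iff_eventually_differentiableAt] at h ⊢
  have hc : Tendsto (fun w : ℂ => (starRingEnd ℂ) w) (𝓝 z) (𝓝 ((starRingEnd ℂ) z)) := Complex.continuous_conj.continuousAt
  filter_upwards [hc.eventually h] with w hw
  have := hw.conj_conj
  rw [Complex.conj_conj] at this
  exact this

theorem upper_circle {r θ : ℝ} (hr : 0 < r) (h1 : -Real.pi < θ) (h2 : θ < Real.pi) (h3 : θ ≠ 0) : (circleMap 0 r θ).im ≠ 0 := by
  have : (circleMap 0 r θ).im = r * Real.sin θ := by
    rw [circleMap, zero_add, Complex.im_ofReal_mul, Complex.exp_ofReal_mul_I_im]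
  rw [this]
  refine mul_ne_zero hr.ne' ?_
  intro h
  rw [Real.sin_eq_zero_iff_of_lt_of_lt h1 h2] at h
  exact h3 h

theorem prox_bound {L : ℂ → ℂ} (mL : Meromorphic L) {r0 : ℝ} (h0 : 0 < r0)
    (aL : ∀ z : ℂ, z.im ≠ 0 → r0 < ‖z‖ → AnalyticAt ℂ L z)
    (hK : ∀ z : ℂ, z.im ≠ 0 → r0 < ‖z‖ → deriv L z + L z ^ 2 ≠ 0) {C1 : ℝ}
    (hN : ∀ᶠ r in atTop, ValueDistribution.logCounting L ⊤ r ≤ C1 * (r * Real.log r)) :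
    ∃ C : ℝ, ∀ᶠ R in atTop, Real.circleAverage (fun z => Real.posLog ‖L z‖) 0 R ≤ C * (R * Real.log R) := by
  have hpi := Real.pi_pos
  obtain ⟨Ca, hCa, hA⟩ := area_half h0 (lam := L) (fun z hz => aL z hz.1.ne' hz.2) (fun z hz => hK z hz.1.ne' hz.2)
  have him : ∀ {z : ℂ}, z ∈ OmU r0 → ((starRingEnd ℂ) z).im ≠ 0 := fun hz => by simpa using hz.1.ne'
  have hno : ∀ {z : ℂ}, z ∈ OmU r0 → r0 < ‖(starRingEnd ℂ) z‖ := fun hz => by rw [Complex.norm_conj]; exact hz.2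
  obtain ⟨Cb, hCb, hB⟩ := area_half h0 (lam := mtilde L) (fun z hz => mtilde_analyticAt (aL _ (him hz) (hno hz)))
    (by
      intro z hz
      rw [mtilde_deriv]
      have : (starRingEnd ℂ) (deriv L ((starRingEnd ℂ) z)) + mtilde L z ^ 2 = (starRingEnd ℂ) (deriv L ((starRingEnd ℂ) z) + L ((starRingEnd ℂ) z) ^ 2) := by
        rw [map_add, map_pow]; rfl
      rw [this]
      exact (map_ne_zero _).2 (hK _ (him hz) (hno hz)))
  have hci : ∀ r, CircleIntegrable (fun z => Real.posLog ‖L z‖) 0 r := fun r =>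
    MeromorphicOn.circleIntegrable_posLog_norm (fun z _ => mL z)
  set T := ValueDistribution.characteristic L ⊤ with hT
  set N := ValueDistribution.logCounting L ⊤ with hNd
  set m := fun r => Real.circleAverage (fun z => Real.posLog ‖L z‖) 0 r with hm
  have hTm : ∀ r, T r = m r + N r := by
    intro r
    rw [hT, ValueDistribution.characteristic, Pi.add_apply, ValueDistribution.proximity_top]
  have hNmono : ∀ {a b : ℝ}, 0 < a → a ≤ b → N a ≤ N b := by
    intro a b ha hab
    exact ValueDistribution.logCounting_monotoneOn (by exact ha) (by exact lt_of_lt_of_le ha hab) hab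
  have hTmono : ∀ {a b : ℝ}, 0 < a → a ≤ b → T a ≤ T b := by
    intro a b ha hab
    exact ValueDistribution.characteristic_monotoneOn mL (by exact ha) (by exact lt_of_lt_of_le ha hab) hab
  -- the basic estimate
  have key : ∀ R, 8 * r0 ≤ R → T R - N (2 * R) ≤ (Ca + Cb) * (R * (2 + Real.log (R / (4 * r0)))) := by
    intro R hR
    have hRp : 0 < R := by linarith
    have hlog : 0 ≤ Real.log (R / (4 * r0)) := Real.log_nonneg (by rw [le_div_iff₀ (by positivity)]; linarith)
    set q := T R - N (2 * R) with hq
    by_cases hq0 : q ≤ 0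
    · refine hq0.trans (by positivity)
    push Not at hq0
    set Sp := {z : ℂ | z ∈ OmU r0 ∧ R < ‖z‖ ∧ ‖z‖ < 2 * R} with hSp
    have oSp : IsOpen Sp := (OmU_open r0).inter ((isOpen_lt continuous_const continuous_norm).inter (isOpen_lt continuous_norm continuous_const))
    set Sm := (fun z : ℂ => (starRingEnd ℂ) z) ⁻¹' Sp with hSm
    have oSm : IsOpen Sm := oSp.preimage Complex.continuous_conj
    have hSmem : ∀ z : ℂ, z.im ≠ 0 → R < ‖z‖ → ‖z‖ < 2 * R → z ∈ Sp ∪ Sm := by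
      intro z h1 h2 h3
      rcases lt_or_gt_of_ne h1 with h | h
      · right
        exact ⟨⟨by simpa using h, by rw [Complex.norm_conj]; linarith⟩, by rw [Complex.norm_conj]; exact ⟨h2, h3⟩⟩
      · left; exact ⟨⟨h, by linarith⟩, h2, h3⟩
    have hcont : ContinuousOn L (Sp ∪ Sm) := by
      rintro z (hz | hz)
      · exact (aL z hz.1.1.ne' hz.1.2).continuousAt.continuousWithinAt
      · have := aL ((starRingEnd ℂ) ((starRingEnd ℂ) z)) (him hz.1) (hno hz.1)
        rw [Complex.conj_conj] at this
        exact this.continuousAt.continuousWithinAt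
    have oS := oSp.union oSm
    have mG := meas_ind oS oS.measurableSet (le_refl _) hcont
    have up : ∫⁻ z, (Sp ∪ Sm).indicator (fun z => ENNReal.ofReal (Real.posLog ‖L z‖)) z ≤
        ENNReal.ofReal ((Ca + Cb) * (R ^ 3 * (2 + Real.log (R / (4 * r0))))) := by
      rw [lintegral_indicator oS.measurableSet]
      refine (lintegral_union_le _ _ _).trans ?_
      rw [add_mul, ENNReal.ofReal_add (by positivity) (by positivity)]
      refine add_le_add (hA R hR) ?_
      have hmp := (Complex.conjLIE : ℂ ≃ₗᵢ[ℝ] ℂ).measurePreserving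
      have e := hmp.setLIntegral_comp_preimage_emb (Complex.conjLIE : ℂ ≃ₗᵢ[ℝ] ℂ).toHomeomorph.measurableEmbedding
        (fun z => ENNReal.ofReal (Real.posLog ‖mtilde L z‖)) Sp
      refine le_trans (le_of_eq ?_) (hB R hR)
      rw [← e]
      show ∫⁻ z in Sm, _ = ∫⁻ z in Sm, _
      congr 1
      ext z
      simp [mtilde]
    have lo : ENNReal.ofReal (R * (R * (2 * Real.pi * q))) ≤
        ∫⁻ z, (Sp ∪ Sm).indicator (fun z => ENNReal.ofReal (Real.posLog ‖L z‖)) z := by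
      rw [polar_lint mG]
      calc ENNReal.ofReal (R * (R * (2 * Real.pi * q))) = ∫⁻ r in Set.Ioo R (2 * R), ENNReal.ofReal (R * (2 * Real.pi * q)) := by
            have hq2 : (0:ℝ) ≤ 2 * R - R := by linarith [show (0:ℝ) < R by linarith]
            rw [setLIntegral_const, Real.volume_Ioo, mul_comm (ENNReal.ofReal _), ← ENNReal.ofReal_mul hq2]
            congr 1; ring
        _ ≤ ∫⁻ r in Set.Ioo R (2 * R), ENNReal.ofReal r * ∫⁻ θ in Set.Ioo (-Real.pi) Real.pi,
              (Sp ∪ Sm).indicator (fun z => ENNReal.ofReal (Real.posLog ‖L z‖)) (circleMap 0 r θ) := by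
            apply setLIntegral_mono' measurableSet_Ioo
            intro r hr
            have hrp : 0 < r := by linarith [hr.1]
            have e : ∫⁻ θ in Set.Ioo (-Real.pi) Real.pi,
              (Sp ∪ Sm).indicator (fun z => ENNReal.ofReal (Real.posLog ‖L z‖)) (circleMap 0 r θ) =
              ∫⁻ θ in Set.Ioo (-Real.pi) Real.pi, ENNReal.ofReal (Real.posLog ‖L (circleMap 0 r θ)‖) := by
              apply lintegral_congr_ae
              rw [EventuallyEq, ae_restrict_iff' measurableSet_Ioo]
              have hn : ∀ᵐ θ : ℝ, θ ≠ 0 := by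
                simp [ae_iff]
              filter_upwards [hn] with θ h3 hθ
              apply Set.indicator_of_mem
              have hnorm : ‖circleMap 0 r θ‖ = r := by rw [norm_circleMap_zero, abs_of_pos hrp]
              exact hSmem _ (upper_circle hrp hθ.1 hθ.2 h3) (by rw [hnorm]; exact hr.1) (by rw [hnorm]; exact hr.2)
            rw [e, circle_lint (u := fun z => Real.posLog ‖L z‖) (fun z => Real.posLog_nonneg) (hci r),
              ← ENNReal.ofReal_mul hrp.le]
            apply ENNReal.ofReal_le_ofReal
            have h1 : q ≤ m r := by
              have := hTm r
              have := hTmono hRp hr.1.le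
              have := hNmono hrp hr.2.le
              linarith
            change R * (2 * Real.pi * q) ≤ r * (2 * Real.pi * m r)
            have h2 := hr.1.le
            gcongr
        _ ≤ _ := lintegral_mono_set (fun r hr => by
            have := hr.1
            show 0 < r
            linarith)
    have fin := (ENNReal.ofReal_le_ofReal_iff (by positivity)).1 (lo.trans up)
    have h3 : R ^ 2 * q ≤ R ^ 2 * ((Ca + Cb) * (R * (2 + Real.log (R / (4 * r0))))) := by
      have : R ^ 2 * q ≤ R * (R * (2 * Real.pi * q)) := by
        have : R ^ 2 * q * 1 ≤ R ^ 2 * q * (2 * Real.pi) := by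
          apply mul_le_mul_of_nonneg_left _ (by positivity)
          have := Real.pi_gt_three
          linarith
        linarith
      refine this.trans (fin.trans (le_of_eq (by ring)))
    exact le_of_mul_le_mul_left h3 (by positivity)
  refine ⟨(Ca + Cb) * (3 + |Real.log (4 * r0)|) + 4 * |C1|, ?_⟩
  have hN2 : ∀ᶠ R : ℝ in atTop, N (2 * R) ≤ C1 * ((2 * R) * Real.log (2 * R)) :=
    (tendsto_id.const_mul_atTop (by norm_num : (0:ℝ) < 2)).eventually hN
  filter_upwards [hN2, eventually_ge_atTop (8 * r0), eventually_ge_atTop (Real.exp 1), eventually_ge_atTop 2] with R h1 h2 h3 h4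
  have h5 := key R h2
  have hRp : 0 < R := by linarith
  have hl : 1 ≤ Real.log R := by
    rw [Real.le_log_iff_exp_le hRp]; exact h3
  have h6 : 0 ≤ N R := by
    exact ValueDistribution.logCounting_nonneg (by linarith)
  have h7 := hTm R
  have e1 : Real.log (R / (4 * r0)) = Real.log R - Real.log (4 * r0) := Real.log_div (by positivity) (by positivity)
  have e2 : Real.log (2 * R) = Real.log 2 + Real.log R := Real.log_mul (by norm_num) (by positivity)
  have e3 : Real.log 2 ≤ Real.log R := Real.log_le_log (by norm_num) h4
  have e4 : 0 ≤ Real.log 2 := Real.log_nonneg (by norm_num)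
  have h8 : 2 + Real.log (R / (4 * r0)) ≤ (3 + |Real.log (4 * r0)|) * Real.log R := by
    rw [e1]
    have := neg_abs_le (Real.log (4 * r0))
    nlinarith [abs_nonneg (Real.log (4 * r0))]
  have h9 : C1 * ((2 * R) * Real.log (2 * R)) ≤ 4 * |C1| * (R * Real.log R) := by
    have : (2 * R) * Real.log (2 * R) ≤ 4 * (R * Real.log R) := by
      rw [e2]; nlinarith
    have h10 : 0 ≤ (2 * R) * Real.log (2 * R) := by rw [e2]; positivity
    calc _ ≤ |C1| * ((2 * R) * Real.log (2 * R)) := by gcongr; exact le_abs_self _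
      _ ≤ |C1| * (4 * (R * Real.log R)) := by gcongr
      _ = _ := by ring
  have h11 : (Ca + Cb) * (R * (2 + Real.log (R / (4 * r0)))) ≤ (Ca + Cb) * (R * ((3 + |Real.log (4 * r0)|) * Real.log R)) := by
    gcongr
  show m R ≤ _
  calc m R ≤ T R := by linarith
    _ ≤ (Ca + Cb) * (R * ((3 + |Real.log (4 * r0)|) * Real.log R)) + 4 * |C1| * (R * Real.log R) := by linarith
    _ = _ := by ring

end


section
set_option linter.all false
open Complex Filter Topology MeasureTheory
open scoped Classical
open Metric

theorem nhdsNE_nhds {z : ℂ} {P : ℂ → Prop} (h : ∀ᶠ w in 𝓝[≠] z, P w) :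
    ∀ᶠ w in 𝓝[≠] z, ∀ᶠ u in 𝓝 w, P u := by
  have h1 := eventually_eventually_nhdsWithin.2 h
  filter_upwards [h1, h, self_mem_nhdsWithin] with w hw hp hne
  have : 𝓝[≠] z ⊓ 𝓝 w = 𝓝 w ∨ True := Or.inr trivial
  have h2 : ∀ᶠ u in 𝓝[≠] w, P u := by
    have : (𝓝[≠] w) ≤ 𝓝[({z}ᶜ : Set ℂ)] w := by
      have e : 𝓝[({z}ᶜ : Set ℂ)] w = 𝓝 w := isOpen_compl_singleton.nhdsWithin_eq hne
      rw [e]; exact nhdsWithin_le_nhds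
    exact this hw
  have e : 𝓝[({z}ᶜ : Set ℂ)] w = 𝓝 w := isOpen_compl_singleton.nhdsWithin_eq hne
  rw [e] at hw
  exact hw

theorem nhdsNE_deriv {z : ℂ} {a b : ℂ → ℂ} (h : ∀ᶠ w in 𝓝[≠] z, a w = b w) :
    ∀ᶠ w in 𝓝[≠] z, deriv a w = deriv b w := by
  filter_upwards [nhdsNE_nhds h] with w hw
  exact Filter.EventuallyEq.deriv_eq hw

theorem MeroEq.deriv {a b : ℂ → ℂ} (h : MeroEq a b) : MeroEq (deriv a) (deriv b) :=
  fun z => nhdsNE_deriv (h z)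

theorem MeroEq.symm {a b : ℂ → ℂ} (h : MeroEq a b) : MeroEq b a := fun z => by
  filter_upwards [h z] with w hw using hw.symm

theorem MeroEq.trans {a b c : ℂ → ℂ} (h : MeroEq a b) (h' : MeroEq b c) : MeroEq a c := fun z => by
  filter_upwards [h z, h' z] with w hw hw2 using hw.trans hw2

theorem conj_tendsto_NE (z : ℂ) : Tendsto (fun w : ℂ => (starRingEnd ℂ) w) (𝓝[≠] z) (𝓝[≠] ((starRingEnd ℂ) z)) := by
  apply tendsto_nhdsWithin_of_tendsto_nhds_of_eventually_within
  · exact (Complex.continuous_conj.tendsto z).mono_left nhdsWithin_le_nhds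
  · filter_upwards [self_mem_nhdsWithin] with w hw
    intro h
    exact hw ((starRingEnd ℂ).injective h)

theorem MeroEq.mtilde {a b : ℂ → ℂ} (h : MeroEq a b) : MeroEq (mtilde a) (mtilde b) := fun z => by
  filter_upwards [(conj_tendsto_NE z).eventually (h ((starRingEnd ℂ) z))] with w hw
  simp [_root_.mtilde, hw]

theorem mtilde_mtilde (a : ℂ → ℂ) : mtilde (mtilde a) = a := by
  ext z; simp [mtilde]

theorem mtilde_iter2 (f : ℂ → ℂ) : iteratedDeriv 2 (mtilde f) = mtilde (iteratedDeriv 2 f) := by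
  have e : deriv (mtilde f) = mtilde (deriv f) := funext (mtilde_deriv f)
  have e2 : deriv (mtilde (deriv f)) = mtilde (deriv (deriv f)) := funext (mtilde_deriv _)
  simp only [iteratedDeriv_succ, iteratedDeriv_zero]
  rw [e, e2]

theorem meroOrder_eq {h : ℂ → ℂ} {z : ℂ} (hh : MeromorphicAt h z) : meroOrder h z = meromorphicOrderAt h z := by
  simp [meroOrder, hh]

theorem ord_top_all {f : ℂ → ℂ} (hf : Meromorphic f) {z : ℂ} (h : meromorphicOrderAt f z = ⊤) (w : ℂ) :
    meromorphicOrderAt f w = ⊤ := by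
  by_contra hc
  have := (MeromorphicOn.exists_meromorphicOrderAt_ne_top_iff_forall (f := f) (U := Set.univ)
    (fun x _ => hf x) isConnected_univ).1 ⟨⟨w, trivial⟩, hc⟩ ⟨z, trivial⟩
  exact this h

theorem ord_f_ne_top {f : ℂ → ℂ} (hf : Meromorphic f) (hs : StrictlyNonReal f) (z : ℂ) :
    meromorphicOrderAt f z ≠ ⊤ := by
  intro h
  apply hs
  have hz : MeroEq f (fun _ => 0) := fun w => meromorphicOrderAt_eq_top_iff.1 (ord_top_all hf h w)
  refine ⟨0, ?_⟩
  intro w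
  filter_upwards [hz.mtilde w] with u hu
  rw [hu]; simp [mtilde]

theorem mero_iter2 {f : ℂ → ℂ} (hf : Meromorphic f) : Meromorphic (iteratedDeriv 2 f) := by
  intro z
  simp only [iteratedDeriv_succ, iteratedDeriv_zero]
  exact (hf z).deriv.deriv

theorem ord_f2_ne_top {f : ℂ → ℂ} (hf : Meromorphic f)
    (hzp'' : {z : ℂ | (0 < meroOrder (iteratedDeriv 2 f) z ∨
        meroOrder (iteratedDeriv 2 f) z < 0) ∧ z.im ≠ 0}.Finite) (z : ℂ) :
    meromorphicOrderAt (iteratedDeriv 2 f) z ≠ ⊤ := by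
  intro h
  have hall := ord_top_all (mero_iter2 hf) h
  have hinf : (Set.range (fun n : ℕ => ((n : ℂ) + 1) * I)).Infinite := by
    apply Set.infinite_range_of_injective
    intro a b hab
    simpa using hab
  apply hinf
  apply hzp''.subset
  rintro _ ⟨n, rfl⟩
  refine ⟨Or.inl ?_, ?_⟩
  · rw [meroOrder_eq (mero_iter2 hf _), hall]; simp
  · simp; positivity

/-- normal form of the logarithmic derivative -/
noncomputable def LL (f : ℂ → ℂ) : ℂ → ℂ := toMeromorphicNFOn (fun z => deriv f z / f z) Set.univ

theorem logd_mero {f : ℂ → ℂ} (hf : Meromorphic f) : Meromorphic (fun z => deriv f z / f z) :=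
  fun z => (hf z).deriv.div (hf z)

theorem LL_nf (f : ℂ → ℂ) (z : ℂ) : MeromorphicNFAt (LL f) z :=
  meromorphicNFOn_toMeromorphicNFOn _ _ (Set.mem_univ z)

theorem LL_mero (f : ℂ → ℂ) : Meromorphic (LL f) := fun z => (LL_nf f z).meromorphicAt

theorem LL_eq {f : ℂ → ℂ} (hf : Meromorphic f) : MeroEq (LL f) (fun z => deriv f z / f z) := by
  intro z
  have h := toMeromorphicNFOn_eqOn_codiscrete (U := Set.univ) (fun x _ => logd_mero hf x)
  have := mem_codiscreteWithin.1 h z (Set.mem_univ z)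
  rw [← Set.compl_eq_univ_diff, disjoint_principal_right, compl_compl] at this
  filter_upwards [this] with w hw
  exact hw.symm

theorem LL_form {f : ℂ → ℂ} (hf : Meromorphic f) {z : ℂ} {m : ℤ} (h : meromorphicOrderAt f z = m) :
    ∃ h : ℂ → ℂ, AnalyticAt ℂ h z ∧ ∀ᶠ w in 𝓝[≠] z, LL f w = m / (w - z) + h w := by
  obtain ⟨g, ga, g0, hg⟩ := (meromorphicOrderAt_eq_int_iff (hf z)).1 h
  refine ⟨fun w => deriv g w / g w, ga.deriv.div ga g0, ?_⟩
  have gn : ∀ᶠ w in 𝓝[≠] z, g w ≠ 0 := (ga.continuousAt.eventually_ne g0).filter_mono nhdsWithin_le_nhds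
  have gan : ∀ᶠ w in 𝓝[≠] z, AnalyticAt ℂ g w := ga.eventually_analyticAt.filter_mono nhdsWithin_le_nhds
  filter_upwards [LL_eq hf z, hg, nhdsNE_deriv hg, gn, gan, self_mem_nhdsWithin] with w h1 h2 h3 h4 h5 h6
  have hne : w - z ≠ 0 := sub_ne_zero.2 h6
  have hd : HasDerivAt (fun u => (u - z) ^ m • g u) ((m * (w - z) ^ (m - 1) * 1) * g w + (w - z) ^ m * deriv g w) w := by
    have := ((hasDerivAt_zpow m (w - z) (Or.inl hne)).comp w ((hasDerivAt_id w).sub_const z)).mul h5.differentiableAt.hasDerivAt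
    exact this
  rw [h1, h3, hd.deriv, h2, smul_eq_mul, zpow_sub_one₀ hne]
  have : (w - z) ^ m ≠ 0 := zpow_ne_zero _ hne
  field_simp

theorem LL_an {f : ℂ → ℂ} (hf : Meromorphic f) {z : ℂ} (h : meromorphicOrderAt f z = 0) : AnalyticAt ℂ (LL f) z := by
  obtain ⟨k, ka, hk⟩ := LL_form (m := 0) hf h
  rw [← (LL_nf f z).meromorphicOrderAt_nonneg_iff_analyticAt]
  rw [meromorphicOrderAt_congr (f₂ := k) (by filter_upwards [hk] with w hw; simpa using hw)]
  exact ka.meromorphicOrderAt_nonneg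

theorem LL_K {f : ℂ → ℂ} (hf : Meromorphic f) (ht : ∀ z, meromorphicOrderAt f z ≠ ⊤) :
    MeroEq (fun z => deriv (LL f) z + LL f z ^ 2) (fun z => iteratedDeriv 2 f z / f z) := by
  intro z
  have hn := (meromorphicOrderAt_ne_top_iff_eventually_ne_zero (hf z)).1 (ht z)
  filter_upwards [LL_eq hf z, (LL_eq hf).deriv z, hn, (hf z).eventually_analyticAt] with w h1 h2 h3 h4
  rw [h1, h2]
  have := (h4.deriv.differentiableAt.hasDerivAt.div h4.differentiableAt.hasDerivAt h3).deriv
  rw [show (fun z => deriv f z / f z) = deriv f / f from rfl, this]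
  simp only [iteratedDeriv_succ, iteratedDeriv_zero, Pi.div_apply]
  field_simp
  ring

theorem mtilde_K (L : ℂ → ℂ) : mtilde (fun z => deriv L z + L z ^ 2) = fun z => deriv (mtilde L) z + mtilde L z ^ 2 := by
  ext z
  rw [mtilde_deriv]
  simp [mtilde]

theorem LL_ric {f H : ℂ → ℂ} (hf : Meromorphic f) (ht : ∀ z, meromorphicOrderAt f z ≠ ⊤)
    (hHeq : MeroEq (fun z => iteratedDeriv 2 f z / f z)
      (fun z => H z * (iteratedDeriv 2 (mtilde f) z / mtilde f z))) :
    MeroEq (fun z => deriv (LL f) z + LL f z ^ 2)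
      (fun z => H z * (deriv (mtilde (LL f)) z + mtilde (LL f) z ^ 2)) := by
  intro z
  have h2 := (LL_K hf ht).mtilde
  rw [mtilde_K] at h2
  filter_upwards [LL_K hf ht z, hHeq z, h2 z] with w h1 h2 h3
  rw [h1, h2, h3, mtilde_iter2]
  simp [mtilde]

theorem H_unit {f H : ℂ → ℂ} (hf : Meromorphic f) (ht : ∀ z, meromorphicOrderAt f z ≠ ⊤)
    (ht2 : ∀ z, meromorphicOrderAt (iteratedDeriv 2 f) z ≠ ⊤)
    (hHeq : MeroEq (fun z => iteratedDeriv 2 f z / f z)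
      (fun z => H z * (iteratedDeriv 2 (mtilde f) z / mtilde f z))) :
    MeroEq (fun z => H z * mtilde H z) (fun _ => 1) := by
  intro z
  have hn := (meromorphicOrderAt_ne_top_iff_eventually_ne_zero (hf z)).1 (ht z)
  have hn2 := (meromorphicOrderAt_ne_top_iff_eventually_ne_zero (mero_iter2 hf z)).1 (ht2 z)
  filter_upwards [hHeq z, hHeq.mtilde z, hn, hn2] with w h1 h2 h3 h4
  rw [mtilde_iter2] at h1 h2
  have e1 : mtilde (fun z => iteratedDeriv 2 f z / f z) w = mtilde (iteratedDeriv 2 f) w / mtilde f w := by simp [mtilde]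
  have e2 : mtilde (fun z => H z * (mtilde (iteratedDeriv 2 f) z / mtilde f z)) w = mtilde H w * (iteratedDeriv 2 f w / f w) := by
    simp [mtilde]
  rw [e1, e2] at h2
  rw [h2] at h1
  have : iteratedDeriv 2 f w / f w ≠ 0 := div_ne_zero h4 h3
  have h5 : iteratedDeriv 2 f w / f w * (H w * mtilde H w) = iteratedDeriv 2 f w / f w * 1 := by
    rw [mul_one]; nth_rewrite 2 [h1]; ring
  exact mul_left_cancel₀ this h5

end


section
set_option linter.all false
open Complex Filter Topology MeasureTheory
open scoped Classical
open Metric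

theorem ric_id {L M H G : ℂ → ℂ} {x : ℂ} (mL : MeromorphicAt L x) (mM : MeromorphicAt M x)
    (hric : ∀ᶠ w in 𝓝[≠] x, deriv L w + L w ^ 2 = H w * (deriv M w + M w ^ 2))
    (aG : AnalyticAt ℂ G x) (hG : ∀ᶠ w in 𝓝[≠] x, G w * (1 - H w) = H w) :
    ∀ᶠ w in 𝓝[≠] x, deriv (fun z => L z + G z * (L z - M z)) w + (L w + G w * (L w - M w)) ^ 2 =
      deriv G w * (L w - M w) + (G w + G w ^ 2) * (L w - M w) ^ 2 := by
  filter_upwards [mL.eventually_analyticAt, mM.eventually_analyticAt, hric, hG,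
    aG.eventually_analyticAt.filter_mono nhdsWithin_le_nhds] with w h1 h2 h3 h4 h5
  have l := h1.differentiableAt.hasDerivAt
  have m := h2.differentiableAt.hasDerivAt
  have g := h5.differentiableAt.hasDerivAt
  have hd := (l.add (g.mul (l.sub m))).deriv
  have hd' : deriv (fun z => L z + G z * (L z - M z)) w =
    deriv L w + (deriv G w * (L w - M w) + G w * (deriv L w - deriv M w)) := hd
  rw [hd']
  have e1 : deriv L w = H w * (deriv M w + M w ^ 2) - L w ^ 2 := by rw [← h3]; ring
  rw [e1]
  linear_combination (-(deriv M w + M w ^ 2)) * h4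

theorem ric_A {L H G : ℂ → ℂ} {x s : ℝ} (aL : AnalyticAt ℂ L x)
    (hric : ∀ᶠ w in 𝓝[≠] (x : ℂ), deriv L w + L w ^ 2 = H w * (deriv (mtilde L) w + mtilde L w ^ 2))
    (aG : AnalyticAt ℂ G x) (hG : ∀ᶠ w in 𝓝[≠] (x : ℂ), G w * (1 - H w) = H w)
    (hre : ∀ᶠ y : ℝ in 𝓝 x, (G y).re = -1 / 2) (hs : ‖deriv G x‖ ≤ s * ‖G x‖) :
    ∃ u' : ℝ, HasDerivAt (fun y : ℝ => (L y + G y * (L y - mtilde L y)).re) u' x ∧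
      -s ^ 2 ≤ u' + ((fun y : ℝ => (L y + G y * (L y - mtilde L y)).re) x) ^ 2 := by
  have aM : AnalyticAt ℂ (mtilde L) x := mtilde_analyticAt (by simpa using aL)
  have hid := ric_id aL.meromorphicAt aM.meromorphicAt hric aG hG
  set v : ℂ → ℂ := fun z => L z + G z * (L z - mtilde L z) with hv
  have av : AnalyticAt ℂ v x := aL.add (aG.mul (aL.sub aM))
  have hidx : deriv v x + v x ^ 2 = deriv G x * (L x - mtilde L x) + (G x + G x ^ 2) * (L x - mtilde L x) ^ 2 := by
    have c1 : ContinuousAt (fun w => deriv v w + v w ^ 2) (x : ℂ) := (av.deriv.add (av.pow 2)).continuousAt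
    have c2 : ContinuousAt (fun w => deriv G w * (L w - mtilde L w) + (G w + G w ^ 2) * (L w - mtilde L w) ^ 2) (x : ℂ) :=
      ((aG.deriv.mul (aL.sub aM)).add ((aG.add (aG.pow 2)).mul ((aL.sub aM).pow 2))).continuousAt
    have := (ContinuousAt.eventuallyEq_nhds_iff_eventuallyEq_nhdsNE c1 c2).1 hid
    exact this.eq_of_nhds
  have hder : HasDerivAt (fun y : ℝ => (v y).re) (deriv v x).re x :=
    av.differentiableAt.hasDerivAt.real_of_complex
  refine ⟨(deriv v x).re, hder, ?_⟩
  show _ ≤ (deriv v x).re + (v x).re ^ 2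
  have hG0 : (deriv G x).re = 0 := by
    have h1 : HasDerivAt (fun y : ℝ => (G y).re) (deriv G x).re x := aG.differentiableAt.hasDerivAt.real_of_complex
    have h2 : HasDerivAt (fun y : ℝ => (G y).re) 0 x := by
      apply (hasDerivAt_const x (-1 / 2 : ℝ)).congr_of_eventuallyEq
      exact hre
    exact h1.unique h2
  have hGr : (G x).re = -1 / 2 := hre.self_of_nhds
  have hM : mtilde L x = (starRingEnd ℂ) (L x) := by simp [mtilde]
  have hD : L x - mtilde L x = ⟨0, 2 * (L x).im⟩ := by
    rw [hM]; apply Complex.ext <;> simp; ring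
  have hvim : (v x).im = 0 := by
    simp only [hv]; rw [hD]; simp; rw [hGr]; ring
  have hvsq : (v x ^ 2).re = (v x).re ^ 2 := by
    rw [sq, Complex.mul_re, hvim]; ring
  have hre2 := congrArg Complex.re hidx
  rw [Complex.add_re, hvsq, hD] at hre2
  rw [hre2]
  have hsq : (deriv G x).im ^ 2 ≤ s ^ 2 * (1 / 4 + (G x).im ^ 2) := by
    have h1 : ‖deriv G x‖ ^ 2 = (deriv G x).im ^ 2 := by
      rw [← Complex.normSq_eq_norm_sq, Complex.normSq_apply, hG0]; ring
    have h2 : ‖G x‖ ^ 2 = 1 / 4 + (G x).im ^ 2 := by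
      rw [← Complex.normSq_eq_norm_sq, Complex.normSq_apply, hGr]; ring
    rw [← h1, ← h2, ← mul_pow]
    gcongr
  have hcalc : (deriv G x * (⟨0, 2 * (L x).im⟩ : ℂ) + (G x + G x ^ 2) * (⟨0, 2 * (L x).im⟩ : ℂ) ^ 2).re =
      (1 + 4 * (G x).im ^ 2) * (L x).im ^ 2 - 2 * (deriv G x).im * (L x).im := by
    simp [sq, hGr]
    ring
  rw [hcalc]
  set γ := (G x).im
  set q := (L x).im
  set d := (deriv G x).im
  have hA : 0 < 1 + 4 * γ ^ 2 := by positivity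
  have : 0 ≤ (1 + 4 * γ ^ 2) * ((1 + 4 * γ ^ 2) * q ^ 2 - 2 * d * q + s ^ 2) := by
    have : (1 + 4 * γ ^ 2) * ((1 + 4 * γ ^ 2) * q ^ 2 - 2 * d * q + s ^ 2) = ((1 + 4 * γ ^ 2) * q - d) ^ 2 - d ^ 2 + s ^ 2 * (1 + 4 * γ ^ 2) := by ring
    rw [this]
    nlinarith [sq_nonneg ((1 + 4 * γ ^ 2) * q - d), sq_nonneg s, mul_nonneg (sq_nonneg s) (sq_nonneg γ)]
  have := nonneg_of_mul_nonneg_right this hA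
  linarith

theorem real_NE_tendsto (x : ℝ) : Tendsto (fun y : ℝ => (y : ℂ)) (𝓝[≠] x) (𝓝[≠] (x : ℂ)) := by
  apply tendsto_nhdsWithin_of_tendsto_nhds_of_eventually_within
  · exact (Complex.continuous_ofReal.tendsto x).mono_left nhdsWithin_le_nhds
  · filter_upwards [self_mem_nhdsWithin] with w hw
    intro h
    exact hw (Complex.ofReal_injective h)

theorem ric_B {L H G h : ℂ → ℂ} {x : ℝ} {m : ℤ} (mL : MeromorphicAt L x) (mM : MeromorphicAt (mtilde L) x)
    (ah : AnalyticAt ℂ h x) (hform : ∀ᶠ w in 𝓝[≠] (x : ℂ), L w = m / (w - x) + h w)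
    (hric : ∀ᶠ w in 𝓝[≠] (x : ℂ), deriv L w + L w ^ 2 = H w * (deriv (mtilde L) w + mtilde L w ^ 2))
    (aG : AnalyticAt ℂ G x) (hG : ∀ᶠ w in 𝓝[≠] (x : ℂ), G w * (1 - H w) = H w) :
    (m = 0 ∨ m = 1) ∧ (m = 1 → 
      Tendsto (fun y : ℝ => (L y + G y * (L y - mtilde L y)).re) (𝓝[>] x) atTop ∧
      Tendsto (fun y : ℝ => (L y + G y * (L y - mtilde L y)).re) (𝓝[<] x) atBot) := by
  have hid := ric_id mL mM hric aG hG
  have at' : AnalyticAt ℂ (mtilde h) x := mtilde_analyticAt (by simpa using ah)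
  set d : ℂ → ℂ := fun w => h w - mtilde h w with hd
  have ad : AnalyticAt ℂ d x := ah.sub at'
  set k : ℂ → ℂ := fun w => h w + G w * d w with hk
  have ak : AnalyticAt ℂ k x := ah.add (aG.mul ad)
  have hMform : ∀ᶠ w in 𝓝[≠] (x : ℂ), mtilde L w = m / (w - x) + mtilde h w := by
    have := (conj_tendsto_NE (x : ℂ)).eventually (p := fun w => L w = m / (w - x) + h w) (by simpa using hform)
    filter_upwards [this] with w hw
    simp [mtilde, hw]
  have hvform : ∀ᶠ w in 𝓝[≠] (x : ℂ), L w + G w * (L w - mtilde L w) = m / (w - x) + k w := by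
    filter_upwards [hform, hMform] with w h1 h2
    rw [h1, h2, hk, hd]; ring
  set V : ℂ → ℂ := fun w => deriv G w * d w + (G w + G w ^ 2) * d w ^ 2 with hV
  have aV : AnalyticAt ℂ V x := (aG.deriv.mul ad).add ((aG.add (aG.pow 2)).mul (ad.pow 2))
  have heq : ∀ᶠ w in 𝓝[≠] (x : ℂ), (m : ℂ) ^ 2 - m = (w - x) ^ 2 * (V w - deriv k w - k w ^ 2) - 2 * m * k w * (w - x) := by
    filter_upwards [hid, hform, hMform, hvform, nhdsNE_deriv hvform, self_mem_nhdsWithin,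
      ak.eventually_analyticAt.filter_mono nhdsWithin_le_nhds] with w h1 h2 h3 h4 h5 h6 h7
    have hne : w - x ≠ 0 := sub_ne_zero.2 h6
    have hdv : HasDerivAt (fun w : ℂ => (m : ℂ) / (w - x) + k w) (-(m : ℂ) / (w - x) ^ 2 + deriv k w) w := by
      have h8 := ((hasDerivAt_const w (m : ℂ)).div ((hasDerivAt_id w).sub_const (x : ℂ)) hne).add h7.differentiableAt.hasDerivAt
      have e8 : (0 * (id w - (x : ℂ)) - (m : ℂ) * 1) / (id w - (x : ℂ)) ^ 2 + deriv k w = -(m : ℂ) / (w - x) ^ 2 + deriv k w := by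
        simp only [id, zero_mul, mul_one, zero_sub]
      rw [e8] at h8
      exact h8
    have e : L w - mtilde L w = d w := by rw [h2, h3, hd]; ring
    rw [h5, hdv.deriv, h4, e] at h1
    have h9 : V w = -(m : ℂ) / (w - x) ^ 2 + deriv k w + (m / (w - x) + k w) ^ 2 := by
      simp only [hV]; exact h1.symm
    rw [h9]
    field_simp
    ring
  have hlim : Tendsto (fun w : ℂ => (w - x) ^ 2 * (V w - deriv k w - k w ^ 2) - 2 * m * k w * (w - x)) (𝓝[≠] (x : ℂ)) (𝓝 0) := by
    have c : AnalyticAt ℂ (fun w : ℂ => (w - x) ^ 2 * (V w - deriv k w - k w ^ 2) - 2 * m * k w * (w - x)) x := by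
      have a1 : AnalyticAt ℂ (fun w : ℂ => w - x) x := analyticAt_id.sub analyticAt_const
      exact ((a1.pow 2).mul ((aV.sub ak.deriv).sub (ak.pow 2))).sub ((analyticAt_const.mul ak).mul a1)
    have := c.continuousAt.tendsto
    simp only [sub_self] at this
    refine (this.mono_left nhdsWithin_le_nhds).trans (le_of_eq ?_)
    congr 1; ring
  have hm : (m : ℂ) ^ 2 - m = 0 := by
    refine tendsto_nhds_unique (f := fun w : ℂ => (w - x) ^ 2 * (V w - deriv k w - k w ^ 2) - 2 * m * k w * (w - x)) (l := 𝓝[≠] (x : ℂ)) ?_ hlim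
    apply tendsto_const_nhds.congr'
    exact heq
  refine ⟨?_, ?_⟩
  · have : (m : ℂ) * (m - 1) = 0 := by linear_combination hm
    rcases mul_eq_zero.1 this with h | h
    · left; exact_mod_cast h
    · right; have : (m : ℂ) = 1 := by linear_combination h
      exact_mod_cast this
  · rintro rfl
    have hr : ∀ᶠ y : ℝ in 𝓝[≠] x, (L y + G y * (L y - mtilde L y)).re = (y - x)⁻¹ + (k y).re := by
      filter_upwards [(real_NE_tendsto x).eventually hvform] with y hy
      rw [hy, Complex.add_re]
      congr 1
      rw [← Complex.ofReal_sub, Int.cast_one, one_div, ← Complex.ofReal_inv, Complex.ofReal_re]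
    have kc : Tendsto (fun y : ℝ => (k y).re) (𝓝 x) (𝓝 (k x).re) := by
      have : ContinuousAt (fun y : ℝ => k y) x := ContinuousAt.comp (f := fun y : ℝ => (y : ℂ)) (g := k) ak.continuousAt Complex.continuous_ofReal.continuousAt
      exact (Complex.continuous_re.continuousAt.comp this)
    constructor
    · have t1 : Tendsto (fun y : ℝ => y - x) (𝓝[>] x) (𝓝[>] 0) := by
        apply tendsto_nhdsWithin_of_tendsto_nhds_of_eventually_within
        · have : Tendsto (fun y : ℝ => y - x) (𝓝 x) (𝓝 (x - x)) := (continuous_id.sub continuous_const).tendsto x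
          rw [sub_self] at this
          exact this.mono_left nhdsWithin_le_nhds
        · filter_upwards [self_mem_nhdsWithin] with y hy
          exact sub_pos.2 (Set.mem_Ioi.1 hy)
      have t2 := (tendsto_inv_nhdsGT_zero.comp t1).atTop_add (kc.mono_left nhdsWithin_le_nhds)
      refine t2.congr' ?_
      filter_upwards [hr.filter_mono (nhdsWithin_mono x (fun y hy => ne_of_gt hy))] with y hy
      rw [hy]; rfl
    · have t1 : Tendsto (fun y : ℝ => y - x) (𝓝[<] x) (𝓝[<] 0) := by
        apply tendsto_nhdsWithin_of_tendsto_nhds_of_eventually_within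
        · have : Tendsto (fun y : ℝ => y - x) (𝓝 x) (𝓝 (x - x)) := (continuous_id.sub continuous_const).tendsto x
          rw [sub_self] at this
          exact this.mono_left nhdsWithin_le_nhds
        · filter_upwards [self_mem_nhdsWithin] with y hy
          exact sub_neg.2 (Set.mem_Iio.1 hy)
      have t2 := (tendsto_inv_nhdsLT_zero.comp t1).atBot_add (kc.mono_left nhdsWithin_le_nhds)
      refine t2.congr' ?_
      filter_upwards [hr.filter_mono (nhdsWithin_mono x (fun y hy => ne_of_lt hy))] with y hy
      rw [hy]; rfl

theorem gap_lemma {u : ℝ → ℝ} {a b s : ℝ} (hab : a < b) (hs : 0 < s)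
    (hd : ∀ x ∈ Set.Ioo a b, ∃ u' : ℝ, HasDerivAt u u' x ∧ -s ^ 2 ≤ u' + u x ^ 2)
    (ha : Tendsto u (𝓝[>] a) atTop) (hb : Tendsto u (𝓝[<] b) atBot) : Real.pi ≤ s * (b - a) := by
  set φ : ℝ → ℝ := fun x => Real.arctan (u x / s) + s * x with hφ
  have hder : ∀ x ∈ Set.Ioo a b, ∃ d, 0 ≤ d ∧ HasDerivAt φ d x := by
    intro x hx
    obtain ⟨u', h1, h2⟩ := hd x hx
    refine ⟨_, ?_, ((h1.div_const s).arctan).add ((hasDerivAt_id x).const_mul s)⟩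
    have : 1 / (1 + (u x / s) ^ 2) * (u' / s) + s * 1 = s * (u' + u x ^ 2 + s ^ 2) / (s ^ 2 + u x ^ 2) := by
      field_simp; ring
    rw [this]
    have : 0 ≤ u' + u x ^ 2 + s ^ 2 := by linarith
    positivity
  have hmono : MonotoneOn φ (Set.Ioo a b) := by
    apply monotoneOn_of_deriv_nonneg (convex_Ioo a b)
    · intro x hx
      obtain ⟨d, _, h⟩ := hder x hx
      exact h.continuousAt.continuousWithinAt
    · rw [interior_Ioo]; intro x hx
      obtain ⟨d, _, h⟩ := hder x hx
      exact h.differentiableAt.differentiableWithinAt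
    · rw [interior_Ioo]; intro x hx
      obtain ⟨d, h0, h⟩ := hder x hx
      rw [h.deriv]; exact h0
  have ta : Tendsto φ (𝓝[>] a) (𝓝 (Real.pi / 2 + s * a)) := by
    apply Tendsto.add
    · exact (Real.tendsto_arctan_atTop.mono_right nhdsWithin_le_nhds).comp (ha.atTop_div_const hs)
    · exact ((continuous_const.mul continuous_id).tendsto a).mono_left nhdsWithin_le_nhds
  have tb : Tendsto φ (𝓝[<] b) (𝓝 (-(Real.pi / 2) + s * b)) := by
    apply Tendsto.add
    · exact (Real.tendsto_arctan_atBot.mono_right nhdsWithin_le_nhds).comp (hb.atBot_div_const hs)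
    · exact ((continuous_const.mul continuous_id).tendsto b).mono_left nhdsWithin_le_nhds
  have key : ∀ x ∈ Set.Ioo a b, Real.pi / 2 + s * a ≤ φ x := by
    intro x hx
    apply le_of_tendsto ta
    filter_upwards [Ioo_mem_nhdsGT hx.1] with y hy
    exact hmono ⟨hy.1, hy.2.trans hx.2⟩ hx hy.2.le
  have : Real.pi / 2 + s * a ≤ -(Real.pi / 2) + s * b := by
    apply ge_of_tendsto tb
    filter_upwards [Ioo_mem_nhdsLT hab] with y hy
    exact key y hy
  linarith

end


section
set_option linter.all false
open Complex Filter Topology MeasureTheory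
open scoped Classical
open Metric

theorem S_finite {f : ℂ → ℂ} (hf : Meromorphic f) (ht : ∀ z, meromorphicOrderAt f z ≠ ⊤) (t : ℝ) :
    ({z | meromorphicOrderAt f z ≠ 0} ∩ closedBall (0:ℂ) t).Finite := by
  have hm : MeromorphicOn f (closedBall (0:ℂ) t) := fun x _ => hf x
  have := (MeromorphicOn.divisor f (closedBall (0:ℂ) t)).finiteSupport (isCompact_closedBall 0 t)
  apply this.subset
  rintro z ⟨h1, h2⟩
  rw [Function.mem_support, MeromorphicOn.divisor_apply hm h2]
  simp only [ne_eq, WithTop.untop₀_eq_zero]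
  push Not
  exact ⟨h1, ht z⟩

theorem sep_interval {f H G : ℂ → ℂ} (hf : Meromorphic f) (ht : ∀ z, meromorphicOrderAt f z ≠ ⊤)
    (hric : MeroEq (fun z => deriv (LL f) z + LL f z ^ 2)
      (fun z => H z * (deriv (mtilde (LL f)) z + mtilde (LL f) z ^ 2)))
    {I : Set ℝ} (hI : I.OrdConnected) (aG : ∀ x ∈ I, AnalyticAt ℂ G (x : ℂ))
    (hG : ∀ x ∈ I, ∀ᶠ w in 𝓝[≠] (x : ℂ), G w * (1 - H w) = H w)
    (hre : ∀ x ∈ I, ∀ᶠ y : ℝ in 𝓝 x, (G y).re = -1 / 2) {s : ℝ} (hs0 : 0 < s)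
    (hs : ∀ x ∈ I, ‖deriv G x‖ ≤ s * ‖G x‖) :
    (∀ x ∈ I, meromorphicOrderAt f (x : ℂ) = 0 ∨ meromorphicOrderAt f (x : ℂ) = 1) ∧
    (∀ a ∈ I, ∀ b ∈ I, a < b → meromorphicOrderAt f (a : ℂ) ≠ 0 → meromorphicOrderAt f (b : ℂ) ≠ 0 →
      Real.pi ≤ s * (b - a)) := by
  have mM : Meromorphic (mtilde (LL f)) := by
    intro z
    obtain ⟨n, hn⟩ := LL_mero f ((starRingEnd ℂ) z)
    refine ⟨n, ?_⟩
    have := mtilde_analyticAt hn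
    refine this.congr (Eventually.of_forall fun w => ?_)
    simp [mtilde]
  have hB : ∀ x ∈ I, (meromorphicOrderAt f (x : ℂ) = 0 ∨ meromorphicOrderAt f (x : ℂ) = 1) ∧
    (meromorphicOrderAt f (x : ℂ) = 1 → 
      Tendsto (fun y : ℝ => (LL f y + G y * (LL f y - mtilde (LL f) y)).re) (𝓝[>] x) atTop ∧
      Tendsto (fun y : ℝ => (LL f y + G y * (LL f y - mtilde (LL f) y)).re) (𝓝[<] x) atBot) := by
    intro x hx
    obtain ⟨m, hm⟩ := WithTop.ne_top_iff_exists.1 (ht x)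
    obtain ⟨h, ah, hform⟩ := LL_form hf hm.symm
    have := ric_B (LL_mero f x) (mM x) ah hform (hric x) (aG x hx) (hG x hx)
    rw [← hm]
    refine ⟨?_, ?_⟩
    · rcases this.1 with h | h
      · left; rw [h]; rfl
      · right; rw [h]; rfl
    · intro h1
      apply this.2
      exact_mod_cast h1
  refine ⟨fun x hx => (hB x hx).1, ?_⟩
  intro a ha b hb hab oa ob
  have oa1 : meromorphicOrderAt f (a : ℂ) = 1 := (hB a ha).1.resolve_left oa
  set Z : Set ℝ := {y | a < y ∧ y ≤ b ∧ meromorphicOrderAt f (y : ℂ) ≠ 0} with hZ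
  have Zf : Z.Finite := by
    have := S_finite hf ht (|a| + |b|)
    refine Set.Finite.of_finite_image (f := fun y : ℝ => (y : ℂ)) (this.subset ?_) Complex.ofReal_injective.injOn
    rintro _ ⟨y, ⟨h1, h2, h3⟩, rfl⟩
    refine ⟨h3, ?_⟩
    rw [mem_closedBall_zero_iff, Complex.norm_real, Real.norm_eq_abs]
    rcases abs_cases y with ⟨h, _⟩ | ⟨h, _⟩ <;> rcases abs_cases a with ⟨h', _⟩ | ⟨h', _⟩ <;> rcases abs_cases b with ⟨h'', _⟩ | ⟨h'', _⟩ <;> linarith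
  obtain ⟨c, hc, hmin⟩ := Set.exists_min_image Z id Zf ⟨b, hab, le_rfl, ob⟩
  have hcI : c ∈ I := hI.out ha hb ⟨hc.1.le, hc.2.1⟩
  have oc1 : meromorphicOrderAt f (c : ℂ) = 1 := (hB c hcI).1.resolve_left hc.2.2
  have := gap_lemma hc.1 hs0 ?_ ((hB a ha).2 oa1).1 ((hB c hcI).2 oc1).2
  · have h2 := hc.2.1
    nlinarith
  · intro x hx
    have hxI : x ∈ I := hI.out ha hcI ⟨hx.1.le, hx.2.le⟩
    have ox : meromorphicOrderAt f (x : ℂ) = 0 := by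
      by_contra h
      have := hmin x ⟨hx.1, hx.2.le.trans hc.2.1, h⟩
      simp only [id] at this
      linarith [hx.2]
    exact ric_A (LL_an hf ox) (hric x) (aG x hxI) (hG x hxI) (hre x hxI) (hs x hxI)

theorem sep_count {Z : Set ℝ} {δ : ℝ} (hδ : 0 < δ) (hsep : ∀ a ∈ Z, ∀ b ∈ Z, a < b → δ ≤ b - a) {t : ℝ} (ht : 0 ≤ t) :
    (Z ∩ Set.Icc 0 t).Finite ∧ ((Z ∩ Set.Icc 0 t).ncard : ℝ) ≤ t / δ + 1 := by
  have hinj : Set.InjOn (fun x : ℝ => ⌊x / δ⌋₊) (Z ∩ Set.Icc 0 t) := by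
    have key : ∀ a ∈ Z ∩ Set.Icc 0 t, ∀ b ∈ Z ∩ Set.Icc 0 t, a < b → ⌊a / δ⌋₊ ≠ ⌊b / δ⌋₊ := by
      intro a ha b hb hab h
      have h1 := hsep a ha.1 b hb.1 hab
      have h2 := Nat.lt_floor_add_one (b / δ)
      have h3 := Nat.floor_le (div_nonneg ha.2.1 hδ.le)
      rw [h] at h3
      have h4 : b / δ - a / δ < 1 := by linarith
      rw [← sub_div, div_lt_one hδ] at h4
      linarith
    intro a ha b hb h
    rcases lt_trichotomy a b with h1 | h1 | h1
    · exact absurd h (key a ha b hb h1)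
    · exact h1
    · exact absurd h.symm (key b hb a ha h1)
  have himg : (fun x : ℝ => ⌊x / δ⌋₊) '' (Z ∩ Set.Icc 0 t) ⊆ (Finset.range (⌊t / δ⌋₊ + 1) : Set ℕ) := by
    rintro _ ⟨x, hx, rfl⟩
    simp only [Finset.coe_range, Set.mem_Iio]
    have : ⌊x / δ⌋₊ ≤ ⌊t / δ⌋₊ := Nat.floor_le_floor (by gcongr; exact hx.2.2)
    omega
  have hfin : (Z ∩ Set.Icc 0 t).Finite := Set.Finite.of_finite_image ((Finset.finite_toSet _).subset himg) hinj
  refine ⟨hfin, ?_⟩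
  have h1 : (Z ∩ Set.Icc 0 t).ncard ≤ ⌊t / δ⌋₊ + 1 := by
    rw [← Set.ncard_image_of_injOn hinj]
    refine (Set.ncard_le_ncard himg (Finset.finite_toSet _)).trans ?_
    rw [Set.ncard_coe_finset, Finset.card_range]
  have h2 : (⌊t / δ⌋₊ : ℝ) ≤ t / δ := Nat.floor_le (by positivity)
  have : ((Z ∩ Set.Icc 0 t).ncard : ℝ) ≤ (⌊t / δ⌋₊ : ℝ) + 1 := by exact_mod_cast h1
  linarith

end


section
set_option linter.all false
open Complex Filter Topology MeasureTheory
open scoped Classical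
open Metric

theorem poly_ev_ne {q : Polynomial ℂ} (hq : q ≠ 0) (z : ℂ) : ∀ᶠ w in 𝓝[≠] z, q.eval w ≠ 0 := by
  have := (Polynomial.eventually_cofinite_not_isRoot hq)
  have h2 : 𝓝[≠] z ≤ cofinite := nhdsNE_le_cofinite z
  filter_upwards [h2 this] with w hw using hw

theorem rat_an (p q : Polynomial ℂ) {z : ℂ} (h : q.eval z ≠ 0) : AnalyticAt ℂ (fun z => p.eval z / q.eval z) z :=
  ((AnalyticOnNhd.eval_polynomial p z trivial)).div (AnalyticOnNhd.eval_polynomial q z trivial) h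

theorem rat_G {p q : Polynomial ℂ} {z : ℂ} (h1 : q.eval z ≠ 0) (h2 : (q - p).eval z ≠ 0) :
    p.eval z / (q - p).eval z * (1 - p.eval z / q.eval z) = p.eval z / q.eval z := by
  have h3 : q.eval z - p.eval z ≠ 0 := by simpa using h2
  rw [Polynomial.eval_sub]
  field_simp

theorem rat_re {p q : Polynomial ℂ} 
    (hu : MeroEq (fun z => p.eval z / q.eval z * mtilde (fun z => p.eval z / q.eval z) z) (fun _ => 1))
    {y : ℝ} (h1 : q.eval (y : ℂ) ≠ 0) (h2 : (q - p).eval (y : ℂ) ≠ 0) :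
    ‖p.eval (y : ℂ) / q.eval (y : ℂ)‖ = 1 ∧ (p.eval (y : ℂ) / (q - p).eval (y : ℂ)).re = -1 / 2 := by
  have a1 := rat_an p q h1
  have a2 : AnalyticAt ℂ (mtilde (fun z => p.eval z / q.eval z)) y := mtilde_analyticAt (by simpa using a1)
  have := (ContinuousAt.eventuallyEq_nhds_iff_eventuallyEq_nhdsNE (a1.mul a2).continuousAt (continuousAt_const (y := (1:ℂ)))).1 (hu y)
  have h3 := this.eq_of_nhds
  simp only [Pi.mul_apply] at h3
  have h4 : mtilde (fun z => p.eval z / q.eval z) (y : ℂ) = (starRingEnd ℂ) (p.eval (y : ℂ) / q.eval (y : ℂ)) := by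
    simp [mtilde]
  rw [h4, Complex.mul_conj] at h3
  have h5 : Complex.normSq (p.eval (y : ℂ) / q.eval (y : ℂ)) = 1 := by exact_mod_cast h3
  have h6 := rat_G h1 h2
  set h := p.eval (y : ℂ) / q.eval (y : ℂ) with hh
  set G := p.eval (y : ℂ) / (q - p).eval (y : ℂ) with hG
  refine ⟨?_, ?_⟩
  · rw [Complex.normSq_eq_norm_sq] at h5
    exact (pow_eq_one_iff_of_nonneg (norm_nonneg _) two_ne_zero).1 h5
  have hne : 1 - h ≠ 0 := by
    intro h0
    have : h = 0 := by rw [← h6, h0, mul_zero]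
    rw [this] at h0; simp at h0
  have e : G = h / (1 - h) := by rw [eq_div_iff hne, h6]
  rw [e, Complex.div_re]
  have hne' : Complex.normSq (1 - h) ≠ 0 := by simpa using hne
  rw [← add_div, div_eq_iff hne']
  rw [Complex.normSq_apply] at h5 ⊢
  simp
  linarith

theorem poly_ld (p : Polynomial ℂ) : ∃ C, 0 ≤ C ∧ ∀ᶠ z in Bornology.cobounded ℂ, ‖p.derivative.eval z‖ ≤ C * ‖p.eval z‖ := by
  have h : p.derivative.degree ≤ p.degree := Polynomial.degree_derivative_le
  obtain ⟨C, hC, h⟩ := (Polynomial.isBigO_cobounded_of_degree_le h).exists_nonneg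
  exact ⟨C, hC, h.bound⟩

theorem rat_data {p q : Polynomial ℂ} (hq : q ≠ 0) (hQ : q - p ≠ 0) : ∃ R0 s : ℝ, 0 < R0 ∧ 0 < s ∧ ∀ z : ℂ, R0 < ‖z‖ →
    q.eval z ≠ 0 ∧ (q - p).eval z ≠ 0 ∧
    ‖deriv (fun z => p.eval z / (q - p).eval z) z‖ ≤ s * ‖p.eval z / (q - p).eval z‖ := by
  obtain ⟨C, hC, h⟩ := poly_ld p
  obtain ⟨C', hC', h'⟩ := poly_ld (q - p)
  have e1 := Bornology.le_cofinite ℂ (Polynomial.eventually_cofinite_not_isRoot hq)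
  have e2 := Bornology.le_cofinite ℂ (Polynomial.eventually_cofinite_not_isRoot hQ)
  have ev : ∀ᶠ z in Bornology.cobounded ℂ, q.eval z ≠ 0 ∧ (q - p).eval z ≠ 0 ∧
    ‖deriv (fun z => p.eval z / (q - p).eval z) z‖ ≤ (C + C' + 1) * ‖p.eval z / (q - p).eval z‖ := by
    filter_upwards [h, h', e1, e2] with z h1 h2 h3 h4
    refine ⟨h3, h4, ?_⟩
    have hd := (((p.hasDerivAt z).div ((q - p).hasDerivAt z) h4)).deriv
    have hd' : deriv (fun z => p.eval z / (q - p).eval z) z = (p.derivative.eval z * (q - p).eval z - p.eval z * (q - p).derivative.eval z) / ((q - p).eval z) ^ 2 := hd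
    rw [hd', norm_div, norm_div, norm_pow]
    have h4' : 0 < ‖(q - p).eval z‖ := norm_pos_iff.2 h4
    have n1 : ‖p.derivative.eval z * (q - p).eval z - p.eval z * (q - p).derivative.eval z‖ ≤
      (C + C' + 1) * (‖p.eval z‖ * ‖(q - p).eval z‖) := by
      calc _ ≤ ‖p.derivative.eval z * (q - p).eval z‖ + ‖p.eval z * (q - p).derivative.eval z‖ := norm_sub_le _ _
        _ = ‖p.derivative.eval z‖ * ‖(q - p).eval z‖ + ‖p.eval z‖ * ‖(q - p).derivative.eval z‖ := by rw [norm_mul, norm_mul]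
        _ ≤ (C * ‖p.eval z‖) * ‖(q - p).eval z‖ + ‖p.eval z‖ * (C' * ‖(q - p).eval z‖) := by gcongr
        _ ≤ _ := by nlinarith [mul_nonneg (norm_nonneg (p.eval z)) h4'.le]
    rw [div_le_iff₀ (by positivity)]
    refine n1.trans (le_of_eq ?_)
    field_simp
  obtain ⟨R, _, hR⟩ := (hasBasis_cobounded_norm (E := ℂ)).eventually_iff.1 ev
  refine ⟨|R| + 1, C + C' + 1, by positivity, by positivity, fun z hz => hR ?_⟩
  show R ≤ ‖z‖
  linarith [le_abs_self R]

theorem count_bound {f H : ℂ → ℂ} (hf : Meromorphic f) (ht : ∀ z, meromorphicOrderAt f z ≠ ⊤)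
    (hnr : {z : ℂ | meromorphicOrderAt f z ≠ 0 ∧ z.im ≠ 0}.Finite)
    (hric : MeroEq (fun z => deriv (LL f) z + LL f z ^ 2)
      (fun z => H z * (deriv (mtilde (LL f)) z + mtilde (LL f) z ^ 2)))
    {p q : Polynomial ℂ} (hq : q ≠ 0) (hQ : q - p ≠ 0) (hH : MeroEq H (fun z => p.eval z / q.eval z))
    (hu : MeroEq (fun z => p.eval z / q.eval z * mtilde (fun z => p.eval z / q.eval z) z) (fun _ => 1)) :
    ∃ C, 0 ≤ C ∧ ∀ t, 1 ≤ t → (({z | meromorphicOrderAt f z ≠ 0} ∩ closedBall (0:ℂ) t).ncard : ℝ) ≤ C * t := by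
  obtain ⟨R0, s, hR0, hs, hdat⟩ := rat_data hq hQ
  have nrm : ∀ x : ℝ, R0 < |x| → R0 < ‖(x : ℂ)‖ := by intro x hx; simpa using hx
  set G : ℂ → ℂ := fun z => p.eval z / (q - p).eval z with hGdef
  have master : ∀ I : Set ℝ, I.OrdConnected → IsOpen I → (∀ x ∈ I, R0 < |x|) → 
    (∀ a ∈ I, ∀ b ∈ I, a < b → meromorphicOrderAt f (a : ℂ) ≠ 0 → meromorphicOrderAt f (b : ℂ) ≠ 0 →
      Real.pi ≤ s * (b - a)) := by
    intro I hI hIo hIR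
    refine (sep_interval (G := G) (s := s) hf ht hric hI ?_ ?_ ?_ hs ?_).2
    · intro x hx
      exact rat_an _ _ (hdat x (nrm x (hIR x hx))).2.1
    · intro x hx
      filter_upwards [hH x, poly_ev_ne hq x, poly_ev_ne hQ x] with w h1 h2 h3
      rw [h1]
      exact rat_G h2 h3
    · intro x hx
      filter_upwards [hIo.mem_nhds hx] with y hy
      have := hdat y (nrm y (hIR y hy))
      exact (rat_re hu this.1 this.2.1).2
    · intro x hx
      exact (hdat x (nrm x (hIR x hx))).2.2
  have hδ : 0 < Real.pi / s := div_pos Real.pi_pos hs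
  set Zp : Set ℝ := {x | R0 < x ∧ meromorphicOrderAt f (x : ℂ) ≠ 0} with hZp
  set Zm : Set ℝ := {x | R0 < x ∧ meromorphicOrderAt f ((-x : ℝ) : ℂ) ≠ 0} with hZm
  have sp : ∀ a ∈ Zp, ∀ b ∈ Zp, a < b → Real.pi / s ≤ b - a := by
    intro a ha b hb hab
    rw [div_le_iff₀' hs]
    exact master (Set.Ioi R0) Set.ordConnected_Ioi isOpen_Ioi (fun x hx => lt_of_lt_of_le hx (le_abs_self x)) a ha.1 b hb.1 hab ha.2 hb.2
  have sm : ∀ a ∈ Zm, ∀ b ∈ Zm, a < b → Real.pi / s ≤ b - a := by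
    intro a ha b hb hab
    rw [div_le_iff₀' hs]
    have := master (Set.Iio (-R0)) Set.ordConnected_Iio isOpen_Iio (fun x hx => by
      have := neg_le_abs x
      have h2 : x < -R0 := hx
      linarith) (-b) (by have := hb.1; simp; linarith) (-a) (by have := ha.1; simp; linarith) (by linarith) hb.2 ha.2
    linarith
  set S := {z | meromorphicOrderAt f z ≠ 0} with hS
  set A := {z : ℂ | meromorphicOrderAt f z ≠ 0 ∧ z.im ≠ 0}
  set n0 : ℝ := (A.ncard : ℝ) + (S ∩ closedBall (0:ℂ) R0).ncard + 2 with hn0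
  have hn0p : 0 ≤ n0 := by positivity
  refine ⟨n0 + 2 * (s / Real.pi), by positivity, fun t ht1 => ?_⟩
  obtain ⟨fp, cp⟩ := sep_count hδ sp (t := t) (by linarith)
  obtain ⟨fm, cm⟩ := sep_count hδ sm (t := t) (by linarith)
  have hfB := S_finite hf ht R0
  have hsub : S ∩ closedBall (0:ℂ) t ⊆ (A ∪ (S ∩ closedBall (0:ℂ) R0)) ∪
      ((fun x : ℝ => (x : ℂ)) '' (Zp ∩ Set.Icc 0 t) ∪ (fun x : ℝ => ((-x : ℝ) : ℂ)) '' (Zm ∩ Set.Icc 0 t)) := by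
    rintro z ⟨h1, h2⟩
    by_cases hi : z.im = 0
    · have hz : z = ((z.re : ℝ) : ℂ) := by apply Complex.ext <;> simp [hi]
      have hn : ‖z‖ = |z.re| := by rw [hz]; simp
      rw [mem_closedBall_zero_iff, hn] at h2
      by_cases hb : |z.re| ≤ R0
      · left; right; exact ⟨h1, by rw [mem_closedBall_zero_iff, hn]; exact hb⟩
      · push Not at hb
        right
        rcases abs_cases z.re with ⟨h, h'⟩ | ⟨h, h'⟩
        · left
          refine ⟨z.re, ⟨⟨by linarith, by rw [← hz]; exact h1⟩, h', by linarith⟩, hz.symm⟩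
        · right
          refine ⟨-z.re, ⟨⟨by linarith, by rw [neg_neg, ← hz]; exact h1⟩, by linarith, by linarith⟩, ?_⟩
          show ((- -z.re : ℝ) : ℂ) = z
          rw [neg_neg]; exact hz.symm
    · left; left; exact ⟨h1, hi⟩
  have hfin : ((A ∪ (S ∩ closedBall (0:ℂ) R0)) ∪
      ((fun x : ℝ => (x : ℂ)) '' (Zp ∩ Set.Icc 0 t) ∪ (fun x : ℝ => ((-x : ℝ) : ℂ)) '' (Zm ∩ Set.Icc 0 t))).Finite :=
    (hnr.union hfB).union ((fp.image _).union (fm.image _))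
  have h1 := Set.ncard_le_ncard hsub hfin
  have h2 := Set.ncard_union_le (A ∪ (S ∩ closedBall (0:ℂ) R0)) ((fun x : ℝ => (x : ℂ)) '' (Zp ∩ Set.Icc 0 t) ∪ (fun x : ℝ => ((-x : ℝ) : ℂ)) '' (Zm ∩ Set.Icc 0 t))
  have h3 := Set.ncard_union_le A (S ∩ closedBall (0:ℂ) R0)
  have h4 := Set.ncard_union_le ((fun x : ℝ => (x : ℂ)) '' (Zp ∩ Set.Icc 0 t)) ((fun x : ℝ => ((-x : ℝ) : ℂ)) '' (Zm ∩ Set.Icc 0 t))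
  have h5 := Set.ncard_image_le (f := fun x : ℝ => (x : ℂ)) fp
  have h6 := Set.ncard_image_le (f := fun x : ℝ => ((-x : ℝ) : ℂ)) fm
  have h7 : (S ∩ closedBall (0:ℂ) t).ncard ≤ A.ncard + (S ∩ closedBall (0:ℂ) R0).ncard + (Zp ∩ Set.Icc 0 t).ncard + (Zm ∩ Set.Icc 0 t).ncard := by omega
  have h8 : ((S ∩ closedBall (0:ℂ) t).ncard : ℝ) ≤ A.ncard + (S ∩ closedBall (0:ℂ) R0).ncard + (Zp ∩ Set.Icc 0 t).ncard + (Zm ∩ Set.Icc 0 t).ncard := by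
    exact_mod_cast h7
  have e : t / (Real.pi / s) = s / Real.pi * t := by field_simp
  rw [e] at cp cm
  have : n0 ≤ n0 * t := by nlinarith
  linarith

end


section
set_option linter.all false
open Complex Filter Topology MeasureTheory
open scoped Classical
open Metric

theorem int_bound {φ : ℝ → ℝ} {C : ℝ} (hC : 0 ≤ C) (h0 : ∀ t, 1 ≤ t → 0 ≤ φ t) (h : ∀ t, 1 ≤ t → φ t ≤ C * t) {r : ℝ} (hr : 1 ≤ r) :
    ∫ t in (1:ℝ)..r, φ t / t ≤ C * r := by
  have h1 : ‖∫ t in (1:ℝ)..r, φ t / t‖ ≤ C * |r - 1| := by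
    apply intervalIntegral.norm_integral_le_of_norm_le_const
    intro t ht
    rw [Set.uIoc_of_le hr] at ht
    have ht1 : 1 ≤ t := ht.1.le
    rw [Real.norm_eq_abs, abs_of_nonneg (div_nonneg (h0 t ht1) (by linarith)), div_le_iff₀ (by linarith)]
    exact h t ht1
  rw [abs_of_nonneg (by linarith)] at h1
  have := (le_abs_self _).trans h1
  nlinarith

theorem distinct_le {f : ℂ → ℂ} (hf : Meromorphic f) (ht : ∀ z, meromorphicOrderAt f z ≠ ⊤) {A : Set ℂ}
    (hA : ∀ z ∈ A, meromorphicOrderAt f z ≠ 0) (t : ℝ) :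
    distinctCount A t ≤ (({z | meromorphicOrderAt f z ≠ 0} ∩ closedBall (0:ℂ) t).ncard : ℝ) := by
  rw [distinctCount]
  exact_mod_cast Set.ncard_le_ncard (Set.inter_subset_inter_left _ hA) (S_finite hf ht t)

theorem Nbar_bound {f : ℂ → ℂ} (hf : Meromorphic f) (ht : ∀ z, meromorphicOrderAt f z ≠ ⊤) {C : ℝ} (hC : 0 ≤ C)
    (hc : ∀ t, 1 ≤ t → (({z | meromorphicOrderAt f z ≠ 0} ∩ closedBall (0:ℂ) t).ncard : ℝ) ≤ C * t) :
    ∀ᶠ r in atTop, NbarPoles f r + NbarZeros f r ≤ (2 * C) * r := by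
  filter_upwards [eventually_ge_atTop 1] with r hr
  have key : ∀ A : Set ℂ, (∀ z ∈ A, meromorphicOrderAt f z ≠ 0) → ∫ t in (1:ℝ)..r, distinctCount A t / t ≤ C * r := by
    intro A hA
    apply int_bound hC _ _ hr
    · intro t _; exact Nat.cast_nonneg _
    · intro t h1; exact (distinct_le hf ht hA t).trans (hc t h1)
  have h1 := key {z | meroOrder f z < 0} (fun z hz => by
    have hz' : meroOrder f z < 0 := hz
    rw [meroOrder_eq (hf z)] at hz'; exact hz'.ne)
  have h2 := key {z | 0 < meroOrder f z} (fun z hz => by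
    have hz' : 0 < meroOrder f z := hz
    rw [meroOrder_eq (hf z)] at hz'; exact hz'.ne')
  unfold NbarPoles NbarZeros
  linarith

theorem LL_ord {f : ℂ → ℂ} (hf : Meromorphic f) (ht : ∀ z, meromorphicOrderAt f z ≠ ⊤) (z : ℂ) :
    (meromorphicOrderAt f z ≠ 0 → meromorphicOrderAt (LL f) z = (-1 : ℤ)) ∧
    (meromorphicOrderAt f z = 0 → 0 ≤ meromorphicOrderAt (LL f) z) := by
  refine ⟨?_, ?_⟩
  · intro h0
    obtain ⟨m, hm⟩ := WithTop.ne_top_iff_exists.1 (ht z)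
    obtain ⟨h, ah, hform⟩ := LL_form hf hm.symm
    rw [meromorphicOrderAt_eq_int_iff (LL_mero f z)]
    refine ⟨fun w => m + (w - z) * h w, analyticAt_const.add ((analyticAt_id.sub analyticAt_const).mul ah), ?_, ?_⟩
    · simp
      rintro rfl
      exact h0 hm.symm
    · filter_upwards [hform, self_mem_nhdsWithin] with w hw hne
      have : w - z ≠ 0 := sub_ne_zero.2 hne
      rw [hw, zpow_neg_one, smul_eq_mul]
      field_simp
  · intro h
    exact (LL_nf f z).meromorphicOrderAt_nonneg_iff_analyticAt.2 (LL_an hf h)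

theorem poleMult_LL {f ℓ : ℂ → ℂ} (hf : Meromorphic f) (ht : ∀ z, meromorphicOrderAt f z ≠ ⊤)
    (hℓ : Meromorphic ℓ) (he : MeroEq (LL f) ℓ) (z : ℂ) :
    poleMult ℓ z = if meromorphicOrderAt f z ≠ 0 then 1 else 0 := by
  rw [poleMult, meroOrder_eq (hℓ z), ← meromorphicOrderAt_congr (he z)]
  split_ifs with h
  · rw [(LL_ord hf ht z).1 h]; rfl
  · push Not at h
    have := (LL_ord hf ht z).2 h
    generalize meromorphicOrderAt (LL f) z = o at *
    cases o with
    | top => rfl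
    | coe n =>
      have hn : 0 ≤ n := by exact_mod_cast this
      simp
      exact hn

theorem poleCount_LL {f ℓ : ℂ → ℂ} (hf : Meromorphic f) (ht : ∀ z, meromorphicOrderAt f z ≠ ⊤)
    (hℓ : Meromorphic ℓ) (he : MeroEq (LL f) ℓ) (t : ℝ) :
    poleCount ℓ t = (({z | meromorphicOrderAt f z ≠ 0} ∩ closedBall (0:ℂ) t).ncard : ℝ) := by
  rw [poleCount]
  have e : ∑ᶠ z ∈ closedBall (0:ℂ) t, (poleMult ℓ z : ℝ) = ∑ᶠ z ∈ {z | meromorphicOrderAt f z ≠ 0} ∩ closedBall (0:ℂ) t, (poleMult ℓ z : ℝ) := by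
    apply finsum_mem_inter_support_eq'
    intro z hz
    rw [Function.mem_support, poleMult_LL hf ht hℓ he] at hz
    have : meromorphicOrderAt f z ≠ 0 := by
      by_contra h
      simp [h] at hz
    simp [this]
  rw [e, finsum_mem_eq_finite_toFinset_sum _ (S_finite hf ht t), Set.ncard_eq_toFinset_card _ (S_finite hf ht t)]
  rw [Finset.card_eq_sum_ones, Nat.cast_sum]
  apply Finset.sum_congr rfl
  intro z hz
  rw [Set.Finite.mem_toFinset] at hz
  have h1 : meromorphicOrderAt f z ≠ 0 := hz.1
  rw [poleMult_LL hf ht hℓ he, if_pos h1]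

theorem NCount_LL {f ℓ : ℂ → ℂ} (hf : Meromorphic f) (ht : ∀ z, meromorphicOrderAt f z ≠ ⊤)
    (hℓ : Meromorphic ℓ) (he : MeroEq (LL f) ℓ) {C : ℝ} (hC : 0 ≤ C)
    (hc : ∀ t, 1 ≤ t → (({z | meromorphicOrderAt f z ≠ 0} ∩ closedBall (0:ℂ) t).ncard : ℝ) ≤ C * t) {r : ℝ} (hr : 1 ≤ r) :
    NCount ℓ r ≤ C * r := by
  apply int_bound hC _ _ hr
  · intro t _; rw [poleCount_LL hf ht hℓ he]; positivity
  · intro t h1; rw [poleCount_LL hf ht hℓ he]; exact hc t h1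

theorem logCounting_LL {f : ℂ → ℂ} (hf : Meromorphic f) (ht : ∀ z, meromorphicOrderAt f z ≠ ⊤) {C : ℝ} (hC : 0 ≤ C)
    (hc : ∀ t, 1 ≤ t → (({z | meromorphicOrderAt f z ≠ 0} ∩ closedBall (0:ℂ) t).ncard : ℝ) ≤ C * t) :
    ∃ C1, ∀ᶠ r in atTop, ValueDistribution.logCounting (LL f) ⊤ r ≤ C1 * (r * Real.log r) := by
  set S := {z | meromorphicOrderAt f z ≠ 0} with hS
  set D := (MeromorphicOn.divisor (LL f) Set.univ)⁻ with hD
  have hmer : MeromorphicOn (LL f) Set.univ := fun z _ => LL_mero f z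
  have Dval : ∀ z, D z = if z ∈ S then 1 else 0 := by
    intro z
    rw [hD, Function.locallyFinsuppWithin.negPart_apply, MeromorphicOn.divisor_apply hmer (Set.mem_univ z)]
    split_ifs with h
    · rw [(LL_ord hf ht z).1 h]; rfl
    · have h' : meromorphicOrderAt f z = 0 := by simpa [hS] using h
      have := (LL_ord hf ht z).2 h'
      have h2 : 0 ≤ (meromorphicOrderAt (LL f) z).untop₀ := by
        exact WithTop.untop₀_nonneg.2 this
      exact negPart_eq_zero.2 h2
  obtain ⟨K, hK⟩ : ∃ K, ∀ z ∈ S, -Real.log ‖z‖ ≤ K := by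
    have hb := ((S_finite hf ht 1).image (fun z => -Real.log ‖z‖)).bddAbove
    obtain ⟨K, hK⟩ := hb
    refine ⟨max K 0, fun z hz => ?_⟩
    by_cases h : ‖z‖ ≤ 1
    · exact (hK ⟨z, ⟨hz, by simpa using h⟩, rfl⟩).trans (le_max_left _ _)
    · push Not at h
      have := Real.log_nonneg h.le
      exact le_trans (by linarith) (le_max_right _ _)
  refine ⟨C * (1 + |K|) + 1, ?_⟩
  filter_upwards [eventually_ge_atTop (Real.exp 1)] with r hr
  have hr1 : 1 ≤ r := le_trans (by have := Real.add_one_le_exp 1; linarith) hr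
  have hlog : 1 ≤ Real.log r := by rw [Real.le_log_iff_exp_le (by linarith)]; exact hr
  rw [ValueDistribution.logCounting_top]
  show ∑ᶠ z, ((Function.locallyFinsuppWithin.toClosedBall r D) z : ℝ) * Real.log (r * ‖z‖⁻¹) + (D 0) * Real.log r ≤ _
  have hfin := S_finite hf ht r
  have hsub : Function.support (fun z => ((Function.locallyFinsuppWithin.toClosedBall r D) z : ℝ) * Real.log (r * ‖z‖⁻¹)) ⊆ (hfin.toFinset : Set ℂ) := by
    intro z hz
    rw [Set.Finite.coe_toFinset]
    have h1 : (Function.locallyFinsuppWithin.toClosedBall r D) z ≠ 0 := by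
      intro h
      apply hz
      show ((Function.locallyFinsuppWithin.toClosedBall r D) z : ℝ) * Real.log (r * ‖z‖⁻¹) = 0
      rw [h, Int.cast_zero, zero_mul]
    have h2 : z ∈ closedBall (0:ℂ) |r| := Function.locallyFinsuppWithin.toClosedBall_support_subset_closedBall D h1
    rw [Function.locallyFinsuppWithin.toClosedBall_eval_within D h2, Dval] at h1
    rw [abs_of_nonneg (by linarith)] at h2
    refine ⟨?_, h2⟩
    by_contra h
    exact h1 (if_neg h)
  rw [finsum_eq_sum_of_support_subset _ hsub]
  have hterm : ∀ z ∈ hfin.toFinset, ((Function.locallyFinsuppWithin.toClosedBall r D) z : ℝ) * Real.log (r * ‖z‖⁻¹) ≤ Real.log r + |K| := by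
    intro z hz
    rw [Set.Finite.mem_toFinset] at hz
    rw [Function.locallyFinsuppWithin.toClosedBall_eval_within D (by rw [abs_of_nonneg (by linarith)]; exact hz.2), Dval, if_pos hz.1]
    rw [Int.cast_one, one_mul]
    by_cases h0 : z = 0
    · rw [h0]; simp
      have := abs_nonneg K
      linarith
    · rw [Real.log_mul (by linarith) (inv_ne_zero (norm_ne_zero_iff.2 h0)), Real.log_inv]
      have := hK z hz.1
      have := le_abs_self K
      linarith
  have h1 := Finset.sum_le_card_nsmul _ _ _ hterm
  rw [← Set.ncard_eq_toFinset_card _ hfin, nsmul_eq_mul] at h1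
  have h2 := hc r hr1
  have h3 : (D 0 : ℝ) * Real.log r ≤ r * Real.log r := by
    rw [Dval]
    split_ifs
    · push_cast; gcongr
    · push_cast; rw [zero_mul]; positivity
  have h4 : Real.log r + |K| ≤ (1 + |K|) * Real.log r := by nlinarith [abs_nonneg K]
  have h5 : ((S ∩ closedBall (0:ℂ) r).ncard : ℝ) * (Real.log r + |K|) ≤ (C * r) * ((1 + |K|) * Real.log r) := by
    gcongr
  calc _ ≤ (C * r) * ((1 + |K|) * Real.log r) + r * Real.log r := by linarith
    _ = _ := by ring

theorem MeroEq.circle {a b : ℂ → ℂ} (h : MeroEq a b) {r : ℝ} (hr : r ≠ 0) :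
    Real.circleAverage (fun z => Real.posLog ‖a z‖) 0 r = Real.circleAverage (fun z => Real.posLog ‖b z‖) 0 r := by
  apply Real.circleAverage_congr_codiscreteWithin _ hr
  have : ∀ᶠ z in codiscreteWithin (sphere (0:ℂ) |r|), a z = b z := by
    rw [Filter.Eventually, mem_codiscreteWithin]
    intro x _
    rw [disjoint_principal_right]
    filter_upwards [h x] with w hw
    simp [hw]
  filter_upwards [this] with z hz
  rw [hz]

theorem prox_eq (h : ℂ → ℂ) (r : ℝ) : proximity h r = Real.circleAverage (fun z => Real.posLog ‖h z‖) 0 r := by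
  rw [proximity, Real.circleAverage, smul_eq_mul]
  congr 1
  apply intervalIntegral.integral_congr
  intro θ _
  simp [logPlus, Real.posLog, circleMap, max_comm]

theorem part1_T {f : ℂ → ℂ} (hf : Meromorphic f) (ht : ∀ z, meromorphicOrderAt f z ≠ ⊤)
    (hnr : {z : ℂ | meromorphicOrderAt f z ≠ 0 ∧ z.im ≠ 0}.Finite)
    (hnr2 : {z : ℂ | meromorphicOrderAt (iteratedDeriv 2 f) z ≠ 0 ∧ z.im ≠ 0}.Finite) {C : ℝ} (hC : 0 ≤ C)
    (hc : ∀ t, 1 ≤ t → (({z | meromorphicOrderAt f z ≠ 0} ∩ closedBall (0:ℂ) t).ncard : ℝ) ≤ C * t) :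
    ∃ C : ℝ, ∀ᶠ r in atTop, TChar (fun z => deriv f z / f z) r ≤ C * (r * Real.log r) := by
  obtain ⟨C1, hC1⟩ := logCounting_LL hf ht hC hc
  obtain ⟨B, hB⟩ := ((hnr.union hnr2).image (fun z => ‖z‖)).bddAbove
  have hB' : ∀ z : ℂ, z.im ≠ 0 → |B| + 1 < ‖z‖ → meromorphicOrderAt f z = 0 ∧ meromorphicOrderAt (iteratedDeriv 2 f) z = 0 := by
    intro z hz hn
    by_contra hcon
    have : ‖z‖ ≤ B := by
      apply hB
      refine ⟨z, ?_, rfl⟩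
      by_cases h : meromorphicOrderAt f z = 0
      · right; exact ⟨fun h2 => hcon ⟨h, h2⟩, hz⟩
      · left; exact ⟨h, hz⟩
    linarith [le_abs_self B]
  have hKne : ∀ z : ℂ, z.im ≠ 0 → |B| + 1 < ‖z‖ → deriv (LL f) z + LL f z ^ 2 ≠ 0 := by
    intro z hz hn
    obtain ⟨o1, o2⟩ := hB' z hz hn
    have aL := LL_an hf o1
    have aK : AnalyticAt ℂ (fun z => deriv (LL f) z + LL f z ^ 2) z := aL.deriv.add (aL.pow 2)
    have hord : meromorphicOrderAt (fun z => deriv (LL f) z + LL f z ^ 2) z = 0 := by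
      rw [meromorphicOrderAt_congr (LL_K hf ht z)]
      have := meromorphicOrderAt_mul (mero_iter2 hf z) ((hf z).inv)
      rw [meromorphicOrderAt_inv, o1, o2] at this
      rw [show (fun z => iteratedDeriv 2 f z / f z) = iteratedDeriv 2 f * f⁻¹ from by ext; simp [div_eq_mul_inv], this]
      rfl
    rw [aK.meromorphicOrderAt_eq] at hord
    have : analyticOrderAt (fun z => deriv (LL f) z + LL f z ^ 2) z = 0 := by
      generalize analyticOrderAt (fun z => deriv (LL f) z + LL f z ^ 2) z = o at *
      cases o with
      | top => simp at hord
      | coe n => simpa using hord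
    exact aK.analyticOrderAt_eq_zero.1 this
  obtain ⟨C2, hC2⟩ := prox_bound (LL_mero f) (r0 := |B| + 1) (by positivity)
    (fun z hz hn => LL_an hf (hB' z hz hn).1) hKne hC1
  refine ⟨C2 + C, ?_⟩
  filter_upwards [hC2, eventually_ge_atTop (Real.exp 1)] with r h1 hr
  have hr1 : 1 ≤ r := le_trans (by have := Real.add_one_le_exp 1; linarith) hr
  have hlog : 1 ≤ Real.log r := by rw [Real.le_log_iff_exp_le (by linarith)]; exact hr
  rw [TChar, prox_eq, ← (LL_eq hf).circle (by linarith)]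
  have := NCount_LL hf ht (logd_mero hf) (LL_eq hf) hC hc hr1
  have h3 : C * r ≤ C * (r * Real.log r) := by
    gcongr; nlinarith
  linarith

end


section
set_option linter.all false
open Complex Filter Topology MeasureTheory
open scoped Classical
open Metric

theorem re_bound {S : ℂ → ℂ} (hS : Differentiable ℂ S) {R : ℝ} (hR : 0 < R) {w : ℂ} (hw : ‖w‖ ≤ R / 2) :
    (S w).re ≤ 3 * Real.circleAverage (fun z => max (S z).re 0) 0 R := by
  have hwb : w ∈ ball (0:ℂ) R := by rw [mem_ball_zero_iff]; linarith
  have hh : InnerProductSpace.HarmonicOnNhd (fun z => (S z).re) (closedBall 0 R) := by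
    intro z hz
    exact (hS.analyticAt z).harmonicAt_re
  have hP := hh.circleAverage_re_herglotzRieszKernel_smul hwb
  have hc : Continuous S := hS.continuous
  have hmax : Continuous fun z => max (S z).re 0 := (Complex.continuous_re.comp hc).max continuous_const
  have e : 3 * Real.circleAverage (fun z => max (S z).re 0) 0 R = Real.circleAverage (fun z => (3:ℝ) • max (S z).re 0) 0 R := by
    rw [Real.circleAverage_fun_smul]; rfl
  change _ = (S w).re at hP
  rw [e, ← hP]
  have hk := continuousOn_herglotzRieszKernel_sphere (c := (0:ℂ)) hwb
  apply Real.circleAverage_mono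
  · apply ContinuousOn.circleIntegrable'
    exact (Complex.continuous_re.comp_continuousOn hk).smul (Complex.continuous_re.comp hc).continuousOn
  · apply ContinuousOn.circleIntegrable'
    exact (hmax.const_smul (3:ℝ)).continuousOn
  · intro z hz
    rw [abs_of_pos hR] at hz
    have h1 := re_herglotzRieszKernel_le hz hwb
    have h2 := le_re_herglotzRieszKernel hz hwb
    simp only [Pi.smul_apply', Function.comp, smul_eq_mul, herglotzRieszKernel_def]
    simp only [sub_zero] at h1 h2 ⊢
    have h3 : (R + ‖w‖) / (R - ‖w‖) ≤ 3 := by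
      rw [div_le_iff₀ (by linarith)]; linarith
    have h4 : 0 ≤ (R - ‖w‖) / (R + ‖w‖) := div_nonneg (by linarith) (by positivity)
    set k := ((z + w) / (z - w)).re
    calc k * (S z).re ≤ k * max (S z).re 0 := by gcongr; linarith; exact le_max_left _ _
      _ ≤ 3 * max (S z).re 0 := by
        apply mul_le_mul_of_nonneg_right (by linarith) (le_max_right _ _)

theorem poly_of_growth {S : ℂ → ℂ} (hS : Differentiable ℂ S) {C : ℝ}
    (h : ∃ᶠ r in atTop, Real.circleAverage (fun z => max (S z).re 0) 0 r ≤ r ^ C) :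
    ∃ p : Polynomial ℂ, ∀ z, S z = p.eval z := by
  obtain ⟨N, hN⟩ := exists_nat_gt C
  have hz : ∀ n, N < n → iteratedDeriv n S 0 = 0 := by
    intro n hn
    by_contra hne
    have hpos : 0 < ‖iteratedDeriv n S 0‖ := norm_pos_iff.2 hne
    set K : ℝ := n.factorial * (6 + 3 * ‖S 0‖) * 4 ^ n with hK
    have hKpos : 0 < K := by positivity
    obtain ⟨r, h1, hr⟩ := (h.and_eventually (eventually_gt_atTop (max 1 (K / ‖iteratedDeriv n S 0‖)))).exists
    have hr1 : 1 < r := lt_of_le_of_lt (le_max_left _ _) hr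
    have hr2 := lt_of_le_of_lt (le_max_right _ _) hr
    have hr0 : 0 < r := by linarith
    have hrC : r ^ C ≤ r ^ N := by
      rw [← Real.rpow_natCast]; exact Real.rpow_le_rpow_of_exponent_le hr1.le hN.le
    have hb : ∀ z ∈ sphere (0:ℂ) (r / 4), ‖S z‖ ≤ (6 + 3 * ‖S 0‖) * r ^ N := by
      intro z hz
      have hzn : ‖z‖ = r / 4 := by simpa using hz
      have := Complex.borelCaratheodory (M := 3 * r ^ N) (R := r / 2) (by positivity) hS.differentiableOn (f := S) (z := z) ?_ (by positivity) ?_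
      · have e1 : r / 2 - ‖z‖ = r / 4 := by rw [hzn]; ring
        rw [e1, hzn] at this
        have e2 : 2 * (3 * r ^ N) * (r / 4) / (r / 4) + ‖S 0‖ * (r / 2 + r / 4) / (r / 4) = 6 * r ^ N + 3 * ‖S 0‖ := by
          field_simp; ring
        rw [e2] at this
        have : 1 ≤ r ^ N := one_le_pow₀ hr1.le
        nlinarith [norm_nonneg (S 0)]
      · intro w hw
        have hw' : ‖w‖ < r / 2 := by simpa using hw
        have := re_bound hS hr0 hw'.le
        show (S w).re ≤ _
        linarith
      · rw [mem_ball_zero_iff, hzn]; linarith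
    have := Complex.norm_iteratedDeriv_le_of_forall_mem_sphere_norm_le n (by positivity : 0 < r / 4) hS.diffContOnCl hb
    have e3 : n.factorial * ((6 + 3 * ‖S 0‖) * r ^ N) / (r / 4) ^ n = K * (r ^ N / r ^ n) := by
      rw [hK, div_pow]; field_simp
    rw [e3] at this
    have h5 : r ^ N / r ^ n ≤ 1 / r := by
      rw [div_le_div_iff₀ (by positivity) hr0, one_mul, ← pow_succ]
      exact pow_le_pow_right₀ hr1.le hn
    have h6 : ‖iteratedDeriv n S 0‖ ≤ K * (1 / r) := this.trans (by gcongr)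
    rw [div_lt_iff₀ hpos] at hr2
    rw [mul_one_div, le_div_iff₀ hr0] at h6
    linarith
  refine ⟨∑ n ∈ Finset.range (N + 1), Polynomial.monomial n ((n.factorial : ℂ)⁻¹ * iteratedDeriv n S 0), fun z => ?_⟩
  rw [← Complex.taylorSeries_eq_of_entire' 0 z hS, tsum_eq_sum (s := Finset.range (N + 1))]
  · simp [Polynomial.eval_finset_sum]
  · intro n hn
    rw [hz n (by simpa using hn)]; simp

end


section
set_option linter.all false
open Complex Filter Topology MeasureTheory
open scoped Classical
open Metric

theorem nhdsNE_eq_at {a b : ℂ → ℂ} {z : ℂ} (h : ∀ᶠ w in 𝓝[≠] z, a w = b w) (ha : ContinuousAt a z) (hb : ContinuousAt b z) :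
    a z = b z := by
  have h1 := ha.tendsto.mono_left (nhdsWithin_le_nhds (s := {z}ᶜ))
  have h2 := hb.tendsto.mono_left (nhdsWithin_le_nhds (s := {z}ᶜ))
  exact tendsto_nhds_unique_of_eventuallyEq h1 h2 h

theorem K_ne {f : ℂ → ℂ} (hf : Meromorphic f) (ht : ∀ z, meromorphicOrderAt f z ≠ ⊤) {z : ℂ}
    (o1 : meromorphicOrderAt f z = 0) (o2 : meromorphicOrderAt (iteratedDeriv 2 f) z = 0) :
    AnalyticAt ℂ (fun z => deriv (LL f) z + LL f z ^ 2) z ∧ deriv (LL f) z + LL f z ^ 2 ≠ 0 := by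
  have aL := LL_an hf o1
  have aK : AnalyticAt ℂ (fun z => deriv (LL f) z + LL f z ^ 2) z := aL.deriv.add (aL.pow 2)
  have hord : meromorphicOrderAt (fun z => deriv (LL f) z + LL f z ^ 2) z = 0 := by
    rw [meromorphicOrderAt_congr (LL_K hf ht z)]
    have := meromorphicOrderAt_mul (mero_iter2 hf z) ((hf z).inv)
    rw [meromorphicOrderAt_inv, o1, o2] at this
    rw [show (fun z => iteratedDeriv 2 f z / f z) = iteratedDeriv 2 f * f⁻¹ from by ext; simp [div_eq_mul_inv], this]
    rfl
  rw [aK.meromorphicOrderAt_eq] at hord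
  have : analyticOrderAt (fun z => deriv (LL f) z + LL f z ^ 2) z = 0 := by
    generalize analyticOrderAt (fun z => deriv (LL f) z + LL f z ^ 2) z = o at *
    cases o with
    | top => simp at hord
    | coe n => simpa using hord
  exact ⟨aK, aK.analyticOrderAt_eq_zero.1 this⟩

theorem H_const {f H : ℂ → ℂ} (hf : Meromorphic f) (ht : ∀ z, meromorphicOrderAt f z ≠ ⊤)
    (hric : MeroEq (fun z => deriv (LL f) z + LL f z ^ 2)
      (fun z => H z * (deriv (mtilde (LL f)) z + mtilde (LL f) z ^ 2)))
    (hu : MeroEq (fun z => H z * mtilde H z) (fun _ => 1))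
    (ho : ∀ z : ℂ, z.im ≠ 0 → meromorphicOrderAt f z = 0 ∧ meromorphicOrderAt (iteratedDeriv 2 f) z = 0)
    (hr : IsRatFn H) : ∃ c : ℂ, MeroEq H (fun _ => c) := by
  obtain ⟨p0, q0, hq0, hH0⟩ := hr
  obtain ⟨p, q, hq, hco, hH⟩ : ∃ p q : Polynomial ℂ, q ≠ 0 ∧ IsCoprime p q ∧ MeroEq H (fun z => p.eval z / q.eval z) := by
    set g := EuclideanDomain.gcd p0 q0 with hg
    have hg0 : g ≠ 0 := fun h => hq0 (EuclideanDomain.gcd_eq_zero_iff.1 h).2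
    obtain ⟨p, hp⟩ : g ∣ p0 := EuclideanDomain.gcd_dvd_left _ _
    obtain ⟨q, hq⟩ : g ∣ q0 := EuclideanDomain.gcd_dvd_right _ _
    refine ⟨p, q, ?_, ?_, ?_⟩
    · rintro rfl; apply hq0; rw [hq, mul_zero]
    · have := EuclideanDomain.gcd_eq_gcd_ab p0 q0
      rw [← hg] at this
      generalize EuclideanDomain.gcdA p0 q0 = u at this
      generalize EuclideanDomain.gcdB p0 q0 = v at this
      refine ⟨u, v, ?_⟩
      apply mul_left_cancel₀ hg0
      conv_rhs => rw [mul_one, this, hp, hq]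
      ring
    · intro z
      filter_upwards [hH0 z, poly_ev_ne hg0 z] with w h1 h2
      rw [h1, hp, hq, Polynomial.eval_mul, Polynomial.eval_mul, mul_div_mul_left _ _ h2]
  have hnoroot : ∀ z, q.eval z = 0 → p.eval z ≠ 0 := by
    intro z h1 h2
    obtain ⟨u, v, h⟩ := hco
    have := congrArg (Polynomial.eval z) h
    simp [h1, h2] at this
  have ctil : ∀ a : Polynomial ℂ, Continuous (mtilde (fun z => a.eval z)) := fun a =>
    Complex.continuous_conj.comp (a.continuous.comp Complex.continuous_conj)
  have hid : ∀ z, p.eval z * mtilde (fun z => p.eval z) z = q.eval z * mtilde (fun z => q.eval z) z := by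
    intro z
    refine nhdsNE_eq_at (a := fun z => p.eval z * mtilde (fun z => p.eval z) z) 
      (b := fun z => q.eval z * mtilde (fun z => q.eval z) z) ?_ (p.continuous.mul (ctil p)).continuousAt (q.continuous.mul (ctil q)).continuousAt
    filter_upwards [hu z, hH z, hH.mtilde z, poly_ev_ne hq z, (conj_tendsto_NE z).eventually (poly_ev_ne hq _)] with w h1 h2 h3 h4 h5
    rw [h2, h3] at h1
    simp only [mtilde, map_div₀] at h1 ⊢
    have h6 : (starRingEnd ℂ) (q.eval ((starRingEnd ℂ) w)) ≠ 0 := by simpa using h5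
    field_simp at h1
    exact h1
  have q0 : ∀ z, q.eval z ≠ 0 := by
    intro z hz
    have hpz := hnoroot z hz
    by_cases him : z.im = 0
    · have hc : (starRingEnd ℂ) z = z := Complex.conj_eq_iff_im.2 him
      have := hid z
      rw [hz, zero_mul] at this
      simp [mtilde, hc, hpz] at this
    · obtain ⟨aK, _⟩ := K_ne hf ht (ho z him).1 (ho z him).2
      have him' : ((starRingEnd ℂ) z).im ≠ 0 := by simpa using him
      obtain ⟨aK', hK'⟩ := K_ne hf ht (ho _ him').1 (ho _ him').2
      have aKt := mtilde_analyticAt aK'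
      have := nhdsNE_eq_at (z := z) (a := fun w => q.eval w * (deriv (LL f) w + LL f w ^ 2))
        (b := fun w => p.eval w * mtilde (fun z => deriv (LL f) z + LL f z ^ 2) w) ?_ 
        (q.continuous.continuousAt.mul aK.continuousAt) (p.continuous.continuousAt.mul aKt.continuousAt)
      · simp only [hz, zero_mul] at this
        rcases mul_eq_zero.1 this.symm with h | h
        · exact hpz h
        · apply hK'
          exact (map_eq_zero (starRingEnd ℂ)).1 h
      · filter_upwards [hric z, hH z, poly_ev_ne hq z] with w h1 h2 h3
        rw [h1, h2, mtilde_K]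
        field_simp
  have p0 : ∀ z, p.eval z ≠ 0 := by
    intro z hz
    have := hid z
    rw [hz, zero_mul] at this
    rcases mul_eq_zero.1 this.symm with h | h
    · exact q0 _ h
    · exact q0 _ (by simpa [mtilde] using h)
  have cst : ∀ a : Polynomial ℂ, (∀ z, a.eval z ≠ 0) → ∃ c, a = Polynomial.C c := by
    intro a ha
    by_cases hd : a.degree = 0
    · exact ⟨_, Polynomial.eq_C_of_degree_eq_zero hd⟩
    · obtain ⟨x, hx⟩ := IsAlgClosed.exists_root a hd
      exact absurd hx (ha x)
  obtain ⟨a, rfl⟩ := cst p p0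
  obtain ⟨b, rfl⟩ := cst q q0
  exact ⟨a / b, by simpa using hH⟩

theorem ord_const {f H : ℂ → ℂ} (hf : Meromorphic f) (ht : ∀ z, meromorphicOrderAt f z ≠ ⊤)
    (hric : MeroEq (fun z => deriv (LL f) z + LL f z ^ 2)
      (fun z => H z * (deriv (mtilde (LL f)) z + mtilde (LL f) z ^ 2)))
    (ho : ∀ z : ℂ, z.im ≠ 0 → meromorphicOrderAt f z = 0)
    {c : ℂ} (hH : MeroEq H (fun _ => c)) (hc1 : c ≠ 1) (hc : c * (starRingEnd ℂ) c = 1) :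
    ∃ (e : ℕ) (a : ℝ), e ≤ 1 ∧ meromorphicOrderAt f (a : ℂ) = e ∧ ∀ z : ℂ, z ≠ a → meromorphicOrderAt f z = 0 := by
  have h1c : 1 - c ≠ 0 := sub_ne_zero.2 hc1.symm
  have key : ∀ s : ℝ, 0 < s → _ := fun s hs => sep_interval (G := fun _ => c / (1 - c)) (s := s) (I := Set.univ) hf ht hric
    Set.ordConnected_univ (fun _ _ => analyticAt_const) (fun x _ => by
      filter_upwards [hH x] with w hw
      rw [hw]; field_simp) (fun x _ => Eventually.of_forall fun y => by
      have h2 : (c / (1 - c)) + (starRingEnd ℂ) (c / (1 - c)) = -1 := by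
        have : (starRingEnd ℂ) (1 - c) ≠ 0 := (map_ne_zero (starRingEnd ℂ)).2 h1c
        rw [map_div₀]
        field_simp
        simp only [map_sub, map_one]
        linear_combination -hc
      rw [Complex.add_conj] at h2
      have h3 : 2 * (c / (1 - c)).re = -1 := by exact_mod_cast h2
      show (c / (1 - c)).re = _
      linarith) hs (fun x _ => by simp; positivity)
  have k1 := (key 1 one_pos).1
  by_cases hex : ∃ a : ℝ, meromorphicOrderAt f (a : ℂ) ≠ 0
  · obtain ⟨a, ha⟩ := hex
    refine ⟨1, a, le_rfl, by simpa using (k1 a trivial).resolve_left ha, fun z hz => ?_⟩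
    by_cases him : z.im = 0
    · by_contra hne
      have hzr : ((z.re : ℝ) : ℂ) = z := by apply Complex.ext <;> simp [him]
      rw [← hzr] at hne hz
      have hne2 : z.re ≠ a := fun h => hz (by rw [h])
      have aux : ∀ u v : ℝ, u < v → meromorphicOrderAt f (u:ℂ) ≠ 0 → meromorphicOrderAt f (v:ℂ) ≠ 0 → False := by
        intro u v huv hu hv
        have := (key (1 / (v - u)) (by have := sub_pos.2 huv; positivity)).2 u trivial v trivial huv hu hv
        rw [one_div_mul_cancel (sub_pos.2 huv).ne'] at this
        linarith [Real.pi_gt_three]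
      rcases lt_or_gt_of_ne hne2 with h | h
      · exact aux _ _ h hne ha
      · exact aux _ _ h ha hne
    · exact ho z him
  · push Not at hex
    have hall : ∀ z, meromorphicOrderAt f z = 0 := by
      intro z
      by_cases him : z.im = 0
      · have hzr : ((z.re : ℝ) : ℂ) = z := by apply Complex.ext <;> simp [him]
        rw [← hzr]; exact hex _
      · exact ho z him
    exact ⟨0, 0, by norm_num, by simpa using hall 0, fun z _ => hall z⟩

end


section
set_option linter.all false
open Complex Filter Topology MeasureTheory
open scoped Classical
open Metric

theorem NF_eq {k : ℂ → ℂ} (hk : Meromorphic k) : MeroEq (toMeromorphicNFOn k Set.univ) k := by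
  intro z
  have h := toMeromorphicNFOn_eqOn_codiscrete (U := Set.univ) (fun x _ => hk x)
  have := mem_codiscreteWithin.1 h z (Set.mem_univ z)
  rw [← Set.compl_eq_univ_diff, disjoint_principal_right, compl_compl] at this
  filter_upwards [this] with w hw
  exact hw.symm

theorem entire_log {h : ℂ → ℂ} (hd : Differentiable ℂ h) (h0 : ∀ z, h z ≠ 0) :
    ∃ S : ℂ → ℂ, Differentiable ℂ S ∧ ∀ z, h z = Complex.exp (S z) := by
  have hdd : Differentiable ℂ (deriv h) := fun z => (hd.analyticAt z).deriv.differentiableAt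
  obtain ⟨s, hs⟩ := (hdd.div hd h0).isExactOn_univ
  have hs' : ∀ z, HasDerivAt s (deriv h z / h z) z := fun z => hs z trivial
  have hc : ∀ z, HasDerivAt (fun z => h z * Complex.exp (- s z)) 0 z := by
    intro z
    have := (hd z).hasDerivAt.mul (hs' z).neg.cexp
    convert! this using 1
    have := h0 z
    simp only [Pi.neg_apply]
    field_simp
    ring
  have hk : ∀ z, h z * Complex.exp (- s z) = h 0 * Complex.exp (- s 0) := fun z =>
    is_const_of_deriv_eq_zero (fun z => (hc z).differentiableAt) (fun z => (hc z).deriv) z 0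
  set k := h 0 * Complex.exp (- s 0)
  have hk0 : k ≠ 0 := mul_ne_zero (h0 0) (Complex.exp_ne_zero _)
  refine ⟨fun z => s z + Complex.log k, fun z => (hs' z).differentiableAt.add_const _, fun z => ?_⟩
  rw [Complex.exp_add, Complex.exp_log hk0, ← hk z, mul_comm (h z), ← mul_assoc, ← Complex.exp_add]
  simp

theorem NCount_nonneg (h : ℂ → ℂ) {r : ℝ} (hr : 1 ≤ r) : 0 ≤ NCount h r := by
  apply intervalIntegral.integral_nonneg hr
  intro t ht
  apply div_nonneg _ (by linarith [ht.1])
  exact finsum_nonneg fun z => finsum_nonneg fun _ => Nat.cast_nonneg _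

theorem poly_exp {f : ℂ → ℂ} (hf : Meromorphic f) {e : ℕ} {a : ℂ} (hea : meromorphicOrderAt f a = e)
    (ho : ∀ z, z ≠ a → meromorphicOrderAt f z = 0) (hlow : FiniteLowerOrder f) :
    ∃ S : Polynomial ℂ, MeroEq f (fun z => (z - a) ^ e * Complex.exp (S.eval z)) := by
  set k : ℂ → ℂ := fun z => f z * ((z - a) ^ e)⁻¹ with hk
  have hkm : Meromorphic k := fun z => (hf z).mul (((analyticAt_id.sub analyticAt_const).pow e).meromorphicAt.inv)
  set h := toMeromorphicNFOn k Set.univ with hh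
  have hnf : ∀ z, MeromorphicNFAt h z := fun z => meromorphicNFOn_toMeromorphicNFOn _ _ (Set.mem_univ z)
  have heq : MeroEq h k := NF_eq hkm
  have hord : ∀ z, meromorphicOrderAt h z = 0 := by
    intro z
    rw [meromorphicOrderAt_congr (heq z)]
    refine (meromorphicOrderAt_eq_int_iff (hkm z) (n := 0)).2 ?_
    by_cases hz : z = a
    · subst hz
      obtain ⟨g, ga, g0, hg⟩ := (meromorphicOrderAt_eq_int_iff (hf z) (n := e)).1 (by simpa using hea)
      refine ⟨g, ga, g0, ?_⟩
      filter_upwards [hg, self_mem_nhdsWithin] with w h1 h2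
      have : w - z ≠ 0 := sub_ne_zero.2 h2
      simp only [hk, h1, zpow_natCast, smul_eq_mul, zpow_zero, one_mul]
      field_simp
    · obtain ⟨g, ga, g0, hg⟩ := (meromorphicOrderAt_eq_int_iff (hf z) (n := 0)).1 (by simpa using ho z hz)
      have hza : (z - a) ^ e ≠ 0 := pow_ne_zero _ (sub_ne_zero.2 hz)
      refine ⟨fun w => g w * ((w - a) ^ e)⁻¹, ga.mul (((analyticAt_id.sub analyticAt_const).pow e).inv hza), mul_ne_zero g0 (inv_ne_zero hza), ?_⟩
      filter_upwards [hg] with w h1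
      simp [hk, h1]
  have hd : Differentiable ℂ h := fun z => ((hnf z).meromorphicOrderAt_nonneg_iff_analyticAt.1 (hord z).ge).differentiableAt
  have h0 : ∀ z, h z ≠ 0 := fun z => (hnf z).meromorphicOrderAt_eq_zero_iff.1 (hord z)
  obtain ⟨S, hS, hSe⟩ := entire_log hd h0
  have hfe : MeroEq f (fun z => (z - a) ^ e * Complex.exp (S z)) := by
    intro z
    have hne : ∀ᶠ w in 𝓝[≠] z, w - a ≠ 0 := by
      by_cases hz : z = a
      · subst hz; filter_upwards [self_mem_nhdsWithin] with w hw using sub_ne_zero.2 hw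
      · have : ∀ᶠ w in 𝓝 z, w ≠ a := continuousAt_id.eventually_ne hz
        filter_upwards [this.filter_mono nhdsWithin_le_nhds] with w hw using sub_ne_zero.2 hw
    filter_upwards [heq z, hne] with w h1 h2
    rw [← hSe, h1, hk]
    field_simp
  obtain ⟨C, hC⟩ := hlow
  have hgr : ∃ᶠ r in atTop, Real.circleAverage (fun z => max (S z).re 0) 0 r ≤ r ^ C := by
    refine (hC.and_eventually (eventually_ge_atTop (‖a‖ + 1))).mono ?_
    rintro r ⟨h1, h2⟩
    have hr1 : 1 ≤ r := by linarith [norm_nonneg a]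
    have h3 := NCount_nonneg f hr1
    rw [TChar, prox_eq, hfe.circle (by linarith)] at h1
    refine le_trans ?_ (show _ ≤ r ^ C from le_trans (le_add_of_nonneg_right h3) h1)
    apply Real.circleAverage_mono
    · exact ((Complex.continuous_re.comp hS.continuous).max continuous_const).continuousOn.circleIntegrable'
    · apply ContinuousOn.circleIntegrable'
      apply Continuous.continuousOn
      have : Continuous fun z => (z - a) ^ e * Complex.exp (S z) := 
        ((continuous_id.sub continuous_const).pow e).mul (Complex.continuous_exp.comp hS.continuous)
      exact Real.continuous_posLog.comp this.norm
    · intro z hz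
      have hz' : ‖z‖ = r := by simpa [abs_of_nonneg (by linarith : 0 ≤ r)] using hz
      have hge : 1 ≤ ‖(z - a) ^ e‖ := by
        rw [norm_pow]
        apply one_le_pow₀
        have := norm_sub_norm_le z a
        linarith
      have : Real.posLog ‖Complex.exp (S z)‖ = max (S z).re 0 := by
        show max 0 (Real.log _) = _
        rw [Complex.norm_exp, Real.log_exp, max_comm]
      show _ ≤ Real.posLog ‖(z - a) ^ e * Complex.exp (S z)‖
      rw [← this]
      apply Real.posLog_le_posLog (norm_nonneg _)
      rw [norm_mul]
      exact le_mul_of_one_le_left (norm_nonneg _) hge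
  obtain ⟨p, hp⟩ := poly_of_growth hS hgr
  refine ⟨p, ?_⟩
  simpa only [hp] using hfe

end


section
set_option linter.all false
open Complex Filter Topology MeasureTheory
open scoped Classical
open Metric

theorem alg_AB {A B : Polynomial ℂ} {a : ℂ} {e : ℕ} (he : e ≤ 1) (hAB : A ≠ B)
    (h : (Polynomial.X - Polynomial.C a) * (A.derivative + B.derivative + 2 * (A * B)) + 2 * (e : Polynomial ℂ) * (A + B) = 0) :
    e = 0 ∧ A.derivative = 0 ∧ B.derivative = 0 := by
  have hX : (Polynomial.X - Polynomial.C a) ≠ 0 := Polynomial.X_sub_C_ne_zero a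
  have hz : A * B = 0 := by
    by_contra hne
    have hA : A ≠ 0 := left_ne_zero_of_mul hne
    have hB : B ≠ 0 := right_ne_zero_of_mul hne
    have hN : (A * B).natDegree = A.natDegree + B.natDegree := Polynomial.natDegree_mul hA hB
    have h1 : (Polynomial.X - Polynomial.C a) * (A * B) = Polynomial.C (-1/2) * ((Polynomial.X - Polynomial.C a) * (A.derivative + B.derivative)) - (e : Polynomial ℂ) * (A + B) := by
      have h2 : (Polynomial.C (-1/2) : Polynomial ℂ) * 2 = -1 := by
        rw [show (2 : Polynomial ℂ) = Polynomial.C 2 from rfl, ← Polynomial.C_mul]; norm_num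
      linear_combination (-Polynomial.C (-1/2)) * h + ((Polynomial.X - Polynomial.C a) * (A * B) + e * (A + B)) * h2
    have d1 : ((Polynomial.X - Polynomial.C a) * (A * B)).natDegree = A.natDegree + B.natDegree + 1 := by
      rw [Polynomial.natDegree_mul hX hne, hN, Polynomial.natDegree_X_sub_C]; ring
    have dd : ∀ P : Polynomial ℂ, P.natDegree ≤ A.natDegree + B.natDegree → ((Polynomial.X - Polynomial.C a) * P.derivative).natDegree ≤ A.natDegree + B.natDegree := by
      intro P hP
      by_cases hP0 : P.natDegree = 0
      · rw [Polynomial.derivative_of_natDegree_zero hP0]; simp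
      · refine Polynomial.natDegree_mul_le.trans ?_
        rw [Polynomial.natDegree_X_sub_C]
        have := Polynomial.natDegree_derivative_lt hP0
        omega
    have d2 : (Polynomial.C (-1/2) * ((Polynomial.X - Polynomial.C a) * (A.derivative + B.derivative)) - (e : Polynomial ℂ) * (A + B)).natDegree ≤ A.natDegree + B.natDegree := by
      refine (Polynomial.natDegree_sub_le _ _).trans (max_le ?_ ?_)
      · refine (Polynomial.natDegree_C_mul_le _ _).trans ?_
        rw [mul_add]
        exact (Polynomial.natDegree_add_le _ _).trans (max_le (dd A (by omega)) (dd B (by omega)))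
      · rw [← Polynomial.C_eq_natCast]
        refine (Polynomial.natDegree_C_mul_le _ _).trans ?_
        exact (Polynomial.natDegree_add_le _ _).trans (max_le (by omega) (by omega))
    rw [← h1, d1] at d2
    omega
  have h' : (Polynomial.X - Polynomial.C a) * (A + B).derivative + 2 * (e : Polynomial ℂ) * (A + B) = 0 := by
    rw [hz] at h
    rw [Polynomial.derivative_add]
    simpa using h
  have hT : A + B ≠ 0 := by
    intro hT
    have hB : B = -A := by linear_combination hT
    rw [hB] at hz
    have : A = 0 := by simpa using hz
    apply hAB; rw [hB, this]; simp
  have he0 : e = 0 := by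
    by_contra hne
    have : e = 1 := by omega
    subst this
    have hd : ((Polynomial.X - Polynomial.C a) ^ 2 * (A + B)).derivative = 0 := by
      simp only [Polynomial.derivative_mul, Polynomial.derivative_pow, Polynomial.derivative_sub, Polynomial.derivative_X, Polynomial.derivative_C]
      push_cast at h'
      have : (Polynomial.C ((2 : ℕ) : ℂ)) = 2 := by rfl
      rw [this]
      linear_combination (Polynomial.X - Polynomial.C a) * h'
    have := Polynomial.natDegree_eq_zero_of_derivative_eq_zero hd
    rw [Polynomial.natDegree_mul (pow_ne_zero _ hX) hT, Polynomial.natDegree_pow, Polynomial.natDegree_X_sub_C] at this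
    omega
  subst he0
  have hTd : (A + B).derivative = 0 := by
    simp only [Nat.cast_zero, mul_zero, zero_mul, add_zero] at h'
    exact (mul_eq_zero.1 h').resolve_left hX
  refine ⟨rfl, ?_⟩
  rcases mul_eq_zero.1 hz with h0 | h0
  · subst h0; simpa using hTd
  · subst h0; simpa using hTd

theorem tilde_poly (p : Polynomial ℂ) (z : ℂ) : (starRingEnd ℂ) (p.eval ((starRingEnd ℂ) z)) = (p.map (starRingEnd ℂ)).eval z := by
  have := Polynomial.eval₂_at_apply (p := p) (starRingEnd ℂ) ((starRingEnd ℂ) z)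
  rw [← this, Polynomial.eval_map, Complex.conj_conj]

theorem final {f H : ℂ → ℂ} (hf : Meromorphic f) (hs : StrictlyNonReal f)
    (hric : MeroEq (fun z => deriv (LL f) z + LL f z ^ 2)
      (fun z => H z * (deriv (mtilde (LL f)) z + mtilde (LL f) z ^ 2)))
    {c : ℂ} (hH : MeroEq H (fun _ => c)) (hc1 : c ≠ 1) (hc0 : c ≠ 0) {e : ℕ} {a : ℝ} (he : e ≤ 1)
    {S : Polynomial ℂ} (hfe : MeroEq f (fun z => (z - a) ^ e * Complex.exp (S.eval z))) :
    ∃ A₁ B₁ : ℂ, MeroEq f (fun z => Complex.exp (A₁ * z + B₁)) := by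
  have h1c : 1 - c ≠ 0 := sub_ne_zero.2 hc1.symm
  set l := S.derivative with hl
  set m := l.map (starRingEnd ℂ) with hm
  have hlm : l ≠ m := by
    intro h
    apply hs
    have hd : (S.map (starRingEnd ℂ) - S).derivative = 0 := by
      rw [Polynomial.derivative_sub, Polynomial.derivative_map, ← hl, ← hm, ← h, sub_self]
    have hk := Polynomial.eq_C_of_natDegree_eq_zero (Polynomial.natDegree_eq_zero_of_derivative_eq_zero hd)
    set k := (S.map (starRingEnd ℂ) - S).coeff 0
    refine ⟨Complex.exp k, fun z => ?_⟩
    filter_upwards [hfe z, hfe.mtilde z] with w h1 h2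
    rw [h2, h1]
    have h3 := congrArg (Polynomial.eval w) hk
    rw [Polynomial.eval_sub, Polynomial.eval_C, sub_eq_iff_eq_add] at h3
    simp only [mtilde, map_mul, map_pow, map_sub, Complex.conj_conj, Complex.conj_ofReal, ← Complex.exp_conj]
    rw [tilde_poly, h3, Complex.exp_add]
    ring
  set L : ℂ → ℂ := fun w => e / (w - a) + l.eval w with hL
  set M : ℂ → ℂ := fun w => e / (w - a) + m.eval w with hM
  have hLL : MeroEq (LL f) L := by
    intro z
    have hne : ∀ᶠ w in 𝓝[≠] z, (Polynomial.X - Polynomial.C (a : ℂ)).eval w ≠ 0 := poly_ev_ne (Polynomial.X_sub_C_ne_zero _) z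
    filter_upwards [LL_eq hf z, hfe z, hfe.deriv z, hne] with w h1 h2 h3 h4
    have h4' : w - a ≠ 0 := by simpa using h4
    have hd : HasDerivAt (fun z : ℂ => (z - a) ^ e * Complex.exp (S.eval z)) ((e * (w - a) ^ (e - 1) * 1) * Complex.exp (S.eval w) + (w - a) ^ e * (Complex.exp (S.eval w) * l.eval w)) w := 
      (((hasDerivAt_id w).sub_const (a:ℂ)).pow e).mul (S.hasDerivAt w).cexp
    rw [h1, h3, h2, hd.deriv]
    have := Complex.exp_ne_zero (S.eval w)
    simp only [hL]
    interval_cases e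
    · simp
    · simp; field_simp
  have hMM : MeroEq (mtilde (LL f)) M := by
    intro z
    filter_upwards [hLL.mtilde z] with w h1
    rw [h1]
    simp only [hL, hM, mtilde, map_add, map_div₀, map_sub, Complex.conj_conj, Complex.conj_ofReal, tilde_poly, ← hm]
    simp
  set g := c / (1 - c) with hg
  have hgg : g + g ^ 2 ≠ 0 := by
    have : g + g ^ 2 = c / (1 - c) ^ 2 := by rw [hg]; field_simp; ring
    rw [this]; exact div_ne_zero hc0 (pow_ne_zero _ h1c)
  obtain ⟨s, hss⟩ := IsAlgClosed.exists_pow_nat_eq (g + g ^ 2) (n := 2) (by norm_num)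
  have hs0 : s ≠ 0 := by rintro rfl; apply hgg; rw [← hss]; ring
  set v := l + Polynomial.C g * (l - m) with hv
  have hpoly : (Polynomial.X - Polynomial.C (a:ℂ)) * (v.derivative + v ^ 2 - Polynomial.C (s ^ 2) * (l - m) ^ 2) + 2 * (e : Polynomial ℂ) * v = 0 := by
    have mL : ∀ p : Polynomial ℂ, MeromorphicAt (fun w : ℂ => (e:ℂ) / (w - a) + p.eval w) 0 := by
      intro p
      have ap : AnalyticAt ℂ (fun w => p.eval w) 0 := (p.differentiable).analyticAt 0
      exact ((MeromorphicAt.const _ _).div ((MeromorphicAt.id _).sub (MeromorphicAt.const _ _))).add ap.meromorphicAt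
    have hr0 : ∀ᶠ w in 𝓝[≠] (0:ℂ), deriv L w + L w ^ 2 = H w * (deriv M w + M w ^ 2) := by
      filter_upwards [hric 0, hLL 0, hLL.deriv 0, hMM 0, hMM.deriv 0] with w h1 h2 h3 h4 h5
      rw [← h2, ← h3, ← h4, ← h5, h1]
    have hG : ∀ᶠ w in 𝓝[≠] (0:ℂ), (fun _ => g) w * (1 - H w) = H w := by
      filter_upwards [hH 0] with w hw
      simp only [hw, hg]; field_simp
    have key := ric_id (mL l) (mL m) hr0 (analyticAt_const) hG
    have hne : ∀ᶠ w in 𝓝[≠] (0:ℂ), (Polynomial.X - Polynomial.C (a : ℂ)).eval w ≠ 0 := poly_ev_ne (Polynomial.X_sub_C_ne_zero _) 0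
    apply Polynomial.eq_of_infinite_eval_eq
    have hev : ∀ᶠ w in 𝓝[≠] (0:ℂ), w ∈ {x : ℂ | Polynomial.eval x ((Polynomial.X - Polynomial.C (a:ℂ)) * (v.derivative + v ^ 2 - Polynomial.C (s ^ 2) * (l - m) ^ 2) + 2 * (e : Polynomial ℂ) * v) = Polynomial.eval x 0} := by
      filter_upwards [key, hne] with w h1 h2
      have h2' : w - a ≠ 0 := by simpa using h2
      have hV : (fun z => L z + g * (L z - M z)) = fun z => (e:ℂ) / (z - a) + v.eval z := by
        ext z; simp only [hL, hM, hv, Polynomial.eval_add, Polynomial.eval_mul, Polynomial.eval_sub, Polynomial.eval_C]; ring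
      have hd : HasDerivAt (fun z : ℂ => (e:ℂ) / (z - a) + v.eval z) ((0 * (w - a) - e * 1) / (w - a) ^ 2 + v.derivative.eval w) w :=
        ((hasDerivAt_const w (e:ℂ)).div ((hasDerivAt_id w).sub_const (a:ℂ)) h2').add (v.hasDerivAt w)
      have hVw := congrFun hV w
      change deriv (fun z => L z + g * (L z - M z)) w + (L w + g * (L w - M w)) ^ 2 = deriv (fun _ => g) w * (L w - M w) + (g + g ^ 2) * (L w - M w) ^ 2 at h1
      rw [hVw, hV, hd.deriv, deriv_const, ← hss] at h1
      have hLM : L w - M w = (l - m).eval w := by simp [hL, hM]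
      rw [hLM] at h1
      simp only [Set.mem_ofPred_eq, Polynomial.eval_add, Polynomial.eval_mul, Polynomial.eval_sub, Polynomial.eval_C, Polynomial.eval_pow, Polynomial.eval_X, Polynomial.eval_natCast, Polynomial.eval_ofNat, Polynomial.eval_zero] at h1 ⊢
      interval_cases e
      · simp at h1 ⊢
        right
        linear_combination h1
      · simp only [Nat.cast_one] at h1 ⊢
        field_simp at h1
        have h3 : (w - a) * ((w - a) * (Polynomial.eval w (Polynomial.derivative v) + Polynomial.eval w v ^ 2 - s ^ 2 * (Polynomial.eval w l - Polynomial.eval w m) ^ 2) + 2 * 1 * Polynomial.eval w v) = 0 := by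
          linear_combination h1
        exact (mul_eq_zero.1 h3).resolve_left h2'
    have hinf : ∃ᶠ w in 𝓝[≠] (0:ℂ), w ∈ {x : ℂ | Polynomial.eval x ((Polynomial.X - Polynomial.C (a:ℂ)) * (v.derivative + v ^ 2 - Polynomial.C (s ^ 2) * (l - m) ^ 2) + 2 * (e : Polynomial ℂ) * v) = Polynomial.eval x 0} := hev.frequently
    have : {x : ℂ | Polynomial.eval x ((Polynomial.X - Polynomial.C (a:ℂ)) * (v.derivative + v ^ 2 - Polynomial.C (s ^ 2) * (l - m) ^ 2) + 2 * (e : Polynomial ℂ) * v) = Polynomial.eval x 0} ∈ 𝓝[≠] (0:ℂ) := hev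
    exact fun hfin => infinite_of_mem_nhds 0 (insert_mem_nhds_iff.2 this) (hfin.insert 0)
  have hA := alg_AB (A := v - Polynomial.C s * (l - m)) (B := v + Polynomial.C s * (l - m)) (a := a) he ?_ ?_
  · obtain ⟨he0, dA, dB⟩ := hA
    subst he0
    have hC2 : (Polynomial.C s : Polynomial ℂ) ≠ 0 := by simpa using hs0
    simp only [Polynomial.derivative_sub, Polynomial.derivative_add, Polynomial.derivative_mul, Polynomial.derivative_C, zero_mul, zero_add] at dA dB
    have dv : v.derivative = 0 := by
      have : (2:Polynomial ℂ) * v.derivative = 0 := by linear_combination dA + dB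
      simpa using this
    have dd : l.derivative - m.derivative = 0 := by
      rw [dv, zero_add] at dB
      exact (mul_eq_zero.1 dB).resolve_left hC2
    have dl : l.derivative = 0 := by
      have : l.derivative = v.derivative - Polynomial.C g * (l.derivative - m.derivative) := by
        rw [hv]; simp
      rw [this, dv, dd]; simp
    obtain hlC := Polynomial.eq_C_of_natDegree_eq_zero (Polynomial.natDegree_eq_zero_of_derivative_eq_zero dl)
    have dS : (S - Polynomial.C (l.coeff 0) * Polynomial.X).derivative = 0 := by
      rw [Polynomial.derivative_sub, ← hl]
      rw [show Polynomial.derivative (Polynomial.C (l.coeff 0) * Polynomial.X) = Polynomial.C (l.coeff 0) by simp, ← hlC, sub_self]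
    have hSC := Polynomial.eq_C_of_natDegree_eq_zero (Polynomial.natDegree_eq_zero_of_derivative_eq_zero dS)
    refine ⟨l.coeff 0, (S - Polynomial.C (l.coeff 0) * Polynomial.X).coeff 0, fun z => ?_⟩
    filter_upwards [hfe z] with w hw
    rw [hw, pow_zero, one_mul]
    congr 1
    have := congrArg (Polynomial.eval w) hSC
    rw [Polynomial.eval_C, Polynomial.eval_sub, Polynomial.eval_mul, Polynomial.eval_C, Polynomial.eval_X] at this
    rw [← this]; ring
  · intro h
    have h3 : Polynomial.C s * (l - m) = 0 := by
      have : (2:Polynomial ℂ) * (Polynomial.C s * (l - m)) = 0 := by linear_combination -h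
      simpa using this
    rcases mul_eq_zero.1 h3 with h4 | h4
    · exact hs0 (by simpa using h4)
    · exact hlm (sub_eq_zero.1 h4)
  · rw [Polynomial.C_pow] at hpoly
    rw [← Polynomial.derivative_add]
    have : v - Polynomial.C s * (l - m) + (v + Polynomial.C s * (l - m)) = 2 * v := by ring
    rw [this]
    simp only [Polynomial.derivative_mul, Polynomial.derivative_ofNat]
    linear_combination 2 * hpoly

end


set_option linter.all false
open Complex Filter Topology MeasureTheory
open scoped Classical
open Metric

theorem statement_19 (f : ℂ → ℂ) (hmero : ∀ z, MeromorphicAt f z)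
    (hsnr : StrictlyNonReal f)
    (hzp : {z : ℂ | (0 < meroOrder f z ∨ meroOrder f z < 0) ∧ z.im ≠ 0}.Finite)
    (hzp'' : {z : ℂ | (0 < meroOrder (iteratedDeriv 2 f) z ∨
        meroOrder (iteratedDeriv 2 f) z < 0) ∧ z.im ≠ 0}.Finite)
    (H : ℂ → ℂ) (hHmero : ∀ z, MeromorphicAt H z)
    (hHz : {z : ℂ | 0 < meroOrder H z}.Finite) (hHp : {z : ℂ | meroOrder H z < 0}.Finite)
    (hHeq : MeroEq (fun z => iteratedDeriv 2 f z / f z)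
      (fun z => H z * (iteratedDeriv 2 (mtilde f) z / mtilde f z)))
    (hH1 : ¬ MeroEq H (fun _ => 1))
    (hHrat : IsRatFn H) :
    ((∃ C : ℝ, ∀ᶠ r in atTop, NbarPoles f r + NbarZeros f r ≤ C * r) ∧
      (∃ C : ℝ, ∀ᶠ r in atTop,
        TChar (fun z => deriv f z / f z) r ≤ C * (r * Real.log r))) ∧
    (FiniteLowerOrder f →
      (∀ z : ℂ, (0 < meroOrder f z ∨ meroOrder f z < 0) → z.im = 0) →
      (∀ z : ℂ, (0 < meroOrder (iteratedDeriv 2 f) z ∨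
          meroOrder (iteratedDeriv 2 f) z < 0) → z.im = 0) →
      ∃ A₁ B₁ : ℂ, MeroEq f (fun z => Complex.exp (A₁ * z + B₁))) := by
  have hf : Meromorphic f := hmero
  have ht : ∀ z, meromorphicOrderAt f z ≠ ⊤ := ord_f_ne_top hf hsnr
  have ht2 : ∀ z, meromorphicOrderAt (iteratedDeriv 2 f) z ≠ ⊤ := ord_f2_ne_top hf hzp''
  have e1 : ∀ z, (0 < meroOrder f z ∨ meroOrder f z < 0) ↔ meromorphicOrderAt f z ≠ 0 := by
    intro z
    rw [meroOrder_eq (hf z), ne_iff_lt_or_gt, or_comm]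
  have e2 : ∀ z, (0 < meroOrder (iteratedDeriv 2 f) z ∨ meroOrder (iteratedDeriv 2 f) z < 0) ↔
      meromorphicOrderAt (iteratedDeriv 2 f) z ≠ 0 := by
    intro z
    rw [meroOrder_eq (mero_iter2 hf z), ne_iff_lt_or_gt, or_comm]
  have hric := LL_ric hf ht hHeq
  have hunit := H_unit hf ht ht2 hHeq
  have hnr : {z : ℂ | meromorphicOrderAt f z ≠ 0 ∧ z.im ≠ 0}.Finite := by
    simpa only [e1] using hzp
  have hnr2 : {z : ℂ | meromorphicOrderAt (iteratedDeriv 2 f) z ≠ 0 ∧ z.im ≠ 0}.Finite := by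
    simpa only [e2] using hzp''
  refine ⟨?_, ?_⟩
  · obtain ⟨p, q, hq, hH⟩ := hHrat
    have hQ : q - p ≠ 0 := by
      intro h
      have hqp : q = p := sub_eq_zero.1 h
      subst hqp
      apply hH1
      intro z
      filter_upwards [hH z, poly_ev_ne hq z] with w h1 h2
      rw [h1, div_self h2]
    have hu : MeroEq (fun z => p.eval z / q.eval z * mtilde (fun z => p.eval z / q.eval z) z) (fun _ => 1) := by
      intro z
      filter_upwards [hunit z, hH z, hH.mtilde z] with w h1 h2 h3
      rw [← h2, ← h3, h1]
    obtain ⟨C, hC, hc⟩ := count_bound hf ht hnr hric hq hQ hH hu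
    exact ⟨⟨2 * C, Nbar_bound hf ht hC hc⟩, part1_T hf ht hnr hnr2 hC hc⟩
  · intro hlow hr1 hr2
    have ho : ∀ z : ℂ, z.im ≠ 0 → meromorphicOrderAt f z = 0 ∧ meromorphicOrderAt (iteratedDeriv 2 f) z = 0 := by
      intro z hz
      constructor
      · by_contra h
        exact hz (hr1 z ((e1 z).2 h))
      · by_contra h
        exact hz (hr2 z ((e2 z).2 h))
    obtain ⟨c, hc⟩ := H_const hf ht hric hunit ho hHrat
    have hc1 : c ≠ 1 := by
      rintro rfl
      exact hH1 hc
    have hcc : c * (starRingEnd ℂ) c = 1 := by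
      obtain ⟨w, h1, h2, h3⟩ := ((hunit 0).and ((hc 0).and (hc.mtilde 0))).exists
      beta_reduce at h1
      rw [h2, h3] at h1
      exact h1
    have hc0 : c ≠ 0 := by
      rintro rfl
      simp at hcc
    obtain ⟨e, a, he, hea, hoa⟩ := ord_const hf ht hric (fun z hz => (ho z hz).1) hc hc1 hcc
    obtain ⟨S, hS⟩ := poly_exp hf hea hoa hlow
    exact final hf hsnr hric hc hc1 hc0 he hS
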